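/- Let 1<p<∞ and let w be a weight on ℝⁿ belonging to A_p^{(s)}(ℝⁿ). Then there exists a constant c depending only on n and p such that the n-dimensional Hilbert transform (Hilbert transform with product kernel) satisfies ‖H^{(n)}f‖_{L^p_w(ℝⁿ)} ≤ c (‖w‖_{A_p(x_1)} ⋯ ‖w‖_{A_p(x_n)})^{max{1, p'/p}} ‖f‖_{L^p_w(ℝⁿ)} for all f ∈ L^p_w(ℝⁿ). Moreover the power max{1, p'/p} is sharp. -/

import Mathlib

open MeasureTheory Set Filter
open scoped ENNReal

noncomputable section

/-- `∫_a^b w` as a lower integral. -/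
def lintIoc (w : ℝ → ℝ) (a b : ℝ) : ℝ≥0∞ :=
  ∫⁻ t in Set.Ioc a b, ENNReal.ofReal (w t)

/-- Average `(1/(b-a)) ∫_a^b w`. -/
def avgIoc (w : ℝ → ℝ) (a b : ℝ) : ℝ≥0∞ :=
  (ENNReal.ofReal (b - a))⁻¹ * lintIoc w a b

/-- The (two-sided) Muckenhoupt `A_p` characteristic of a function of one variable:
`sup_I ((1/|I|)∫_I u)((1/|I|)∫_I u^{1-p'})^{p-1}`, sup over bounded intervals. -/
def apChar (p : ℝ) (u : ℝ → ℝ) : ℝ≥0∞ :=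
  ⨆ (a : ℝ) (b : ℝ) (_ : a < b),
    avgIoc u a b * avgIoc (fun t => u t ^ (1 - p / (p - 1))) a b ^ (p - 1)

/-- `A_p` characteristic of `w : ℝⁿ → ℝ` in the `i`-th variable, uniformly
(essential supremum) with respect to the remaining variables. -/
def apVar {n : ℕ} (p : ℝ) (w : (Fin n → ℝ) → ℝ) (i : Fin n) : ℝ≥0∞ :=
  essSup (fun x : Fin n → ℝ => apChar p (fun t => w (Function.update x i t)))
    MeasureTheory.volume

/-- A weight on `ℝⁿ`: a.e. positive and locally integrable. -/
def IsWeightN {n : ℕ} (w : (Fin n → ℝ) → ℝ) : Prop :=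
  (∀ᵐ x : Fin n → ℝ, 0 < w x) ∧ MeasureTheory.LocallyIntegrable w MeasureTheory.volume

/-- Weighted `L^p(ℝⁿ)` "norm" `(∫ g^p w)^{1/p}` of an `ℝ≥0∞`-valued function. -/
def lnormWN {n : ℕ} (p : ℝ) (w : (Fin n → ℝ) → ℝ) (g : (Fin n → ℝ) → ℝ≥0∞) : ℝ≥0∞ :=
  (∫⁻ x : Fin n → ℝ, g x ^ p * ENNReal.ofReal (w x)) ^ (1 / p)

/-- Truncated `n`-dimensional Hilbert transform with truncation parameters `ε i`. -/
def truncHilb (n : ℕ) (f : (Fin n → ℝ) → ℝ) (ε : Fin n → ℝ) (x : Fin n → ℝ) : ℝ :=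
  ∫ t in {t : Fin n → ℝ | ∀ i, ε i < |x i - t i|}, f t / ∏ i, (x i - t i)

/-- `L` is the principal value of the `n`-dimensional Hilbert transform of `f` at `x`:
the truncated integrals converge to `L` as all `εᵢ → 0⁺`. -/
def HasHilbPV (n : ℕ) (f : (Fin n → ℝ) → ℝ) (x : Fin n → ℝ) (L : ℝ) : Prop :=
  Filter.Tendsto (fun ε : Fin n → ℝ => truncHilb n f ε x)
    (Filter.pi fun _ : Fin n => nhdsWithin 0 (Set.Ioi 0)) (nhds L)


def cauF (f : ℝ → ℝ) (z : ℂ) : ℂ := ∫ t : ℝ, (f t : ℂ) / (z - (t : ℂ))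

lemma cau_norm_ge (z : ℂ) (t : ℝ) : |z.im| ≤ ‖z - (t : ℂ)‖ := by
  have := Complex.abs_im_le_norm (z - (t : ℂ))
  simpa using this

lemma cau_ne (z : ℂ) (hz : 0 < z.im) (t : ℝ) : z - (t : ℂ) ≠ 0 := by
  intro h
  have := cau_norm_ge z t
  rw [h, norm_zero, abs_of_pos hz] at this
  linarith

lemma cau_aesm {f : ℝ → ℝ} (hf : Integrable f) (z : ℂ) :
    AEStronglyMeasurable (fun t : ℝ => (f t : ℂ) / (z - (t : ℂ))) volume := by
  apply AEStronglyMeasurable.div₀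
  · exact (hf.ofReal (𝕜 := ℂ)).aestronglyMeasurable
  · exact (continuous_const.sub Complex.continuous_ofReal).aestronglyMeasurable

lemma cau_norm_le {f : ℝ → ℝ} (z : ℂ) (hz : 0 < z.im) (t : ℝ) :
    ‖(f t : ℂ) / (z - (t : ℂ))‖ ≤ |f t| / z.im := by
  rw [norm_div, Complex.norm_real, Real.norm_eq_abs]
  have := cau_norm_ge z t
  rw [abs_of_pos hz] at this
  gcongr

lemma cau_int {f : ℝ → ℝ} (hf : Integrable f) (z : ℂ) (hz : 0 < z.im) :
    Integrable (fun t : ℝ => (f t : ℂ) / (z - (t : ℂ))) := by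
  refine Integrable.mono' (hf.abs.div_const z.im) (cau_aesm hf z) ?_
  exact Eventually.of_forall fun t => cau_norm_le z hz t

lemma cauF_norm_le {f : ℝ → ℝ} (hf : Integrable f) (z : ℂ) (hz : 0 < z.im) :
    ‖cauF f z‖ ≤ (∫ t, |f t|) / z.im := by
  unfold cauF
  rw [← integral_div]
  exact norm_integral_le_of_norm_le (hf.abs.div_const z.im)
    (Eventually.of_forall fun t => cau_norm_le z hz t)

lemma cauF_im {f : ℝ → ℝ} (hf : Integrable f) (h0 : ∀ t, 0 ≤ f t) (z : ℂ) (hz : 0 < z.im) :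
    (cauF f z).im ≤ 0 := by
  unfold cauF
  have := integral_im (cau_int hf z hz)
  simp only [RCLike.im_to_complex] at this
  rw [← this]
  apply integral_nonpos
  intro t
  simp only [Pi.zero_apply]
  rw [div_eq_mul_inv, Complex.im_ofReal_mul, Complex.inv_im]
  simp only [Complex.sub_im, Complex.ofReal_im, sub_zero]
  have := Complex.normSq_nonneg (z - (t : ℂ))
  apply mul_nonpos_of_nonneg_of_nonpos (h0 t)
  exact div_nonpos_of_nonpos_of_nonneg (by linarith) this

lemma cauF_diff {f : ℝ → ℝ} (hf : Integrable f) (z : ℂ) (hz : 0 < z.im) :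
    DifferentiableAt ℂ (cauF f) z := by
  have hs : {w : ℂ | z.im / 2 < w.im} ∈ nhds z := by
    apply (isOpen_lt continuous_const Complex.continuous_im).mem_nhds
    simp; linarith
  have := hasDerivAt_integral_of_dominated_loc_of_deriv_le (μ := volume) (x₀ := z)
    (F := fun w t => (f t : ℂ) / (w - (t : ℂ)))
    (F' := fun w t => -(f t : ℂ) / (w - (t : ℂ))^2)
    (bound := fun t => |f t| / (z.im/2)^2) hs
    (Eventually.of_forall fun w => cau_aesm hf w) (cau_int hf z hz) ?_ ?_ ?_ ?_
  · exact this.2.differentiableAt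
  · apply AEStronglyMeasurable.div₀
    · exact (hf.ofReal (𝕜 := ℂ)).aestronglyMeasurable.neg
    · exact ((continuous_const.sub Complex.continuous_ofReal).pow 2).aestronglyMeasurable
  · refine Eventually.of_forall fun t w hw => ?_
    simp only [mem_ofPred_eq] at hw
    rw [norm_div, norm_neg, Complex.norm_real, Real.norm_eq_abs, norm_pow]
    have := cau_norm_ge w t
    rw [abs_of_pos (by linarith)] at this
    have h2 : z.im/2 ≤ ‖w - (t : ℂ)‖ := by linarith
    gcongr
  · exact hf.abs.div_const _
  · refine Eventually.of_forall fun t w hw => ?_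
    simp only [mem_ofPred_eq] at hw
    have h1 : HasDerivAt (fun w : ℂ => w - (t : ℂ)) 1 w := (hasDerivAt_id w).sub_const _
    have := (hasDerivAt_const w (f t : ℂ)).div h1 (cau_ne w (by linarith) t)
    exact this.congr_deriv (by simp)

/-- real part of the Moebius image -/
lemma mob_re (l : ℝ) (hl : 0 < l) (w : ℂ) (hw : w.im ≤ 0) :
    0 ≤ (w / (w - l * Complex.I)).re ∧ (l ≤ ‖w‖ → 1/2 ≤ (w / (w - l * Complex.I)).re) := by
  have e : (w / (w - l * Complex.I)).re
      = (w.re^2 + w.im * (w.im - l)) / (w.re^2 + (w.im - l)^2) := by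
    rw [Complex.div_re]
    simp [Complex.normSq_apply]
    ring
  have hpos : 0 < w.re^2 + (w.im - l)^2 := by nlinarith [sq_nonneg w.re]
  rw [e]
  constructor
  · apply div_nonneg _ hpos.le
    nlinarith [sq_nonneg w.re]
  · intro h
    rw [div_le_div_iff₀ (by norm_num) hpos]
    have h2 : l^2 ≤ w.re^2 + w.im^2 := by
      have : ‖w‖^2 = w.re^2+w.im^2 := by
        rw [← Complex.normSq_eq_norm_sq, Complex.normSq_apply]; ring
      rw [← this]; gcongr
    nlinarith

lemma mob_ne (l : ℝ) (hl : 0 < l) (w : ℂ) (hw : w.im ≤ 0) : l ≤ ‖w - l * Complex.I‖ := by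
  have := Complex.abs_im_le_norm (w - l * Complex.I)
  simp at this
  rw [abs_of_neg (by linarith)] at this
  linarith

def cauU (f : ℝ → ℝ) (l : ℝ) (z : ℂ) : ℝ := (cauF f z / (cauF f z - l * Complex.I)).re

lemma cauU_circ {f : ℝ → ℝ} (hf : Integrable f) (h0 : ∀ t, 0 ≤ f t) {ε l R : ℝ} (hε : 0 < ε)
    (hl : 0 < l) (hR : 0 < R) :
    R * ∫ θ in (0:ℝ)..2*Real.pi, cauU f l (circleMap (((ε + R : ℝ) : ℂ) * Complex.I) R θ)
      ≤ 2 * Real.pi * ((∫ t, f t) / l) := by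
  set c : ℂ := ((ε + R : ℝ) : ℂ) * Complex.I with hc
  have him : c.im = ε + R := by simp [hc]
  have hball : ∀ z ∈ Metric.closedBall c R, 0 < z.im := by
    intro z hz
    have h1 := Complex.abs_im_le_norm (z - c)
    rw [Metric.mem_closedBall, dist_eq_norm] at hz
    have h2 := abs_le.1 (h1.trans hz)
    simp only [Complex.sub_im, him] at h2
    linarith [h2.1]
  have hd : ∀ z ∈ Metric.closedBall c R,
      DifferentiableAt ℂ (fun z => cauF f z / (cauF f z - l * Complex.I)) z := by
    intro z hz
    have hz' := hball z hz
    apply (cauF_diff hf z hz').div ((cauF_diff hf z hz').sub_const _)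
    intro h
    have := mob_ne l hl _ (cauF_im hf h0 z hz')
    rw [h, norm_zero] at this; linarith
  have hmv : Real.circleAverage (fun z => cauF f z / (cauF f z - l * Complex.I)) c R
      = cauF f c / (cauF f c - l * Complex.I) := by
    apply DiffContOnCl.circleAverage
    rw [abs_of_pos hR]
    apply DifferentiableOn.diffContOnCl
    intro z hz
    exact (hd z (Metric.closure_ball_subset_closedBall hz)).differentiableWithinAt
  have hcont : Continuous fun θ : ℝ =>
      (fun z => cauF f z / (cauF f z - l * Complex.I)) (circleMap c R θ) := by
    rw [continuous_iff_continuousAt]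
    intro θ
    exact (hd _ (circleMap_mem_closedBall c hR.le θ)).continuousAt.comp
      (continuous_circleMap c R).continuousAt
  have hre : ∫ θ in (0:ℝ)..2*Real.pi, cauU f l (circleMap c R θ)
      = (∫ θ in (0:ℝ)..2*Real.pi,
          (fun z => cauF f z / (cauF f z - l * Complex.I)) (circleMap c R θ)).re := by
    exact Complex.reCLM.intervalIntegral_comp_comm (hcont.intervalIntegrable _ _)
  rw [Real.circleAverage_def] at hmv
  have hI : (∫ θ in (0:ℝ)..2*Real.pi,
          (fun z => cauF f z / (cauF f z - l * Complex.I)) (circleMap c R θ))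
      = (2 * Real.pi) • (cauF f c / (cauF f c - l * Complex.I)) := by
    rw [← hmv, smul_smul, mul_inv_cancel₀ (by positivity), one_smul]
  rw [hre, hI, Complex.smul_re, smul_eq_mul]
  have hb : (cauF f c / (cauF f c - l * Complex.I)).re ≤ (∫ t, f t) / (ε + R) / l := by
    refine (Complex.re_le_norm _).trans ?_
    rw [norm_div]
    have hcim : 0 < c.im := by rw [him]; linarith
    have h1 := cauF_norm_le hf c hcim
    have h2 := mob_ne l hl _ (cauF_im hf h0 c hcim)
    rw [him] at h1
    simp only [abs_of_nonneg (h0 _)] at h1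
    gcongr
    exact le_trans (norm_nonneg _) h1
  have hI0 : 0 ≤ ∫ t, f t := integral_nonneg h0
  calc R * (2 * Real.pi * (cauF f c / (cauF f c - l * Complex.I)).re)
      ≤ R * (2 * Real.pi * ((∫ t, f t) / (ε + R) / l)) := by gcongr
    _ = 2 * Real.pi * ((∫ t, f t) / l) * (R / (ε + R)) := by
        field_simp
    _ ≤ 2 * Real.pi * ((∫ t, f t) / l) * 1 := by
        gcongr
        rw [div_le_one (by linarith)]; linarith
    _ = _ := by ring

lemma cauU_cont {f : ℝ → ℝ} (hf : Integrable f) (h0 : ∀ t, 0 ≤ f t) {l : ℝ} (hl : 0 < l)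
    (z : ℂ) (hz : 0 < z.im) : ContinuousAt (cauU f l) z := by
  apply Complex.continuous_re.continuousAt.comp
  have h := (cauF_diff hf z hz).continuousAt
  apply h.div (h.sub continuousAt_const)
  intro h
  change cauF f z - l * Complex.I = 0 at h
  have := mob_ne l hl _ (cauF_im hf h0 z hz)
  rw [h, norm_zero] at this; linarith

lemma circ_tend (ε s : ℝ) : Tendsto (fun n : ℕ => circleMap (((ε + ((n:ℝ)+1) : ℝ) : ℂ) * Complex.I)
    ((n:ℝ)+1) (-(Real.pi/2) + s / ((n:ℝ)+1))) atTop (nhds ((s : ℂ) + ε * Complex.I)) := by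
  have hd : HasDerivAt (fun y : ℝ => Complex.exp (((s * y : ℝ) : ℂ) * Complex.I)) (s * Complex.I) 0 := by
    have h1 : HasDerivAt (fun y : ℝ => ((s * y : ℝ) : ℂ) * Complex.I) (s * Complex.I) 0 := by
      have := ((hasDerivAt_id (0:ℝ)).const_mul s).ofReal_comp.mul_const Complex.I
      simpa using this
    have := h1.cexp
    simpa using this
  have h2 := hd.tendsto_slope_zero
  have h3 : Tendsto (fun n : ℕ => (1:ℝ) / ((n:ℝ)+1)) atTop (nhdsWithin 0 {0}ᶜ) := by
    apply tendsto_nhdsWithin_iff.2 ⟨tendsto_one_div_add_atTop_nhds_zero_nat, ?_⟩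
    refine Eventually.of_forall fun n => ?_
    have : (0:ℝ) < 1 / ((n:ℝ)+1) := by positivity
    simpa using (by positivity : ((n:ℝ)+1) ≠ 0)
  have h4 := h2.comp h3
  have h5 := (h4.const_mul (-Complex.I)).const_add (ε * Complex.I)
  have e : (ε:ℂ) * Complex.I + -Complex.I * (s * Complex.I) = (s : ℂ) + ε * Complex.I := by
    linear_combination (-(s:ℂ)) * Complex.I_mul_I
  rw [e] at h5
  refine h5.congr fun n => ?_
  have hn : ((n:ℂ)+1) ≠ 0 := by exact_mod_cast (by positivity : ((n:ℝ)+1) ≠ 0)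
  simp only [Function.comp, circleMap, zero_add, mul_zero, Complex.ofReal_zero, zero_mul,
    Complex.exp_zero]
  have e2 : Complex.exp (((-(Real.pi/2) + s / ((n:ℝ)+1) : ℝ) : ℂ) * Complex.I)
      = -Complex.I * Complex.exp (((s * (1 / ((n:ℝ)+1)) : ℝ) : ℂ) * Complex.I) := by
    have : ((-(Real.pi/2) + s / ((n:ℝ)+1) : ℝ) : ℂ) * Complex.I
      = -(Real.pi/2*Complex.I) + ((s * (1 / ((n:ℝ)+1)) : ℝ) : ℂ) * Complex.I := by
      push_cast; ring
    rw [this, Complex.exp_add, Complex.exp_neg, Complex.exp_pi_div_two_mul_I, Complex.inv_I]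
  rw [e2]
  simp only [Complex.real_smul]
  push_cast
  field_simp
  ring

lemma circ_im (ε R θ : ℝ) (hε : 0 < ε) (hR : 0 < R) :
    0 < (circleMap (((ε + R : ℝ) : ℂ) * Complex.I) R θ).im := by
  have h : (circleMap (((ε + R : ℝ) : ℂ) * Complex.I) R θ).im = ε + R + R * Real.sin θ := by
    simp [circleMap, Complex.exp_ofReal_mul_I_im]
  rw [h]
  nlinarith [Real.neg_one_le_sin θ]

lemma cau_weak {f : ℝ → ℝ} (hf : Integrable f) (h0 : ∀ t, 0 ≤ f t) {ε l : ℝ} (hε : 0 < ε)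
    (hl : 0 < l) :
    volume {x : ℝ | l ≤ ‖cauF f ((x:ℂ) + ε * Complex.I)‖}
      ≤ ENNReal.ofReal (4 * Real.pi * ((∫ t, f t) / l)) := by
  set z : ℕ → ℝ → ℂ := fun n s => circleMap (((ε + ((n:ℝ)+1) : ℝ) : ℂ) * Complex.I)
    ((n:ℝ)+1) (-(Real.pi/2) + s / ((n:ℝ)+1)) with hz
  set B : ℝ := 2 * Real.pi * ((∫ t, f t) / l) with hB
  have hu0 : ∀ w : ℂ, 0 < w.im → 0 ≤ cauU f l w := fun w hw =>
    (mob_re l hl _ (cauF_im hf h0 w hw)).1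
  have hzim : ∀ n s, 0 < (z n s).im := fun n s => circ_im _ _ _ hε (by positivity)
  have hzc : ∀ n, Continuous fun s => cauU f l (z n s) := by
    intro n
    rw [continuous_iff_continuousAt]
    intro s
    apply (cauU_cont hf h0 hl _ (hzim n s)).comp
    apply Continuous.continuousAt
    exact (continuous_circleMap _ _).comp (by fun_prop)
  set g : ℕ → ℝ → ℝ≥0∞ := fun n => (Ioc (-(Real.pi * ((n:ℝ)+1))) (Real.pi * ((n:ℝ)+1))).indicator
    (fun s => ENNReal.ofReal (cauU f l (z n s))) with hg
  have hgI : ∀ n, ∫⁻ s, g n s ≤ ENNReal.ofReal B := by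
    intro n
    rw [hg, lintegral_indicator measurableSet_Ioc, ← ofReal_integral_eq_lintegral_ofReal]
    rotate_left
    · exact ((hzc n).integrableOn_Icc).mono_set Ioc_subset_Icc_self
    · exact Eventually.of_forall fun s => hu0 _ (hzim n s)
    apply ENNReal.ofReal_le_ofReal
    have hle : -(Real.pi * ((n:ℝ)+1)) ≤ Real.pi * ((n:ℝ)+1) := by
      have : 0 ≤ Real.pi * ((n:ℝ)+1) := by positivity
      linarith
    rw [← intervalIntegral.integral_of_le hle]
    have hn : ((n:ℝ)+1) ≠ 0 := by positivity
    have := intervalIntegral.integral_comp_add_div (a := -(Real.pi * ((n:ℝ)+1)))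
      (b := Real.pi * ((n:ℝ)+1))
      (fun θ => cauU f l (circleMap (((ε + ((n:ℝ)+1) : ℝ) : ℂ) * Complex.I) ((n:ℝ)+1) θ)) hn
      (-(Real.pi/2))
    simp only [hz]
    rw [this]
    have hper : Function.Periodic (fun θ => cauU f l
      (circleMap (((ε + ((n:ℝ)+1) : ℝ) : ℂ) * Complex.I) ((n:ℝ)+1) θ)) (2 * Real.pi) := by
      intro θ
      simp only [periodic_circleMap _ _ θ]
    have h2 := hper.intervalIntegral_add_eq (-(Real.pi/2) + -(Real.pi * ((n:ℝ)+1)) / ((n:ℝ)+1)) 0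
    have e1 : -(Real.pi/2) + -(Real.pi * ((n:ℝ)+1)) / ((n:ℝ)+1) + 2 * Real.pi
      = -(Real.pi/2) + (Real.pi * ((n:ℝ)+1)) / ((n:ℝ)+1) := by
      field_simp; ring
    rw [e1, zero_add] at h2
    rw [h2, smul_eq_mul]
    exact cauU_circ hf h0 hε hl (by positivity)
  have hlim : ∀ s : ℝ, Tendsto (fun n => g n s) atTop
      (nhds (ENNReal.ofReal (cauU f l ((s:ℂ) + ε * Complex.I)))) := by
    intro s
    have him : 0 < ((s:ℂ) + ε * Complex.I).im := by simpa using hε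
    have h1 := (cauU_cont hf h0 hl _ him).tendsto.comp (circ_tend ε s)
    have h2 := (ENNReal.continuous_ofReal.tendsto _).comp h1
    refine h2.congr' ?_
    have h3 : ∀ᶠ n : ℕ in atTop, |s| < (n:ℝ) := by
      obtain ⟨N, hN⟩ := exists_nat_gt |s|
      filter_upwards [eventually_ge_atTop N] with n hn
      exact hN.trans_le (by exact_mod_cast hn)
    filter_upwards [h3] with n hn
    simp only [hg]
    rw [indicator_of_mem]
    · rfl
    · have hp := Real.pi_gt_three
      have : |s| < Real.pi * ((n:ℝ)+1) := by nlinarith [abs_nonneg s]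
      have := abs_lt.1 this
      exact ⟨this.1, this.2.le⟩
  have hF : ∫⁻ s : ℝ, ENNReal.ofReal (cauU f l ((s:ℂ) + ε * Complex.I)) ≤ ENNReal.ofReal B := by
    have h1 := lintegral_liminf_le (μ := volume) (u := atTop) (f := g) (fun n =>
      ((hzc n).measurable.ennreal_ofReal).indicator measurableSet_Ioc)
    have h2 : ∀ s : ℝ, liminf (fun n => g n s) atTop
        = ENNReal.ofReal (cauU f l ((s:ℂ) + ε * Complex.I)) := fun s => (hlim s).liminf_eq
    simp only [h2] at h1
    refine h1.trans ?_
    refine liminf_le_of_le (by isBoundedDefault) ?_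
    intro b hb
    obtain ⟨n, hn⟩ := hb.exists
    exact hn.trans (hgI n)
  have hsub : {x : ℝ | l ≤ ‖cauF f ((x:ℂ) + ε * Complex.I)‖} ⊆
      {x : ℝ | ENNReal.ofReal (1/2) ≤ ENNReal.ofReal (cauU f l ((x:ℂ) + ε * Complex.I))} := by
    intro x hx
    have him : 0 < ((x:ℂ) + ε * Complex.I).im := by simpa using hε
    exact ENNReal.ofReal_le_ofReal ((mob_re l hl _ (cauF_im hf h0 _ him)).2 hx)
  refine (measure_mono hsub).trans ?_
  have hm : Measurable fun x : ℝ => ENNReal.ofReal (cauU f l ((x:ℂ) + ε * Complex.I)) := by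
    apply Measurable.ennreal_ofReal
    apply Continuous.measurable
    rw [continuous_iff_continuousAt]
    intro s
    have him : 0 < ((s:ℂ) + ε * Complex.I).im := by simpa using hε
    have h1 := cauU_cont hf h0 hl _ him
    exact ContinuousAt.comp (f := fun x : ℝ => (x:ℂ) + ε * Complex.I) h1 (by fun_prop)
  have h3 := mul_meas_ge_le_lintegral (μ := volume) hm (ENNReal.ofReal (1/2))
  have h4 := h3.trans hF
  have e : ENNReal.ofReal (4 * Real.pi * ((∫ t, f t) / l)) = 2 * ENNReal.ofReal B := by
    rw [show (2:ℝ≥0∞) = ENNReal.ofReal 2 by simp, ← ENNReal.ofReal_mul (by norm_num)]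
    congr 1; rw [hB]; ring
  rw [e]
  calc _ = 2 * (ENNReal.ofReal (1/2) * volume {x : ℝ | ENNReal.ofReal (1/2) ≤ ENNReal.ofReal (cauU f l ((x:ℂ) + ε * Complex.I))}) := by
        rw [← mul_assoc, show (2:ℝ≥0∞) = ENNReal.ofReal 2 by simp, ← ENNReal.ofReal_mul (by norm_num)]
        simp
    _ ≤ _ := by gcongr

def ivl (I : ℝ × ℝ) : Set ℝ := Ioo I.1 I.2

lemma cover_fin (S : Finset (ℝ × ℝ)) : ∃ T : Finset (ℝ × ℝ), T ⊆ S ∧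
    (⋃ I ∈ T, ivl I) = (⋃ I ∈ S, ivl I) ∧ ∀ x : ℝ, (T.filter fun I => I.1 < x ∧ x < I.2).card ≤ 2 := by
  classical
  obtain ⟨T, hT, hmin⟩ := Finset.exists_min_image
    (S.powerset.filter fun T => (⋃ I ∈ T, ivl I) = (⋃ I ∈ S, ivl I)) Finset.card
    ⟨S, by simp⟩
  simp only [Finset.mem_filter, Finset.mem_powerset] at hT hmin
  refine ⟨T, hT.1, hT.2, fun x => ?_⟩
  by_contra hcon
  push Not at hcon
  set U := T.filter fun I => I.1 < x ∧ x < I.2 with hU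
  have hUne : U.Nonempty := by
    rw [← Finset.card_pos]; omega
  obtain ⟨I, hI, hImin⟩ := Finset.exists_min_image U Prod.fst hUne
  obtain ⟨J, hJ, hJmax⟩ := Finset.exists_max_image U Prod.snd hUne
  have : ∃ K ∈ U, K ∉ ({I, J} : Finset (ℝ × ℝ)) := by
    by_contra h
    push Not at h
    have h1 : U ⊆ {I, J} := h
    have := Finset.card_le_card h1
    have := Finset.card_le_two (a := I) (b := J)
    omega
  obtain ⟨K, hK, hKn⟩ := this
  simp only [Finset.mem_insert, Finset.mem_singleton, not_or] at hKn
  have hKT : K ∈ T := (Finset.mem_filter.1 hK).1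
  have hIT := Finset.mem_filter.1 hI
  have hJT := Finset.mem_filter.1 hJ
  have hsub : ivl K ⊆ ivl I ∪ ivl J := by
    intro y hy
    have h1 := hImin K hK
    have h2 := hJmax K hK
    simp only [ivl, mem_union, mem_Ioo] at hy ⊢
    by_cases h : y < I.2
    · left; exact ⟨by linarith, h⟩
    · right; push Not at h
      exact ⟨by linarith [hIT.2.2, hJT.2.1], by linarith⟩
  have := hmin (T.erase K) ⟨(Finset.erase_subset _ _).trans hT.1, ?_⟩
  · have h3 := Finset.card_erase_lt_of_mem hKT
    omega
  · rw [← hT.2]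
    apply Subset.antisymm
    · intro y hy
      simp only [mem_iUnion, exists_prop, Finset.mem_erase] at hy ⊢
      obtain ⟨L, ⟨_, hL⟩, hy⟩ := hy
      exact ⟨L, hL, hy⟩
    · intro y hy
      simp only [mem_iUnion, exists_prop, Finset.mem_erase] at hy ⊢
      obtain ⟨L, hL, hy⟩ := hy
      by_cases hLK : L = K
      · subst hLK
        rcases hsub hy with h | h
        · exact ⟨I, ⟨fun h => hKn.1 h.symm, hIT.1⟩, h⟩
        · exact ⟨J, ⟨fun h => hKn.2 h.symm, hJT.1⟩, h⟩
      · exact ⟨L, ⟨hLK, hL⟩, hy⟩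

lemma weak_fin (σ : Measure ℝ) (h : ℝ → ℝ≥0∞) (l : ℝ≥0∞) (S : Finset (ℝ × ℝ))
    (hm : Measurable h)
    (hS : ∀ I ∈ S, l * σ (ivl I) ≤ ∫⁻ x in ivl I, h x ∂σ) :
    l * σ (⋃ I ∈ S, ivl I) ≤ 2 * ∫⁻ x, h x ∂σ := by
  classical
  obtain ⟨T, hTS, hTU, hT⟩ := cover_fin S
  rw [← hTU]
  calc l * σ (⋃ I ∈ T, ivl I) ≤ l * ∑ I ∈ T, σ (ivl I) := by
        gcongr; exact measure_biUnion_finset_le _ _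
    _ = ∑ I ∈ T, l * σ (ivl I) := Finset.mul_sum _ _ _
    _ ≤ ∑ I ∈ T, ∫⁻ x in ivl I, h x ∂σ := Finset.sum_le_sum fun I hI => hS I (hTS hI)
    _ = ∑ I ∈ T, ∫⁻ x, (ivl I).indicator h x ∂σ := by
        refine Finset.sum_congr rfl fun I _ => ?_
        rw [lintegral_indicator (show MeasurableSet (ivl I) from measurableSet_Ioo)]
    _ = ∫⁻ x, ∑ I ∈ T, (ivl I).indicator h x ∂σ := by
        rw [lintegral_finsetSum]
        exact fun I _ => hm.indicator measurableSet_Ioo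
    _ ≤ ∫⁻ x, 2 * h x ∂σ := by
        apply lintegral_mono
        intro x
        have e : ∑ I ∈ T, (ivl I).indicator h x
            = ∑ I ∈ T.filter (fun I => I.1 < x ∧ x < I.2), h x := by
          rw [Finset.sum_filter]
          refine Finset.sum_congr rfl fun I _ => ?_
          simp only [indicator, ivl, mem_Ioo]
        simp only [e, Finset.sum_const, nsmul_eq_mul]
        gcongr
        exact_mod_cast hT x
    _ = 2 * ∫⁻ x, h x ∂σ := lintegral_const_mul _ hm

lemma weak_gen (σ : Measure ℝ) (h : ℝ → ℝ≥0∞) (l : ℝ≥0∞) (S : Set (ℝ × ℝ))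
    (hm : Measurable h)
    (hS : ∀ I ∈ S, l * σ (ivl I) ≤ ∫⁻ x in ivl I, h x ∂σ) :
    l * σ (⋃ I ∈ S, ivl I) ≤ 2 * ∫⁻ x, h x ∂σ := by
  classical
  obtain ⟨T, hTS, hTc, hTU⟩ := TopologicalSpace.isOpen_biUnion_countable S ivl
    (fun I _ => isOpen_Ioo)
  rw [← hTU]
  rcases T.eq_empty_or_nonempty with rfl | hne
  · simp
  obtain ⟨e, rfl⟩ := hTc.exists_eq_range hne
  rw [biUnion_range, measure_iUnion_eq_iSup_accumulate, ENNReal.mul_iSup]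
  apply iSup_le
  intro n
  have : Set.accumulate (fun n => ivl (e n)) n
      = ⋃ I ∈ (Finset.range (n+1)).image e, ivl I := by
    ext x
    simp [Set.accumulate]
  rw [this]
  apply weak_fin σ h l _ hm
  intro I hI
  obtain ⟨k, _, rfl⟩ := Finset.mem_image.1 hI
  exact hS _ (hTS (mem_range_self k))

def maxF (σ : Measure ℝ) (h : ℝ → ℝ≥0∞) (x : ℝ) : ℝ≥0∞ :=
  ⨆ I : ℝ × ℝ, (ivl I).indicator (fun _ => (∫⁻ x in ivl I, h x ∂σ) / σ (ivl I)) x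

lemma maxF_meas (σ : Measure ℝ) (h : ℝ → ℝ≥0∞) : Measurable (maxF σ h) := by
  apply LowerSemicontinuous.measurable
  apply lowerSemicontinuous_iSup
  intro I
  exact isOpen_Ioo.lowerSemicontinuous_indicator zero_le

lemma le_maxF (σ : Measure ℝ) (h : ℝ → ℝ≥0∞) (I : ℝ × ℝ) (x : ℝ) (hx : x ∈ ivl I) :
    (∫⁻ x in ivl I, h x ∂σ) / σ (ivl I) ≤ maxF σ h x := by
  refine le_trans ?_ (le_iSup _ I)
  rw [indicator_of_mem hx]

lemma maxF_weak (σ : Measure ℝ) (h : ℝ → ℝ≥0∞) (hm : Measurable h) (l : ℝ≥0∞) :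
    l * σ {x | l < maxF σ h x} ≤ 2 * ∫⁻ x, h x ∂σ := by
  have : {x | l < maxF σ h x} ⊆ ⋃ I ∈ {I : ℝ × ℝ | l < (∫⁻ x in ivl I, h x ∂σ) / σ (ivl I)}, ivl I := by
    intro x hx
    obtain ⟨I, hI⟩ := lt_iSup_iff.1 (show l < _ from hx)
    by_cases hxI : x ∈ ivl I
    · rw [indicator_of_mem hxI] at hI
      simp only [mem_iUnion]
      exact ⟨I, hI, hxI⟩
    · rw [indicator_of_notMem hxI] at hI
      exact absurd hI (by simp)
  calc _ ≤ l * σ (⋃ I ∈ {I : ℝ × ℝ | l < (∫⁻ x in ivl I, h x ∂σ) / σ (ivl I)}, ivl I) := by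
        gcongr
    _ ≤ _ := by
        apply weak_gen σ h l _ hm
        intro I hI
        exact ENNReal.mul_le_of_le_div (le_of_lt hI)

/-- truncation version -/
lemma maxF_weak2 (σ : Measure ℝ) (h : ℝ → ℝ≥0∞) (hm : Measurable h) (l : ℝ≥0∞) :
    l * σ {x | 2 * l < maxF σ h x} ≤ 2 * ∫⁻ x, {x | l < h x}.indicator h x ∂σ := by
  have hms : MeasurableSet {x | l < h x} := measurableSet_lt measurable_const hm
  refine le_trans ?_ (maxF_weak σ _ (hm.indicator hms) l)
  apply mul_le_mul' le_rfl (measure_mono ?_)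
  intro x hx
  obtain ⟨I, hI⟩ := lt_iSup_iff.1 (show 2 * l < _ from hx)
  by_cases hxI : x ∈ ivl I
  · rw [indicator_of_mem hxI] at hI
    refine lt_of_lt_of_le ?_ (le_maxF σ _ I x hxI)
    have h1 : ∫⁻ x in ivl I, h x ∂σ ≤ (∫⁻ x in ivl I, {x | l < h x}.indicator h x ∂σ) + l * σ (ivl I) := by
      rw [← setLIntegral_const, ← lintegral_add_right _ measurable_const]
      apply lintegral_mono
      intro y
      by_cases hy : l < h y
      · simp [indicator, hy]
      · simp only [indicator, mem_ofPred_eq, hy, if_false, zero_add]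
        exact not_lt.1 hy
    have h2 : (∫⁻ x in ivl I, h x ∂σ) / σ (ivl I) ≤
        (∫⁻ x in ivl I, {x | l < h x}.indicator h x ∂σ) / σ (ivl I) + l := by
      calc _ ≤ ((∫⁻ x in ivl I, {x | l < h x}.indicator h x ∂σ) + l * σ (ivl I)) / σ (ivl I) := by
            gcongr
        _ = _ := ENNReal.add_div
        _ ≤ _ := by
          gcongr
          rw [mul_div_assoc]
          calc _ ≤ l * 1 := by gcongr; exact ENNReal.div_self_le_one
            _ = l := mul_one l
    have h3 := hI.trans_le h2
    rw [two_mul] at h3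
    exact lt_of_add_lt_add_right h3
  · rw [indicator_of_notMem hxI] at hI
    exact absurd hI (by simp)

def pwI (r : ℝ) (a : ℝ≥0∞) : ℝ≥0∞ :=
  ∫⁻ s in Ioi (0:ℝ), if ENNReal.ofReal s < a then ENNReal.ofReal (s ^ (r - 1)) else 0

lemma pwI_fin {r : ℝ} (hr : 0 < r) {b : ℝ} (hb : 0 ≤ b) :
    pwI r (ENNReal.ofReal b) = ENNReal.ofReal b ^ r / ENNReal.ofReal r := by
  have h1 : pwI r (ENNReal.ofReal b) = ∫⁻ s in Ioc (0:ℝ) b, ENNReal.ofReal (s ^ (r - 1)) := by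
    unfold pwI
    rw [restrict_Ioo_eq_restrict_Ioc.symm, ← lintegral_indicator measurableSet_Ioi,
      ← lintegral_indicator measurableSet_Ioo]
    congr 1
    ext s
    by_cases hs : 0 < s
    · have : ENNReal.ofReal s < ENNReal.ofReal b ↔ s < b := ENNReal.ofReal_lt_ofReal_iff_of_nonneg hs.le
      by_cases hsb : s < b
      · simp only [indicator, mem_Ioi, mem_Ioo, hs, hsb, this, and_self, and_false, if_true, if_false]
      · simp only [indicator, mem_Ioi, mem_Ioo, hs, hsb, this, and_self, and_false, if_true, if_false]
    · simp [indicator, hs]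
  rw [h1, ← ofReal_integral_eq_lintegral_ofReal]
  · rw [← intervalIntegral.integral_of_le hb, integral_rpow (Or.inl (by linarith)),
      ENNReal.ofReal_rpow_of_nonneg hb hr.le, ← ENNReal.ofReal_div_of_pos hr]
    congr 1
    rw [sub_add_cancel, Real.zero_rpow hr.ne', sub_zero]
  · exact ((intervalIntegrable_iff_integrableOn_Ioc_of_le hb).1
      (intervalIntegral.intervalIntegrable_rpow' (by linarith)))
  · filter_upwards [ae_restrict_mem measurableSet_Ioc] with s hs
    exact Real.rpow_nonneg hs.1.le _

lemma pwI_eq {r : ℝ} (hr : 0 < r) (a : ℝ≥0∞) : pwI r a = a ^ r / ENNReal.ofReal r := by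
  by_cases ha : a = ⊤
  · subst ha
    rw [ENNReal.top_rpow_of_pos hr, ENNReal.top_div_of_ne_top ENNReal.ofReal_ne_top]
    apply ENNReal.eq_top_of_forall_nnreal_le
    intro c
    have h1 : pwI r (ENNReal.ofReal ((c * r) ^ (1/r))) ≤ pwI r ⊤ := by
      unfold pwI
      apply lintegral_mono
      intro s
      simp only [ENNReal.ofReal_lt_top, if_true]
      split_ifs <;> simp
    refine le_trans ?_ h1
    rw [pwI_fin hr (by positivity), ENNReal.ofReal_rpow_of_nonneg (by positivity) hr.le,
      ← Real.rpow_mul (by positivity), one_div_mul_cancel hr.ne', Real.rpow_one,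
      ← ENNReal.ofReal_div_of_pos hr, mul_div_cancel_right₀ _ hr.ne']
    simp
  · rw [← ENNReal.ofReal_toReal ha]
    exact pwI_fin hr ENNReal.toReal_nonneg

lemma maxF_Lp {q : ℝ} (hq : 1 < q) : ∃ C : ℝ≥0∞, C ≠ ⊤ ∧ ∀ (σ : Measure ℝ) [SFinite σ]
    (h : ℝ → ℝ≥0∞), Measurable h → ∫⁻ x, maxF σ h x ^ q ∂σ ≤ C * ∫⁻ x, h x ^ q ∂σ := by
  have hq0 : 0 < q := by linarith
  have hq1 : 0 < q - 1 := by linarith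
  refine ⟨2 ^ q * ENNReal.ofReal q * (2 / ENNReal.ofReal (q-1)), ?_, ?_⟩
  · apply ENNReal.mul_ne_top (ENNReal.mul_ne_top (by simp) ENNReal.ofReal_ne_top)
    apply ENNReal.div_ne_top (by simp)
    simpa using hq
  intro σ _ h hm
  have hq0' : ENNReal.ofReal q ≠ 0 := by simpa using hq0
  have hM := maxF_meas σ h
  have e1 : ∀ x, maxF σ h x ^ q = 2 ^ q * ENNReal.ofReal q * pwI q (maxF σ h x / 2) := by
    intro x
    rw [pwI_eq hq0, ENNReal.div_rpow_of_nonneg _ _ hq0.le, mul_assoc,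
      ENNReal.mul_div_cancel hq0' ENNReal.ofReal_ne_top, ENNReal.mul_div_cancel (by simp) (by simp)]
  simp_rw [e1]
  have hms1 : Measurable (fun z : ℝ × ℝ => if ENNReal.ofReal z.2 < maxF σ h z.1 / 2
      then ENNReal.ofReal (z.2 ^ (q - 1)) else 0) := by
    apply Measurable.ite
    · exact measurableSet_lt (measurable_snd.ennreal_ofReal) ((hM.comp measurable_fst).div_const _)
    · exact (measurable_snd.pow_const _).ennreal_ofReal
    · exact measurable_const
  have hms2 : Measurable (fun z : ℝ × ℝ => if ENNReal.ofReal z.2 < h z.1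
      then ENNReal.ofReal (z.2 ^ (q - 1 - 1)) * h z.1 else 0) := by
    apply Measurable.ite
    · exact measurableSet_lt (measurable_snd.ennreal_ofReal) (hm.comp measurable_fst)
    · exact (measurable_snd.pow_const _).ennreal_ofReal.mul (hm.comp measurable_fst)
    · exact measurable_const
  rw [lintegral_const_mul]
  swap
  · exact hms1.lintegral_prod_right' (ν := volume.restrict (Ioi 0))
  rw [mul_assoc (2 ^ q * ENNReal.ofReal q)]
  refine mul_le_mul' le_rfl ?_
  calc ∫⁻ x, pwI q (maxF σ h x / 2) ∂σ
      = ∫⁻ s in Ioi (0:ℝ), ∫⁻ x, (if ENNReal.ofReal s < maxF σ h x / 2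
          then ENNReal.ofReal (s ^ (q - 1)) else 0) ∂σ := by
        unfold pwI
        exact lintegral_lintegral_swap hms1.aemeasurable
    _ ≤ ∫⁻ s in Ioi (0:ℝ), 2 * ∫⁻ x, (if ENNReal.ofReal s < h x
          then ENNReal.ofReal (s ^ (q - 1 - 1)) * h x else 0) ∂σ := by
        apply setLIntegral_mono' measurableSet_Ioi
        intro s hs
        have hs' : (0:ℝ) < s := hs
        have h1 : ∫⁻ x, (if ENNReal.ofReal s < maxF σ h x / 2
          then ENNReal.ofReal (s ^ (q - 1)) else 0) ∂σ
          = ENNReal.ofReal (s ^ (q - 1)) * σ {x | 2 * ENNReal.ofReal s < maxF σ h x} := by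
          rw [← setLIntegral_const, ← lintegral_indicator (measurableSet_lt measurable_const hM)]
          congr 1; ext x
          have : ENNReal.ofReal s < maxF σ h x / 2 ↔ 2 * ENNReal.ofReal s < maxF σ h x := by
            rw [ENNReal.lt_div_iff_mul_lt (by simp) (by simp), mul_comm]
          simp only [indicator, mem_ofPred_eq, this]
        have h2 : ∫⁻ x, (if ENNReal.ofReal s < h x
          then ENNReal.ofReal (s ^ (q - 1 - 1)) * h x else 0) ∂σ
          = ENNReal.ofReal (s ^ (q - 1 - 1)) * ∫⁻ x, {x | ENNReal.ofReal s < h x}.indicator h x ∂σ := by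
          rw [← lintegral_const_mul _ (hm.indicator (measurableSet_lt measurable_const hm))]
          congr 1; ext x
          simp only [indicator, mem_ofPred_eq]
          split_ifs <;> simp
        rw [h1, h2]
        have e : ENNReal.ofReal (s ^ (q-1)) = ENNReal.ofReal (s ^ (q-1-1)) * ENNReal.ofReal s := by
          rw [← ENNReal.ofReal_mul (by positivity)]
          congr 1
          rw [← Real.rpow_add_one hs'.ne']; congr 1; ring
        rw [e, mul_assoc, mul_left_comm 2]
        refine mul_le_mul' le_rfl ?_
        exact maxF_weak2 σ h hm _
    _ = 2 * ∫⁻ x, (∫⁻ s in Ioi (0:ℝ), (if ENNReal.ofReal s < h x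
          then ENNReal.ofReal (s ^ (q - 1 - 1)) * h x else 0)) ∂σ := by
        rw [lintegral_const_mul]
        · congr 1
          exact (lintegral_lintegral_swap (f := fun x s => (if ENNReal.ofReal s < h x
            then ENNReal.ofReal (s ^ (q - 1 - 1)) * h x else 0)) hms2.aemeasurable).symm
        exact hms2.lintegral_prod_left' (μ := σ)
    _ = 2 * ∫⁻ x, h x ^ q / ENNReal.ofReal (q - 1) ∂σ := by
        congr 1; apply lintegral_congr; intro x
        have : ∫⁻ s in Ioi (0:ℝ), (if ENNReal.ofReal s < h x
          then ENNReal.ofReal (s ^ (q - 1 - 1)) * h x else 0) = pwI (q-1) (h x) * h x := by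
          unfold pwI
          rw [← lintegral_mul_const]
          · congr 1; ext s; split_ifs <;> simp
          · apply Measurable.ite
            · exact measurableSet_lt ENNReal.measurable_ofReal measurable_const
            · exact (measurable_id.pow_const _).ennreal_ofReal
            · exact measurable_const
        rw [this, pwI_eq hq1]
        simp only [div_eq_mul_inv]
        rw [mul_right_comm]
        congr 1
        nth_rewrite 2 [← ENNReal.rpow_one (h x)]
        rw [← ENNReal.rpow_add_of_nonneg _ _ hq1.le zero_le_one, sub_add_cancel]
    _ = _ := by
        simp only [div_eq_mul_inv]
        rw [lintegral_mul_const _ (hm.pow_const q)]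
        ring

def TT (f : ℝ → ℝ) (ε : ℝ) (S : Set ℝ) (x : ℝ) : ℂ :=
  cauF (S.indicator f) ((x:ℂ) + ε * Complex.I)

lemma TT_im (ε x : ℝ) : ((x:ℂ) + ε * Complex.I).im = ε := by simp

lemma TT_le {f : ℝ → ℝ} (hf : Integrable f) (h0 : ∀ t, 0 ≤ f t) {ε : ℝ} (hε : 0 < ε)
    {S : Set ℝ} (hS : MeasurableSet S) (x : ℝ) : ‖TT f ε S x‖ ≤ (∫ t in S, f t) / ε := by
  have := cauF_norm_le (hf.indicator hS) ((x:ℂ) + ε * Complex.I) (by rw [TT_im]; exact hε)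
  rw [TT_im] at this
  refine this.trans (le_of_eq ?_)
  congr 1
  rw [← integral_indicator hS]
  congr 1; ext t
  exact abs_of_nonneg (indicator_nonneg (fun t _ => h0 t) t)

lemma TT_add {f : ℝ → ℝ} (hf : Integrable f) {ε : ℝ} (hε : 0 < ε)
    {S S' : Set ℝ} (hS : MeasurableSet S) (hS' : MeasurableSet S') (hSS : S ⊆ S') (x : ℝ) :
    TT f ε S' x = TT f ε S x + TT f ε (S' \ S) x := by
  have hz : 0 < ((x:ℂ) + ε * Complex.I).im := by rw [TT_im]; exact hε
  unfold TT cauF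
  rw [← integral_add (cau_int (hf.indicator hS) _ hz) (cau_int (hf.indicator (hS'.diff hS)) _ hz)]
  congr 1; ext t
  rw [← add_div]
  congr 1
  by_cases h : t ∈ S
  · simp [h, hSS h]
  · by_cases h' : t ∈ S' <;> simp [h, h']

lemma TT_cont {f : ℝ → ℝ} (hf : Integrable f) {ε : ℝ} (hε : 0 < ε)
    {S : Set ℝ} (hS : MeasurableSet S) : Continuous (TT f ε S) := by
  rw [continuous_iff_continuousAt]
  intro x
  have h := (cauF_diff (hf.indicator hS) ((x:ℂ) + ε * Complex.I)
    (by rw [TT_im]; exact hε)).continuousAt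
  exact ContinuousAt.comp (f := fun x : ℝ => (x:ℂ) + ε * Complex.I) h (by fun_prop)

lemma TT_weak {f : ℝ → ℝ} (hf : Integrable f) (h0 : ∀ t, 0 ≤ f t) {ε l : ℝ} (hε : 0 < ε)
    (hl : 0 < l) {S : Set ℝ} (hS : MeasurableSet S) :
    volume {x : ℝ | l ≤ ‖TT f ε S x‖} ≤ ENNReal.ofReal (4 * Real.pi * ((∫ t in S, f t) / l)) := by
  have := cau_weak (hf.indicator hS) (fun t => indicator_nonneg (fun t _ => h0 t) t) hε hl
  rw [integral_indicator hS] at this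
  exact this

lemma ann_bd {f : ℝ → ℝ} (h0 : ∀ t, 0 ≤ f t) {S : Set ℝ} (hS : MeasurableSet S)
    {r B x : ℝ} (hr : 0 < r) (hB : 0 ≤ B) (hfar : ∀ t ∈ S, r ≤ |x - t|)
    (hM : ∀ ρ > 0, ∫⁻ t in S ∩ Ioo (x - ρ) (x + ρ), ENNReal.ofReal (f t) ≤ ENNReal.ofReal (2 * B * ρ))
    (k : ℕ) :
    ∫⁻ t in S ∩ Ioo (x - 2^k * r) (x + 2^k * r), ENNReal.ofReal (f t / |x - t|^2)
      ≤ ENNReal.ofReal (8 * B / r * (1 - (1/2)^k)) := by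
  induction k with
  | zero =>
    have : S ∩ Ioo (x - 2^0 * r) (x + 2^0 * r) = ∅ := by
      ext t
      simp only [mem_inter_iff, mem_Ioo, mem_empty_iff_false, iff_false, not_and]
      intro ht h1 h2
      have := hfar t ht
      rw [le_abs] at this
      rcases this with h | h <;> linarith
    rw [this]; simp
  | succ k ih =>
    set U := S ∩ Ioo (x - 2^k * r) (x + 2^k * r)
    set V := S ∩ Ioo (x - 2^(k+1) * r) (x + 2^(k+1) * r)
    have hV : MeasurableSet V := hS.inter measurableSet_Ioo
    have hU : MeasurableSet U := hS.inter measurableSet_Ioo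
    have h2k : (0:ℝ) < 2^k := by positivity
    have hc : V ⊆ U ∪ (V \ U) := by intro t ht; by_cases h : t ∈ U <;> simp [h, ht]
    calc _ ≤ ∫⁻ t in U ∪ (V \ U), ENNReal.ofReal (f t / |x - t|^2) := lintegral_mono_set hc
      _ ≤ (∫⁻ t in U, ENNReal.ofReal (f t / |x - t|^2)) +
          ∫⁻ t in V \ U, ENNReal.ofReal (f t / |x - t|^2) := lintegral_union_le _ _ _
      _ ≤ ENNReal.ofReal (8 * B / r * (1 - (1/2)^k)) + ENNReal.ofReal (4 * B / r * (1/2)^k) := by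
        refine add_le_add ih ?_
        calc _ ≤ ∫⁻ t in V \ U, ENNReal.ofReal ((2^k*r)^2)⁻¹ * ENNReal.ofReal (f t) := by
              apply setLIntegral_mono' (hV.diff hU)
              intro t ht
              rw [← ENNReal.ofReal_mul (by positivity)]
              apply ENNReal.ofReal_le_ofReal
              rw [div_eq_inv_mul]
              have h3 : 2^k * r ≤ |x - t| := by
                by_contra hcon
                push Not at hcon
                rw [abs_lt] at hcon
                exact ht.2 ⟨ht.1.1, by constructor <;> linarith⟩
              have := h0 t
              gcongr
          _ ≤ ENNReal.ofReal ((2^k*r)^2)⁻¹ * ENNReal.ofReal (2 * B * (2^(k+1)*r)) := by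
              rw [lintegral_const_mul' _ _ ENNReal.ofReal_ne_top]
              refine mul_le_mul' le_rfl ?_
              exact (lintegral_mono_set sdiff_subset).trans (hM _ (by positivity))
          _ = _ := by
              rw [← ENNReal.ofReal_mul (by positivity)]
              congr 1
              rw [one_div, inv_pow, pow_succ]
              field_simp
              ring
      _ = _ := by
        have : ((1:ℝ)/2)^k ≤ 1 := pow_le_one₀ (by norm_num) (by norm_num)
        rw [← ENNReal.ofReal_add]
        · congr 1; rw [pow_succ]; ring
        · apply mul_nonneg (by positivity); linarith
        · positivity

lemma TT_osc {f : ℝ → ℝ} (hf : Integrable f) (h0 : ∀ t, 0 ≤ f t) {ε : ℝ} (hε : 0 < ε)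
    {S : Set ℝ} (hS : MeasurableSet S)
    {r B x y R : ℝ} (hr : 0 < r) (hB : 0 ≤ B) (hfar : ∀ t ∈ S, r ≤ |x - t|)
    (hfary : ∀ t ∈ S, r ≤ |y - t|) (hxy : |x - y| ≤ r) (hR : S ⊆ Ioo (x - R) (x + R))
    (hM : ∀ ρ > 0, ∫⁻ t in S ∩ Ioo (x - ρ) (x + ρ), ENNReal.ofReal (f t) ≤ ENNReal.ofReal (2 * B * ρ)) :
    ‖TT f ε S y - TT f ε S x‖ ≤ 16 * B := by
  obtain ⟨k, hk⟩ := pow_unbounded_of_one_lt (R / r) (one_lt_two : (1:ℝ) < 2)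
  have hSk : S = S ∩ Ioo (x - 2^k * r) (x + 2^k * r) := by
    symm; apply inter_eq_left.2
    refine hR.trans ?_
    have : R < 2^k * r := by rwa [div_lt_iff₀ hr] at hk
    intro t ht
    exact ⟨by linarith [ht.1], by linarith [ht.2]⟩
  have hann := ann_bd h0 hS hr hB hfar hM k
  rw [← hSk] at hann
  have hz : ∀ x : ℝ, 0 < ((x:ℂ) + ε * Complex.I).im := fun x => by rw [TT_im]; exact hε
  have key : ENNReal.ofReal ‖TT f ε S y - TT f ε S x‖ ≤ ENNReal.ofReal (16 * B) := by
    unfold TT cauF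
    rw [← integral_sub (cau_int (hf.indicator hS) _ (hz y)) (cau_int (hf.indicator hS) _ (hz x))]
    rw [ofReal_norm]
    refine (enorm_integral_le_lintegral_enorm _).trans ?_
    calc _ ≤ ∫⁻ t, S.indicator (fun t => ENNReal.ofReal (2 * r) * ENNReal.ofReal (f t / |x - t|^2)) t := by
          apply lintegral_mono
          intro t
          by_cases ht : t ∈ S
          swap
          · simp [ht]
          simp only [indicator_of_mem ht]
          rw [← ofReal_norm, ← ENNReal.ofReal_mul (by positivity)]
          apply ENNReal.ofReal_le_ofReal
          have n1 := cau_ne _ (hz y) t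
          have n2 := cau_ne _ (hz x) t
          have e : (f t : ℂ) / ((y:ℂ) + ε * Complex.I - t) - (f t : ℂ) / ((x:ℂ) + ε * Complex.I - t)
            = (f t : ℂ) * ((x - y : ℝ) : ℂ) / (((y:ℂ) + ε * Complex.I - t) * ((x:ℂ) + ε * Complex.I - t)) := by
            push_cast
            field_simp
            ring
          rw [e, norm_div, norm_mul, norm_mul, Complex.norm_real, Complex.norm_real,
            Real.norm_eq_abs, Real.norm_eq_abs, abs_of_nonneg (h0 t)]
          have m1 : |y - t| ≤ ‖(y:ℂ) + ε * Complex.I - t‖ := by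
            have := Complex.abs_re_le_norm ((y:ℂ) + ε * Complex.I - t)
            simpa using this
          have m2 : |x - t| ≤ ‖(x:ℂ) + ε * Complex.I - t‖ := by
            have := Complex.abs_re_le_norm ((x:ℂ) + ε * Complex.I - t)
            simpa using this
          have a1 := hfar t ht
          have a2 := hfary t ht
          have a3 : |x - t| ≤ 2 * |y - t| := by
            have : |x - t| ≤ |x - y| + |y - t| := by
              have := abs_add_le (x - y) (y - t); simpa using this
            linarith
          have hx0 : 0 < |x - t| := by linarith
          have hy0 : 0 < |y - t| := by linarith
          have hft := h0 t
          calc f t * |x - y| / (‖(y:ℂ) + ε * Complex.I - t‖ * ‖(x:ℂ) + ε * Complex.I - t‖)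
              ≤ f t * r / (|y - t| * |x - t|) := by gcongr
            _ ≤ f t * r / ((|x - t|/2) * |x - t|) := by gcongr; linarith
            _ = _ := by field_simp
      _ = ENNReal.ofReal (2 * r) * ∫⁻ t in S, ENNReal.ofReal (f t / |x - t|^2) := by
          rw [lintegral_indicator hS, lintegral_const_mul' _ _ ENNReal.ofReal_ne_top]
      _ ≤ ENNReal.ofReal (2 * r) * ENNReal.ofReal (8 * B / r * (1 - (1/2)^k)) := mul_le_mul' le_rfl hann
      _ ≤ _ := by
          rw [← ENNReal.ofReal_mul (by positivity)]
          apply ENNReal.ofReal_le_ofReal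
          have e : 2 * r * (8 * B / r * (1 - (1/2)^k)) = 16 * B * (1 - (1/2)^k) := by
            field_simp; ring
          rw [e]
          have : (0:ℝ) ≤ (1/2)^k := by positivity
          nlinarith
  exact (ENNReal.ofReal_le_ofReal_iff (by positivity)).1 key

def bad2 (f : ℝ → ℝ) (U : Set ℝ) (l : ℝ) : Set ℝ :=
  ⋃ I ∈ {I : ℝ × ℝ | ENNReal.ofReal l * volume (ivl I)
    ≤ ∫⁻ t in ivl I, U.indicator (fun t => ENNReal.ofReal (f t)) t}, ivl I

def bad (f : ℝ → ℝ) (ε : ℝ) (U : Set ℝ) (l : ℝ) : Set ℝ :=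
  {x | l ≤ ‖TT f ε U x‖} ∪ bad2 f U l

lemma bad2_meas (f : ℝ → ℝ) (U : Set ℝ) (l : ℝ) : MeasurableSet (bad2 f U l) :=
  (isOpen_biUnion fun I _ => isOpen_Ioo).measurableSet

lemma bad_meas {f : ℝ → ℝ} (hf : Integrable f) {ε : ℝ} (hε : 0 < ε) {U : Set ℝ}
    (hU : MeasurableSet U) (l : ℝ) : MeasurableSet (bad f ε U l) :=
  ((isClosed_le continuous_const (TT_cont hf hε hU).norm).measurableSet).union (bad2_meas f U l)

lemma bad_vol {f : ℝ → ℝ} (hf : Integrable f) (hfm : Measurable f) (h0 : ∀ t, 0 ≤ f t)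
    {ε : ℝ} (hε : 0 < ε) {U : Set ℝ} (hU : MeasurableSet U) {l : ℝ} (hl : 0 < l) :
    volume (bad f ε U l) ≤ ENNReal.ofReal (16 * ((∫ t in U, f t) / l)) := by
  have hI : 0 ≤ ∫ t in U, f t := integral_nonneg h0
  have h1 := TT_weak hf h0 hε hl hU
  have h2 := weak_gen volume (U.indicator (fun t => ENNReal.ofReal (f t))) (ENNReal.ofReal l)
    {I : ℝ × ℝ | ENNReal.ofReal l * volume (ivl I)
    ≤ ∫⁻ t in ivl I, U.indicator (fun t => ENNReal.ofReal (f t)) t}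
    (hfm.ennreal_ofReal.indicator hU) (fun I hI => hI)
  rw [lintegral_indicator hU, ← ofReal_integral_eq_lintegral_ofReal hf.integrableOn
    (Eventually.of_forall h0)] at h2
  have h3 : volume (bad2 f U l) ≤ ENNReal.ofReal (2 * ((∫ t in U, f t) / l)) := by
    have : ENNReal.ofReal l ≠ 0 := by simpa using hl
    change ENNReal.ofReal l * volume (bad2 f U l) ≤ _ at h2
    rw [mul_comm, ← ENNReal.le_div_iff_mul_le (Or.inl this) (Or.inl ENNReal.ofReal_ne_top)] at h2
    refine h2.trans (le_of_eq ?_)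
    rw [ENNReal.ofReal_mul zero_le_two, ENNReal.ofReal_div_of_pos hl, ENNReal.ofReal_ofNat,
      mul_div_assoc]
  refine (measure_union_le _ _).trans ((add_le_add h1 h3).trans ?_)
  have hq : 0 ≤ (∫ t in U, f t) / l := by positivity
  rw [← ENNReal.ofReal_add (by positivity) (by positivity)]
  apply ENNReal.ofReal_le_ofReal
  have := Real.pi_lt_d2
  nlinarith

lemma not_bad2 {f : ℝ → ℝ} {U : Set ℝ} (hU : MeasurableSet U) {l x : ℝ} (hl : 0 < l)
    (hx : x ∉ bad2 f U l) {S : Set ℝ} (hS : S ⊆ U) {ρ : ℝ} (hρ : 0 < ρ) :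
    ∫⁻ t in S ∩ Ioo (x - ρ) (x + ρ), ENNReal.ofReal (f t) ≤ ENNReal.ofReal (2 * l * ρ) := by
  have h : ¬ (ENNReal.ofReal l * volume (ivl (x - ρ, x + ρ))
    ≤ ∫⁻ t in ivl (x - ρ, x + ρ), U.indicator (fun t => ENNReal.ofReal (f t)) t) := by
    intro h
    apply hx
    apply mem_biUnion (show (x - ρ, x + ρ) ∈ _ from h)
    exact ⟨by simp; linarith, by simp; linarith⟩
  push Not at h
  have e : ENNReal.ofReal l * volume (ivl (x - ρ, x + ρ)) = ENNReal.ofReal (2 * l * ρ) := by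
    unfold ivl
    rw [Real.volume_Ioo, ← ENNReal.ofReal_mul hl.le]
    congr 1; ring
  rw [← e]
  refine le_trans ?_ h.le
  unfold ivl
  rw [lintegral_indicator hU, Measure.restrict_restrict hU]
  exact lintegral_mono_set (inter_subset_inter_left _ hS)

lemma exists_good {P E : Set ℝ} {b r s : ℝ} (hP : P = Ico b (b + r)) (hE : MeasurableSet E)
    (hs : s < r) (hr : 0 < r)
    (h : volume (P ∩ E) ≤ ENNReal.ofReal s) : ∃ x ∈ P, x ∉ E := by
  by_contra hc
  push Not at hc
  rw [inter_eq_left.2 hc, hP, Real.volume_Ico] at h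
  rw [add_sub_cancel_left, ENNReal.ofReal_le_ofReal_iff'] at h
  rcases h with h | h <;> linarith

lemma loc_bd {f : ℝ → ℝ} (hf : Integrable f) (hfm : Measurable f) (h0 : ∀ t, 0 ≤ f t)
    {ε : ℝ} (hε : 0 < ε) {U : Set ℝ} (hU : MeasurableSet U) {l : ℝ} (hl : 0 < l)
    {b r : ℝ} (hr : 0 < r) {R : ℝ} (hUb : U ⊆ Ioo (b - R) (b + R))
    (hPU : Ioo (b - r) (b + 2 * r) ⊆ U)
    (hE : volume (Ico b (b + r) ∩ bad f ε U l) ≤ ENNReal.ofReal (r / 2)) :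
    (∀ x ∈ Ico b (b + r), ‖TT f ε U x‖ ≤ ‖TT f ε (Ioo (b - r) (b + 2 * r)) x‖ + 145 * l) ∧
    ∫ t in Ioo (b - r) (b + 2 * r), f t ≤ 4 * r * l := by
  set PS := Ioo (b - r) (b + 2 * r) with hPS
  have hPm : MeasurableSet PS := measurableSet_Ioo
  obtain ⟨x0, hx0P, hx0⟩ := exists_good rfl (bad_meas hf hε hU l) (by linarith) hr hE
  have hint : ∫ t in PS, f t ≤ 4 * r * l := by
    have h1 := not_bad2 (ρ := 2 * r) hU hl (fun h => hx0 (Or.inr h)) hPU (by positivity)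
    have h2 : PS ∩ Ioo (x0 - 2 * r) (x0 + 2 * r) = PS := by
      apply inter_eq_left.2
      intro t ht
      exact ⟨by linarith [ht.1, hx0P.2], by linarith [ht.2, hx0P.1]⟩
    rw [h2, ← ofReal_integral_eq_lintegral_ofReal hf.integrableOn (Eventually.of_forall h0),
      ENNReal.ofReal_le_ofReal_iff (by positivity)] at h1
    linarith
  refine ⟨?_, hint⟩
  have hI : 0 ≤ ∫ t in PS, f t := integral_nonneg h0
  have hw : volume {x | 128 * l ≤ ‖TT f ε PS x‖} ≤ ENNReal.ofReal (4 / 10 * r) := by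
    refine (TT_weak hf h0 hε (by positivity) hPm).trans (ENNReal.ofReal_le_ofReal ?_)
    have h3 : (∫ t in PS, f t) / (128 * l) ≤ r / 32 := by
      rw [div_le_iff₀ (by positivity)]; linarith
    have h4 : 0 ≤ (∫ t in PS, f t) / (128 * l) := by positivity
    have := Real.pi_lt_d2
    have := Real.pi_pos
    nlinarith
  have hWm : MeasurableSet {x | 128 * l ≤ ‖TT f ε PS x‖} :=
    (isClosed_le continuous_const (TT_cont hf hε hPm).norm).measurableSet
  obtain ⟨x', hx'P, hx'⟩ := exists_good (P := Ico b (b+r)) (E := bad f ε U l ∪ {x | 128 * l ≤ ‖TT f ε PS x‖})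
    (s := r/2 + 4/10 * r) rfl ((bad_meas hf hε hU l).union hWm) (by linarith) hr (by
      rw [inter_union_distrib_left, ENNReal.ofReal_add (by positivity) (by positivity)]
      exact (measure_union_le _ _).trans (add_le_add hE ((measure_mono inter_subset_right).trans hw)))
  simp only [mem_union, not_or, mem_ofPred_eq, not_le] at hx'
  have hb1 : ‖TT f ε U x'‖ < l := by
    by_contra hc; push Not at hc; exact hx'.1 (Or.inl hc)
  have hb2 : x' ∉ bad2 f U l := fun h => hx'.1 (Or.inr h)
  intro x hx
  have hosc := TT_osc (B := l) (r := r) (x := x') (y := x) (R := R + r) hf h0 hε (hU.diff hPm) hr hl.le ?_ ?_ ?_ ?_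
    (fun ρ hρ => not_bad2 hU hl hb2 sdiff_subset hρ)
  · have e1 := TT_add hf hε hPm hU hPU x
    have e2 := TT_add hf hε hPm hU hPU x'
    have e3 : TT f ε U x = TT f ε PS x + ((TT f ε (U \ PS) x - TT f ε (U \ PS) x') +
      (TT f ε U x' - TT f ε PS x')) := by rw [e1, e2]; ring
    rw [e3]
    refine (norm_add_le _ _).trans ?_
    have := (norm_add_le (TT f ε (U \ PS) x - TT f ε (U \ PS) x') (TT f ε U x' - TT f ε PS x'))
    have := norm_sub_le (TT f ε U x') (TT f ε PS x')
    linarith [hx'.2]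
  · intro t ht
    by_contra hc; push Not at hc; rw [abs_lt] at hc
    exact ht.2 ⟨by linarith [hx'P.1], by linarith [hx'P.2]⟩
  · intro t ht
    by_contra hc; push Not at hc; rw [abs_lt] at hc
    exact ht.2 ⟨by linarith [hx.1], by linarith [hx.2]⟩
  · rw [abs_le]; exact ⟨by linarith [hx'P.1, hx.2], by linarith [hx.1, hx'P.2]⟩
  · intro t ht
    have := hUb ht.1
    exact ⟨by linarith [this.1, hx'P.2], by linarith [this.2, hx'P.1]⟩

lemma inner_ind {f : ℝ → ℝ} (hf : Integrable f) (hfm : Measurable f) (h0 : ∀ t, 0 ≤ f t)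
    {ε : ℝ} (hε : 0 < ε) (μ ν : Measure ℝ) {a ℓ l : ℝ} (hl : 0 < l) (K : ℝ≥0∞)
    (hO : ∀ b r, 0 < r → r ≤ ℓ / 2 →
      ∫⁻ x in Ico b (b+r), ‖TT f ε (Ioo (b-r) (b+2*r)) x‖ₑ ∂μ ≤ K * ν (Ico b (b+r))) (M : ℕ) :
    ∀ b r, 0 < r → r ≤ 2^M * ε → a ≤ b → b + r ≤ a + ℓ →
      volume (Ico b (b+r) ∩ bad f ε (Ioo (a-ℓ) (a+2*ℓ)) l) ≤ ENNReal.ofReal (r/4) →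
      ∃ G ⊆ Ico b (b+r), MeasurableSet G ∧
        volume G ≤ 4 * volume (Ico b (b+r) ∩ bad f ε (Ioo (a-ℓ) (a+2*ℓ)) l) ∧
        ∫⁻ x in Ico b (b+r), ‖TT f ε (Ioo (a-ℓ) (a+2*ℓ)) x‖ₑ ∂μ
          ≤ ENNReal.ofReal (149 * l) * μ (Ico b (b+r)) + K * ν G := by
  set U := Ioo (a-ℓ) (a+2*ℓ) with hU
  have hUm : MeasurableSet U := measurableSet_Ioo
  have hloc : ∀ b r, 0 < r → a ≤ b → b + r ≤ a + ℓ →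
      volume (Ico b (b+r) ∩ bad f ε U l) ≤ ENNReal.ofReal (r/2) →
      (∀ x ∈ Ico b (b + r), ‖TT f ε U x‖ ≤ ‖TT f ε (Ioo (b - r) (b + 2 * r)) x‖ + 145 * l) ∧
        ∫ t in Ioo (b - r) (b + 2 * r), f t ≤ 4 * r * l := by
    intro b r hr hb1 hb2 hv
    apply loc_bd hf hfm h0 hε hUm hl hr (R := 4 * ℓ) _ _ hv
    · intro t ht; exact ⟨by linarith [ht.1], by linarith [ht.2]⟩
    · intro t ht; exact ⟨by linarith [ht.1], by linarith [ht.2]⟩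
  induction M with
  | zero =>
    intro b r hr hrM hb1 hb2 hv
    refine ⟨∅, empty_subset _, MeasurableSet.empty, by simp, ?_⟩
    obtain ⟨h1, h2⟩ := hloc b r hr hb1 hb2 (hv.trans (ENNReal.ofReal_le_ofReal (by linarith)))
    rw [measure_empty, mul_zero, add_zero, ← setLIntegral_const]
    apply setLIntegral_mono' measurableSet_Ico
    intro x hx
    rw [← ofReal_norm]
    apply ENNReal.ofReal_le_ofReal
    refine (h1 x hx).trans ?_
    have h3 := TT_le hf h0 hε (measurableSet_Ioo (a := b - r) (b := b + 2 * r)) x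
    have h4 : (∫ t in Ioo (b - r) (b + 2 * r), f t) / ε ≤ 4 * l := by
      rw [div_le_iff₀ hε]
      refine h2.trans ?_
      simp at hrM
      nlinarith
    linarith
  | succ M ih =>
    intro b r hr hrM hb1 hb2 hv
    have hhalf : ∀ c s, 0 < s → s ≤ 2^M * ε → s ≤ ℓ/2 → a ≤ c → c + s ≤ a + ℓ →
      volume (Ico c (c+s) ∩ bad f ε U l) ≤ ENNReal.ofReal (s/2) →
      ∃ G ⊆ Ico c (c+s), MeasurableSet G ∧
        volume G ≤ 4 * volume (Ico c (c+s) ∩ bad f ε U l) ∧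
        ∫⁻ x in Ico c (c+s), ‖TT f ε U x‖ₑ ∂μ
          ≤ ENNReal.ofReal (149 * l) * μ (Ico c (c+s)) + K * ν G := by
      intro c s hs hsM hsl hc1 hc2 hv'
      by_cases hcase : volume (Ico c (c+s) ∩ bad f ε U l) ≤ ENNReal.ofReal (s/4)
      · exact ih c s hs hsM hc1 hc2 hcase
      push Not at hcase
      refine ⟨Ico c (c+s), subset_rfl, measurableSet_Ico, ?_, ?_⟩
      · rw [Real.volume_Ico]
        refine le_trans (le_of_eq ?_) (mul_le_mul' le_rfl hcase.le)
        rw [← ENNReal.ofReal_ofNat, ← ENNReal.ofReal_mul (by norm_num)]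
        congr 1; norm_num; ring
      · obtain ⟨h1, h2⟩ := hloc c s hs hc1 hc2 hv'
        calc _ ≤ ∫⁻ x in Ico c (c+s), (‖TT f ε (Ioo (c - s) (c + 2 * s)) x‖ₑ + ENNReal.ofReal (149 * l)) ∂μ := by
              apply setLIntegral_mono' measurableSet_Ico
              intro x hx
              rw [← ofReal_norm, ← ofReal_norm, ← ENNReal.ofReal_add (by positivity) (by positivity)]
              apply ENNReal.ofReal_le_ofReal
              linarith [h1 x hx]
          _ = (∫⁻ x in Ico c (c+s), ‖TT f ε (Ioo (c - s) (c + 2 * s)) x‖ₑ ∂μ) +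
              ENNReal.ofReal (149 * l) * μ (Ico c (c+s)) := by
              rw [lintegral_add_right _ measurable_const, setLIntegral_const]
          _ ≤ _ := by
              rw [add_comm]
              exact add_le_add le_rfl (hO c s hs hsl)
    have hbm := bad_meas hf hε hUm l
    have hspl : Ico b (b+r) = Ico b (b+r/2) ∪ Ico (b+r/2) (b+r/2+r/2) := by
      rw [Ico_union_Ico_eq_Ico (by linarith) (by linarith)]; congr 1; ring
    have hdis : Disjoint (Ico b (b+r/2)) (Ico (b+r/2) (b+r/2+r/2)) := by
      rw [Set.disjoint_left]; intro x hx hx'; linarith [hx.2, hx'.1]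
    have hr2 : r/2 ≤ 2^M * ε := by rw [pow_succ] at hrM; linarith
    have hsub1 : Ico b (b+r/2) ⊆ Ico b (b+r) := by rw [hspl]; exact subset_union_left
    have hsub2 : Ico (b+r/2) (b+r/2+r/2) ⊆ Ico b (b+r) := by rw [hspl]; exact subset_union_right
    have e4 : r/4 = r/2/2 := by ring
    rw [e4] at hv
    obtain ⟨G1, hG1, hG1m, hG1v, hG1i⟩ := hhalf b (r/2) (by linarith) hr2 (by linarith) hb1 (by linarith)
      ((measure_mono (inter_subset_inter_left _ hsub1)).trans hv)
    obtain ⟨G2, hG2, hG2m, hG2v, hG2i⟩ := hhalf (b+r/2) (r/2) (by linarith) hr2 (by linarith) (by linarith) (by linarith)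
      ((measure_mono (inter_subset_inter_left _ hsub2)).trans hv)
    have hGd : Disjoint G1 G2 := hdis.mono hG1 hG2
    refine ⟨G1 ∪ G2, ?_, hG1m.union hG2m, ?_, ?_⟩
    · rw [hspl]; exact union_subset_union hG1 hG2
    · rw [hspl, union_inter_distrib_right, measure_union (hdis.mono inter_subset_left inter_subset_left)
        (measurableSet_Ico.inter hbm), mul_add]
      exact (measure_union_le _ _).trans (add_le_add hG1v hG2v)
    · rw [hspl, lintegral_union measurableSet_Ico hdis, measure_union hdis measurableSet_Ico,
        measure_union hGd hG2m]
      refine (add_le_add hG1i hG2i).trans (le_of_eq ?_)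
      ring

lemma outer_ind {f : ℝ → ℝ} (hf : Integrable f) (hfm : Measurable f) (h0 : ∀ t, 0 ≤ f t)
    {ε : ℝ} (hε : 0 < ε) (μ ν : Measure ℝ)
    (hKH : ∀ a ℓ, 0 < ℓ → ∀ E ⊆ Ico a (a+ℓ), MeasurableSet E → ENNReal.ofReal (ℓ/2) ≤ volume E →
      ENNReal.ofReal ((∫ t in Ioo (a-ℓ) (a+2*ℓ), f t) / ℓ) * μ (Ico a (a+ℓ)) ≤ ν E) (N : ℕ) :
    ∀ a ℓ, 0 < ℓ → ℓ ≤ 2^N * ε →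
      ∫⁻ x in Ico a (a+ℓ), ‖TT f ε (Ioo (a-ℓ) (a+2*ℓ)) x‖ₑ ∂μ ≤ 19072 * ν (Ico a (a+ℓ)) := by
  induction N with
  | zero =>
    intro a ℓ hℓ hN
    have hI : 0 ≤ ∫ t in Ioo (a-ℓ) (a+2*ℓ), f t := integral_nonneg h0
    have h1 := hKH a ℓ hℓ _ subset_rfl measurableSet_Ico (by
      rw [Real.volume_Ico]; apply ENNReal.ofReal_le_ofReal; linarith)
    refine le_trans ?_ (h1.trans ?_)
    · rw [← setLIntegral_const]
      apply setLIntegral_mono' measurableSet_Ico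
      intro x hx
      rw [← ofReal_norm]
      apply ENNReal.ofReal_le_ofReal
      refine (TT_le hf h0 hε measurableSet_Ioo x).trans ?_
      simp at hN
      gcongr
    · nth_rewrite 1 [← one_mul (ν _)]
      exact mul_le_mul' (by norm_num) le_rfl
  | succ N ih =>
    intro a ℓ hℓ hN
    set U := Ioo (a-ℓ) (a+2*ℓ) with hU
    have hUm : MeasurableSet U := measurableSet_Ioo
    have hI : 0 ≤ ∫ t in U, f t := integral_nonneg h0
    rcases hI.eq_or_lt with hI0 | hI0
    · have : ∀ x, ‖TT f ε U x‖ₑ = 0 := by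
        intro x
        have := TT_le hf h0 hε hUm x
        rw [← hI0, zero_div] at this
        simpa using this
      simp [this]
    set m := (∫ t in U, f t) / ℓ with hm
    have hm0 : 0 < m := by positivity
    set l := 128 * m with hl
    have hl0 : 0 < l := by positivity
    have hbv : volume (bad f ε U l) ≤ ENNReal.ofReal (ℓ/8) := by
      refine (bad_vol hf hfm h0 hε hUm hl0).trans (ENNReal.ofReal_le_ofReal (le_of_eq ?_))
      rw [hl, hm]; field_simp; norm_num
    obtain ⟨M, hM⟩ := pow_unbounded_of_one_lt (ℓ / ε) (one_lt_two : (1:ℝ) < 2)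
    rw [div_lt_iff₀ hε] at hM
    have hv : volume (Ico a (a+ℓ) ∩ bad f ε U l) ≤ ENNReal.ofReal (ℓ/8) :=
      (measure_mono inter_subset_right).trans hbv
    obtain ⟨G, hG, hGm, hGv, hGi⟩ := inner_ind hf hfm h0 hε μ ν (a := a) (ℓ := ℓ) hl0 19072 (by
        intro b r hr hrl
        exact ih b r hr (by rw [pow_succ] at hN; linarith)) M a ℓ hℓ hM.le le_rfl le_rfl
        (hv.trans (ENNReal.ofReal_le_ofReal (by linarith)))
    have hGv' : volume G ≤ ENNReal.ofReal (ℓ/2) := by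
      refine hGv.trans ((mul_le_mul' le_rfl hv).trans (le_of_eq ?_))
      rw [← ENNReal.ofReal_ofNat, ← ENNReal.ofReal_mul (by norm_num)]
      congr 1; norm_num; ring
    have hE : ENNReal.ofReal (ℓ/2) ≤ volume (Ico a (a+ℓ) \ G) := by
      refine le_trans ?_ (le_measure_sdiff)
      rw [Real.volume_Ico]
      refine le_trans ?_ (tsub_le_tsub_left hGv' _)
      rw [← ENNReal.ofReal_sub _ (by positivity)]
      apply ENNReal.ofReal_le_ofReal; linarith
    have h1 := hKH a ℓ hℓ _ (sdiff_subset) (measurableSet_Ico.diff hGm) hE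
    refine hGi.trans ?_
    have e : ENNReal.ofReal (149 * l) = 19072 * ENNReal.ofReal m := by
      rw [hl, ← ENNReal.ofReal_ofNat, ← ENNReal.ofReal_mul (by norm_num)]
      congr 1; norm_num; ring
    rw [e, mul_assoc]
    refine (add_le_add (mul_le_mul' le_rfl h1) le_rfl).trans (le_of_eq ?_)
    rw [← mul_add, add_comm, ← measure_union disjoint_sdiff_self_right (measurableSet_Ico.diff hGm),
      union_sdiff_cancel hG]

lemma num_real {X Y x y L N r : ℝ} (hr : 2 ≤ r) (hx : 0 < x) (hy : 0 < y) (hxX : x ≤ X) (hyY : y ≤ Y)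
    (hL : 0 < L) (hN : 0 ≤ N) (h1 : X * Y ^ (r - 1) ≤ N * L ^ r)
    (h2 : L ≤ 6 * (x ^ (1/r) * y ^ (1 - 1/r))) :
    X * Y ≤ 6 ^ (r-1) * N * L * (y ^ (1/r) * x ^ (1 - 1/r)) := by
  have hX : 0 < X := by linarith
  have hY : 0 < Y := by linarith
  have hr0 : 0 < r := by linarith
  have e1 : X * Y = (X * Y ^ (r-1)) * Y ^ (2 - r) := by
    rw [mul_assoc, ← Real.rpow_add hY]; norm_num
  have e2 : Y ^ (2 - r) ≤ y ^ (2 - r) := Real.rpow_le_rpow_of_nonpos hy hyY (by linarith)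
  have e3 : L ^ r = L * L ^ (r-1) := by
    rw [← Real.rpow_one_add' hL.le (by linarith)]; ring_nf
  have e4 : L ^ (r-1) ≤ 6 ^ (r-1) * (x ^ (1 - 1/r) * y ^ ((1-1/r)*(r-1))) := by
    refine (Real.rpow_le_rpow hL.le h2 (by linarith)).trans (le_of_eq ?_)
    rw [Real.mul_rpow (by norm_num) (by positivity), Real.mul_rpow (by positivity) (by positivity),
      ← Real.rpow_mul hx.le, ← Real.rpow_mul hy.le]
    congr 3
    field_simp
  have e5 : y ^ ((1-1/r)*(r-1)) * y ^ (2 - r) = y ^ (1/r) := by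
    rw [← Real.rpow_add hy]; congr 1; field_simp; ring
  calc X * Y = (X * Y ^ (r-1)) * Y ^ (2 - r) := e1
    _ ≤ (N * (L * L^(r-1))) * y ^ (2 - r) := by rw [← e3]; gcongr
    _ ≤ (N * (L * (6 ^ (r-1) * (x ^ (1 - 1/r) * y ^ ((1-1/r)*(r-1)))))) * y ^ (2 - r) := by gcongr
    _ = 6 ^ (r-1) * N * L * ((y ^ ((1-1/r)*(r-1)) * y ^ (2 - r)) * x ^ (1 - 1/r)) := by ring
    _ = _ := by rw [e5]

lemma num_enn {X Y x y L N : ℝ≥0∞} {r : ℝ} (hr : 2 ≤ r) (hx : x ≠ 0) (hy : y ≠ 0) (hxX : x ≤ X) (hyY : y ≤ Y)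
    (hX : X ≠ ⊤) (hY : Y ≠ ⊤) (hL : L ≠ 0) (hLt : L ≠ ⊤)
    (hN : N ≠ ⊤) (h1 : X * Y ^ (r - 1) ≤ N * L ^ r)
    (h2 : L ≤ 6 * (x ^ (1/r) * y ^ (1 - 1/r))) :
    X * Y ≤ 6 ^ (r-1) * N * L * (y ^ (1/r) * x ^ (1 - 1/r)) := by
  have hxt : x ≠ ⊤ := ne_top_of_le_ne_top hX hxX
  have hyt : y ≠ ⊤ := ne_top_of_le_ne_top hY hyY
  have hr1 : 0 ≤ 1 - 1/r := by
    rw [sub_nonneg, div_le_one (by linarith)]; linarith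
  have hr2 : 0 ≤ 1/r := by positivity
  have key := num_real (X := X.toReal) (Y := Y.toReal) (x := x.toReal) (y := y.toReal) (L := L.toReal)
    (N := N.toReal) hr (ENNReal.toReal_pos hx hxt) (ENNReal.toReal_pos hy hyt)
    (ENNReal.toReal_mono hX hxX) (ENNReal.toReal_mono hY hyY) (ENNReal.toReal_pos hL hLt)
    ENNReal.toReal_nonneg ?_ ?_
  · rw [← ENNReal.toReal_le_toReal (ENNReal.mul_ne_top hX hY)]
    · have e6 : ((6:ℝ≥0∞)^(r-1)).toReal = 6^(r-1) := by rw [← ENNReal.toReal_rpow]; simp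
      rw [← e6] at key
      simpa [ENNReal.toReal_mul, ENNReal.toReal_rpow] using key
    · apply ENNReal.mul_ne_top (ENNReal.mul_ne_top (ENNReal.mul_ne_top _ hN) hLt)
      · exact ENNReal.mul_ne_top (ENNReal.rpow_ne_top_of_nonneg hr2 hyt) (ENNReal.rpow_ne_top_of_nonneg hr1 hxt)
      · exact ENNReal.rpow_ne_top_of_nonneg (by linarith) (by simp)
  · have := ENNReal.toReal_mono (ENNReal.mul_ne_top hN (ENNReal.rpow_ne_top_of_nonneg (by linarith) hLt)) h1
    simpa [ENNReal.toReal_mul, ENNReal.toReal_rpow] using this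
  · have := ENNReal.toReal_mono (ENNReal.mul_ne_top (by simp) (ENNReal.mul_ne_top (ENNReal.rpow_ne_top_of_nonneg hr2 hxt) (ENNReal.rpow_ne_top_of_nonneg hr1 hyt))) h2
    simpa [ENNReal.toReal_mul, ENNReal.toReal_rpow] using this

/-- the dual weight -/
def dw (p : ℝ) (u : ℝ → ℝ≥0∞) (x : ℝ) : ℝ≥0∞ := u x ^ (1 - p / (p - 1))

lemma holder_E {p : ℝ} (hp : 1 < p) {u : ℝ → ℝ≥0∞} (hu : Measurable u) (hu0 : ∀ x, u x ≠ 0)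
    (hut : ∀ x, u x ≠ ⊤) (E : Set ℝ) :
    volume E ≤ (∫⁻ x in E, u x) ^ (1/p) * (∫⁻ x in E, dw p u x) ^ (1 - 1/p) := by
  have hp0 : 0 < p := by linarith
  have hp1 : p - 1 ≠ 0 := by linarith
  have hc : p.HolderConjugate (p/(p-1)) := Real.HolderConjugate.conjExponent hp
  have h := ENNReal.lintegral_mul_le_Lp_mul_Lq (volume.restrict E) hc (f := fun x => u x ^ (1/p))
    (g := fun x => u x ^ (-(1/p))) (hu.pow_const _).aemeasurable (hu.pow_const _).aemeasurable
  have e1 : ∀ x, ((fun x => u x ^ (1/p)) * (fun x => u x ^ (-(1/p)))) x = 1 := by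
    intro x
    simp only [Pi.mul_apply]
    rw [← ENNReal.rpow_add _ _ (hu0 x) (hut x)]; simp
  have e2 : ∀ x, (u x ^ (1/p)) ^ p = u x := by
    intro x; rw [← ENNReal.rpow_mul]; field_simp; simp
  have e3 : ∀ x, (u x ^ (-(1/p))) ^ (p/(p-1)) = dw p u x := by
    intro x; rw [← ENNReal.rpow_mul]; unfold dw; congr 1; field_simp; ring
  have e4 : 1 / (p/(p-1)) = 1 - 1/p := by field_simp
  simp only [e1, e2, e3, e4] at h
  simpa using h

def ApB (p : ℝ) (u : ℝ → ℝ≥0∞) (A : ℝ≥0∞) : Prop :=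
  ∀ a b : ℝ, a < b → (∫⁻ x in Ioo a b, u x) * (∫⁻ x in Ioo a b, dw p u x) ^ (p-1)
    ≤ A * ENNReal.ofReal (b - a) ^ p

lemma dw_ne_zero {p : ℝ} {u : ℝ → ℝ≥0∞} (hu0 : ∀ x, u x ≠ 0) (hut : ∀ x, u x ≠ ⊤) (x : ℝ) : dw p u x ≠ 0 := by
  unfold dw; simp [ENNReal.rpow_eq_zero_iff, hu0 x, hut x]
lemma dw_ne_top {p : ℝ} {u : ℝ → ℝ≥0∞} (hu0 : ∀ x, u x ≠ 0) (hut : ∀ x, u x ≠ ⊤) (x : ℝ) : dw p u x ≠ ⊤ := by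
  unfold dw; simp [ENNReal.rpow_eq_top_iff, hu0 x, hut x]
lemma dw_meas {p : ℝ} {u : ℝ → ℝ≥0∞} (hu : Measurable u) : Measurable (dw p u) := hu.pow_const _

lemma int_ne_zero {u : ℝ → ℝ≥0∞} (hu : Measurable u) (hu0 : ∀ x, u x ≠ 0) {E : Set ℝ}
    (hE : volume E ≠ 0) : ∫⁻ x in E, u x ≠ 0 := by
  rw [Ne, lintegral_eq_zero_iff hu]
  intro h
  have : ∀ᵐ x ∂(volume.restrict E), False := by
    filter_upwards [h] with x hx using hu0 x hx
  simp at this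
  exact hE this

lemma ApB_fin {p : ℝ} (hp : 1 < p) {u : ℝ → ℝ≥0∞} (hu : Measurable u) (hu0 : ∀ x, u x ≠ 0)
    (hut : ∀ x, u x ≠ ⊤) {A : ℝ≥0∞} (hA : A ≠ ⊤) (h : ApB p u A) {a b : ℝ} (hab : a < b) :
    ∫⁻ x in Ioo a b, u x ≠ ⊤ ∧ ∫⁻ x in Ioo a b, dw p u x ≠ ⊤ := by
  have h1 := h a b hab
  have hv : volume (Ioo a b) ≠ 0 := by simp [hab]
  have n1 := int_ne_zero hu hu0 hv
  have n2 := int_ne_zero (dw_meas (p := p) hu) (dw_ne_zero hu0 hut) hv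
  have hR : A * ENNReal.ofReal (b - a) ^ p ≠ ⊤ :=
    ENNReal.mul_ne_top hA (ENNReal.rpow_ne_top_of_nonneg (by linarith) ENNReal.ofReal_ne_top)
  have h2 := ne_top_of_le_ne_top hR h1
  have hp1 : 0 < p - 1 := by linarith
  constructor
  · intro ht; rw [ht, ENNReal.top_mul] at h2
    · exact h2 rfl
    · simp [ENNReal.rpow_eq_zero_iff, n2, hp1, hp1.le, hp1.not_gt]
  · intro ht; rw [ht, ENNReal.top_rpow_of_pos hp1, ENNReal.mul_top n1] at h2
    exact h2 rfl

lemma XY_bd {p : ℝ} (hp : 1 < p) : ∃ c : ℝ≥0∞, c ≠ ⊤ ∧ ∀ (u : ℝ → ℝ≥0∞), Measurable u → (∀ x, u x ≠ 0) →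
    (∀ x, u x ≠ ⊤) → ∀ A : ℝ≥0∞, A ≠ ⊤ → ApB p u A → ∀ a b : ℝ, a < b → ∀ E ⊆ Ioo a b,
    ENNReal.ofReal (b - a) ≤ 6 * volume E →
    (∫⁻ x in Ioo a b, u x) * (∫⁻ x in Ioo a b, dw p u x) ≤
      c * A ^ (max 1 ((p / (p - 1)) / p)) * ENNReal.ofReal (b - a) *
       ((∫⁻ x in E, dw p u x) ^ (1/p) * (∫⁻ x in E, u x) ^ (1 - 1/p)) := by
  have hp0 : 0 < p := by linarith
  have hp1 : 0 < p - 1 := by linarith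
  by_cases h2 : 2 ≤ p
  · refine ⟨6 ^ (p-1), ENNReal.rpow_ne_top_of_nonneg (by linarith) (by simp), ?_⟩
    intro u hu hu0 hut A hA h a b hab E hE hEv
    have e : max 1 ((p / (p - 1)) / p) = 1 := by
      apply max_eq_left; rw [div_div, div_le_one (by positivity)]; nlinarith
    rw [e, ENNReal.rpow_one]
    have hba : ENNReal.ofReal (b - a) ≠ 0 := by simpa using hab
    have hv : volume E ≠ 0 := by
      intro h0; rw [h0, mul_zero] at hEv; exact hba (le_zero_iff.1 hEv)
    obtain ⟨f1, f2⟩ := ApB_fin hp hu hu0 hut hA h hab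
    exact num_enn h2 (int_ne_zero hu hu0 hv) (int_ne_zero (dw_meas hu) (dw_ne_zero hu0 hut) hv)
      (lintegral_mono_set hE) (lintegral_mono_set hE) f1 f2 hba ENNReal.ofReal_ne_top hA (h a b hab)
      (hEv.trans (mul_le_mul' le_rfl (holder_E hp hu hu0 hut E)))
  · push Not at h2
    set r := p / (p - 1) with hr
    have hr2 : 2 ≤ r := by rw [hr, le_div_iff₀ hp1]; linarith
    refine ⟨6 ^ (r-1), ENNReal.rpow_ne_top_of_nonneg (by linarith) (by simp), ?_⟩
    intro u hu hu0 hut A hA h a b hab E hE hEv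
    have er : r - 1 = 1 / (p-1) := by rw [hr]; field_simp; ring
    have er2 : r / p = r - 1 := by rw [er, hr]; field_simp
    have e : max 1 (r / p) = r - 1 := by
      rw [er2]; apply max_eq_right; linarith
    rw [e]
    have hba : ENNReal.ofReal (b - a) ≠ 0 := by simpa using hab
    have hv : volume E ≠ 0 := by
      intro h0; rw [h0, mul_zero] at hEv; exact hba (le_zero_iff.1 hEv)
    obtain ⟨f1, f2⟩ := ApB_fin hp hu hu0 hut hA h hab
    have e1 : 1 / r = 1 - 1/p := by rw [hr]; field_simp
    have e2 : 1 - 1/r = 1/p := by rw [e1]; ring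
    have := num_enn (X := ∫⁻ x in Ioo a b, dw p u x) (Y := ∫⁻ x in Ioo a b, u x)
      (x := ∫⁻ x in E, dw p u x) (y := ∫⁻ x in E, u x) (L := ENNReal.ofReal (b-a)) (N := A ^ (r-1))
      hr2 (int_ne_zero (dw_meas hu) (dw_ne_zero hu0 hut) hv) (int_ne_zero hu hu0 hv)
      (lintegral_mono_set hE) (lintegral_mono_set hE) f2 f1 hba ENNReal.ofReal_ne_top
      (ENNReal.rpow_ne_top_of_nonneg (by linarith) hA) ?_ ?_
    · rw [mul_comm (∫⁻ x in Ioo a b, u x)]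
      refine this.trans (le_of_eq ?_)
      rw [e2, e1, mul_comm (lintegral _ _ ^ _)]
    · have := ENNReal.rpow_le_rpow (h a b hab) (show 0 ≤ r - 1 by linarith)
      rw [ENNReal.mul_rpow_of_nonneg _ _ (by linarith), ENNReal.mul_rpow_of_nonneg _ _ (by linarith),
        ← ENNReal.rpow_mul, ← ENNReal.rpow_mul, er] at this
      rw [er, mul_comm]
      convert this using 2
      · rw [mul_one_div_cancel hp1.ne', ENNReal.rpow_one]
      · congr 1; rw [hr]; field_simp
    · rw [e2, e1]
      refine hEv.trans (mul_le_mul' le_rfl ?_)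
      rw [mul_comm]
      exact holder_E hp hu hu0 hut E

lemma young_enn {p : ℝ} (hp : 1 < p) (α β x y : ℝ≥0∞) :
    α * β * (y ^ (1/p) * x ^ (1 - 1/p)) ≤ α ^ p * y + β ^ (p/(p-1)) * x := by
  have hp0 : 0 < p := by linarith
  have hp1 : 0 < p - 1 := by linarith
  have hc : p.HolderConjugate (p/(p-1)) := Real.HolderConjugate.conjExponent hp
  have h := ENNReal.young_inequality (α * y ^ (1/p)) (β * x ^ (1 - 1/p)) hc
  have e1 : (α * y ^ (1/p)) ^ p = α ^ p * y := by
    rw [ENNReal.mul_rpow_of_nonneg _ _ hp0.le, ← ENNReal.rpow_mul]; field_simp; simp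
  have e2 : (β * x ^ (1 - 1/p)) ^ (p/(p-1)) = β ^ (p/(p-1)) * x := by
    rw [ENNReal.mul_rpow_of_nonneg _ _ (by positivity), ← ENNReal.rpow_mul]
    have : (1 - 1/p) * (p/(p-1)) = 1 := by field_simp
    rw [this, ENNReal.rpow_one]
  rw [e1, e2] at h
  have e3 : α * β * (y ^ (1/p) * x ^ (1 - 1/p)) = α * y ^ (1/p) * (β * x ^ (1 - 1/p)) := by ring
  rw [e3]
  refine h.trans (add_le_add ?_ ?_)
  · apply ENNReal.div_le_of_le_mul
    nth_rewrite 1 [← mul_one (α ^ p * y)]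
    refine mul_le_mul' le_rfl ?_
    simpa using hp.le
  · apply ENNReal.div_le_of_le_mul
    nth_rewrite 1 [← mul_one (β ^ _ * x)]
    refine mul_le_mul' le_rfl ?_
    have : 1 ≤ p/(p-1) := by rw [le_div_iff₀ hp1]; linarith
    simpa using this

def nuM (p : ℝ) (u h g : ℝ → ℝ≥0∞) : Measure ℝ :=
  (volume.withDensity (dw p u)).withDensity (fun x => maxF (volume.withDensity (dw p u)) h x ^ p) +
  (volume.withDensity u).withDensity (fun x => maxF (volume.withDensity u) g x ^ (p/(p-1)))

lemma avg_part {v h : ℝ → ℝ≥0∞} (hv : Measurable v) (hh : Measurable h) {I : ℝ × ℝ} {q : ℝ} (hq : 0 ≤ q) {E : Set ℝ}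
    (hE : E ⊆ ivl I) (hEm : MeasurableSet E) :
    ((∫⁻ x in ivl I, h x * v x) / ∫⁻ x in ivl I, v x) ^ q * ∫⁻ x in E, v x ≤
     (volume.withDensity v).withDensity (fun x => maxF (volume.withDensity v) h x ^ q) E := by
  rw [withDensity_apply _ hEm, ← withDensity_apply _ hEm, ← setLIntegral_const]
  apply setLIntegral_mono' hEm
  intro x hx
  refine ENNReal.rpow_le_rpow ?_ hq
  refine le_trans (le_of_eq ?_) (le_maxF (volume.withDensity v) h I x (hE hx))
  have hm : MeasurableSet (ivl I) := measurableSet_Ioo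
  rw [withDensity_apply _ hm, restrict_withDensity hm, lintegral_withDensity_eq_lintegral_mul _ hv hh]
  simp only [Pi.mul_apply, mul_comm]

lemma KH_w {p : ℝ} (hp : 1 < p) : ∃ c : ℝ≥0∞, c ≠ ⊤ ∧ ∀ (u : ℝ → ℝ≥0∞), Measurable u → (∀ x, u x ≠ 0) →
    (∀ x, u x ≠ ⊤) → ∀ A : ℝ≥0∞, A ≠ ⊤ → ApB p u A → ∀ (f : ℝ → ℝ), Integrable f → Measurable f →
    (∀ t, 0 ≤ f t) → ∀ g : ℝ → ℝ≥0∞, Measurable g →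
    ∀ a ℓ, 0 < ℓ → ∀ E ⊆ Ico a (a+ℓ), MeasurableSet E → ENNReal.ofReal (ℓ/2) ≤ volume E →
      ENNReal.ofReal ((∫ t in Ioo (a-ℓ) (a+2*ℓ), f t) / ℓ) * (volume.withDensity (fun x => g x * u x)) (Ico a (a+ℓ))
       ≤ ((c * A ^ (max 1 ((p / (p - 1)) / p))) •
        nuM p u (fun x => ENNReal.ofReal (f x) / dw p u x) g) E := by
  obtain ⟨c, hc, H⟩ := XY_bd hp
  refine ⟨3 * c, ENNReal.mul_ne_top (by simp) hc, ?_⟩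
  intro u hu hu0 hut A hA hAp f hf hfm h0 g hg a ℓ hℓ E hE hEm hEv
  have hp0 : 0 < p := by linarith
  have hp1 : 0 < p - 1 := by linarith
  set I : ℝ × ℝ := (a-ℓ, a+2*ℓ) with hI
  have hEI : E ⊆ ivl I := by
    intro x hx; have := hE hx; exact ⟨by simp [hI]; linarith [this.1], by simp [hI]; linarith [this.2]⟩
  have hab : a - ℓ < a + 2*ℓ := by linarith
  have hlen : a + 2*ℓ - (a-ℓ) = 3 * ℓ := by ring
  have h1 := H u hu hu0 hut A hA hAp (a-ℓ) (a+2*ℓ) hab E hEI (by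
    rw [hlen]
    refine le_trans (le_of_eq ?_) (mul_le_mul' le_rfl hEv)
    rw [← ENNReal.ofReal_ofNat, ← ENNReal.ofReal_mul (by norm_num)]
    congr 1; norm_num; ring)
  rw [hlen] at h1
  obtain ⟨f1, f2⟩ := ApB_fin hp hu hu0 hut hA hAp hab
  have hv : volume (Ioo (a-ℓ) (a+2*ℓ)) ≠ 0 := by simp; linarith
  have n1 := int_ne_zero hu hu0 hv
  have n2 := int_ne_zero (dw_meas (p := p) hu) (dw_ne_zero hu0 hut) hv
  set h := fun x => ENNReal.ofReal (f x) / dw p u x with hh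
  have hhm : Measurable h := hfm.ennreal_ofReal.div (dw_meas hu)
  set X := ∫⁻ x in Ioo (a-ℓ) (a+2*ℓ), u x with hX
  set Y := ∫⁻ x in Ioo (a-ℓ) (a+2*ℓ), dw p u x with hY
  set x := ∫⁻ x in E, u x
  set y := ∫⁻ x in E, dw p u x
  have p1 := avg_part (dw_meas (p := p) hu) hhm (I := I) (q := p) hp0.le hEI hEm
  have p2 := avg_part hu hg (I := I) (q := p/(p-1)) (by positivity) hEI hEm
  change (_ / Y) ^ p * y ≤ _ at p1
  change (_ / X) ^ (p/(p-1)) * x ≤ _ at p2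
  set F := ∫⁻ x in ivl I, h x * dw p u x with hF
  set G := ∫⁻ x in ivl I, g x * u x with hG
  have eF : F = ENNReal.ofReal (∫ t in Ioo (a-ℓ) (a+2*ℓ), f t) := by
    rw [ofReal_integral_eq_lintegral_ofReal hf.integrableOn (Eventually.of_forall h0), hF]
    apply lintegral_congr
    intro t
    exact ENNReal.div_mul_cancel (dw_ne_zero hu0 hut t) (dw_ne_top hu0 hut t)
  have eG : (volume.withDensity (fun x => g x * u x)) (Ico a (a+ℓ)) ≤ G := by
    rw [withDensity_apply _ measurableSet_Ico]
    apply lintegral_mono_set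
    intro x hx; exact ⟨by simp [hI]; linarith [hx.1], by simp [hI]; linarith [hx.2]⟩
  rw [ENNReal.ofReal_div_of_pos hℓ, ← eF]
  have hℓ0 : ENNReal.ofReal ℓ ≠ 0 := by simpa using hℓ
  calc _ ≤ F / ENNReal.ofReal ℓ * G := mul_le_mul' le_rfl eG
    _ = (F / Y) * (G / X) * (X * Y) / ENNReal.ofReal ℓ := by
      have eF' : F = F / Y * Y := (ENNReal.div_mul_cancel n2 f2).symm
      have eG' : G = G / X * X := (ENNReal.div_mul_cancel n1 f1).symm
      nth_rewrite 1 [eF']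
      nth_rewrite 1 [eG']
      simp only [div_eq_mul_inv]
      ring
    _ ≤ (F / Y) * (G / X) * (c * A ^ (max 1 ((p / (p - 1)) / p)) * ENNReal.ofReal (3 * ℓ) *
       (y ^ (1/p) * x ^ (1 - 1/p))) / ENNReal.ofReal ℓ := by
      refine ENNReal.div_le_div_right (mul_le_mul' le_rfl h1) _
    _ = 3 * c * A ^ (max 1 ((p / (p - 1)) / p)) * ((F / Y) * (G / X) * (y ^ (1/p) * x ^ (1 - 1/p))) := by
      rw [ENNReal.ofReal_mul (by norm_num), ENNReal.ofReal_ofNat, div_eq_mul_inv]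
      have : ENNReal.ofReal ℓ * (ENNReal.ofReal ℓ)⁻¹ = 1 := ENNReal.mul_inv_cancel hℓ0 ENNReal.ofReal_ne_top
      calc _ = 3 * c * A ^ (max 1 ((p / (p - 1)) / p)) * ((F / Y) * (G / X) * (y ^ (1/p) * x ^ (1 - 1/p))) *
            (ENNReal.ofReal ℓ * (ENNReal.ofReal ℓ)⁻¹) := by ring
        _ = _ := by rw [this, mul_one]
    _ ≤ _ := by
      rw [Measure.smul_apply, smul_eq_mul]
      refine mul_le_mul' le_rfl ((young_enn hp _ _ _ _).trans ?_)
      unfold nuM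
      rw [Measure.add_apply]
      exact add_le_add p1 p2

lemma absorb {p : ℝ} (hp : 1 < p) {κ C J Z : ℝ≥0∞} (hκ : κ ≠ 0) (hκt : κ ≠ ⊤) (hC : 1 ≤ C) (hCt : C ≠ ⊤)
    (hJ : J ≠ ⊤) (H : ∀ s : ℝ≥0∞, s ≠ 0 → s ≠ ⊤ → s * J ≤ κ * (C * Z + C * (s ^ (p/(p-1)) * J))) :
    J ≤ (2 * κ * C) ^ p * Z := by
  have hp0 : 0 < p := by linarith
  have hp1 : 0 < p - 1 := by linarith
  set D := 2 * κ * C with hD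
  have hC0 : C ≠ 0 := (lt_of_lt_of_le one_pos hC).ne'
  have hD0 : D ≠ 0 := by simp [hD, hκ, hC0]
  have hDt : D ≠ ⊤ := ENNReal.mul_ne_top (ENNReal.mul_ne_top (by simp) hκt) hCt
  set s := D ^ (-(p-1)) with hs
  have hs0 : s ≠ 0 := by simp [hs, ENNReal.rpow_eq_zero_iff, hD0, hDt]
  have hst : s ≠ ⊤ := by simp [hs, ENNReal.rpow_eq_top_iff, hD0, hDt]
  have h := H s hs0 hst
  have e1 : s ^ (p/(p-1)) = s * D⁻¹ := by
    rw [hs, ← ENNReal.rpow_mul, ← ENNReal.rpow_neg_one, ← ENNReal.rpow_add _ _ hD0 hDt]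
    congr 1; field_simp; ring
  have e2 : D * (s ^ (p/(p-1)) * J) = s * J := by
    rw [e1]
    calc _ = (D * D⁻¹) * (s * J) := by ring
      _ = _ := by rw [ENNReal.mul_inv_cancel hD0 hDt, one_mul]
  have h2 : s * J + s * J ≤ D * Z + s * J := by
    calc s * J + s * J = 2 * (s * J) := by ring
      _ ≤ 2 * (κ * (C * Z + C * (s ^ (p/(p-1)) * J))) := mul_le_mul' le_rfl h
      _ = D * Z + D * (s ^ (p/(p-1)) * J) := by rw [hD]; ring
      _ = _ := by rw [e2]
  have h3 : s * J ≤ D * Z := (ENNReal.add_le_add_iff_right (ENNReal.mul_ne_top hst hJ)).1 h2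
  have e3 : D ^ (p-1) * s = 1 := by
    rw [hs, ← ENNReal.rpow_add _ _ hD0 hDt]; simp
  calc J = D ^ (p-1) * (s * J) := by rw [← mul_assoc, e3, one_mul]
    _ ≤ D ^ (p-1) * (D * Z) := mul_le_mul' le_rfl h3
    _ = _ := by
      rw [← mul_assoc]
      congr 1
      nth_rewrite 2 [← ENNReal.rpow_one D]
      rw [← ENNReal.rpow_add _ _ hD0 hDt]; simp

lemma ApB_ne_zero {p : ℝ} (hp : 1 < p) {u : ℝ → ℝ≥0∞} (hu : Measurable u) (hu0 : ∀ x, u x ≠ 0)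
    (hut : ∀ x, u x ≠ ⊤) {A : ℝ≥0∞} (h : ApB p u A) : A ≠ 0 := by
  rintro rfl
  have h1 := h 0 1 one_pos
  have hv : volume (Ioo (0:ℝ) 1) ≠ 0 := by simp
  have n1 := int_ne_zero hu hu0 hv
  have n2 := int_ne_zero (dw_meas (p := p) hu) (dw_ne_zero hu0 hut) hv
  have hp1 : 0 < p - 1 := by linarith
  rw [zero_mul, nonpos_iff_eq_zero, mul_eq_zero] at h1
  rcases h1 with h1 | h1
  · exact n1 h1
  · rw [ENNReal.rpow_eq_zero_iff_of_pos hp1] at h1; exact n2 h1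

lemma oneD_loc {p : ℝ} (hp : 1 < p) : ∃ C : ℝ≥0∞, C ≠ ⊤ ∧ ∀ (u : ℝ → ℝ≥0∞), Measurable u → (∀ x, u x ≠ 0) →
    (∀ x, u x ≠ ⊤) → ∀ A : ℝ≥0∞, A ≠ ⊤ → ApB p u A → ∀ (f : ℝ → ℝ), Integrable f → Measurable f →
    (∀ t, 0 ≤ f t) → ∀ ε, 0 < ε → ∀ a ℓ, 0 < ℓ →
      ∫⁻ x in Ico a (a+ℓ), ‖TT f ε (Ioo (a-ℓ) (a+2*ℓ)) x‖ₑ ^ p * u x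
        ≤ (C * A ^ (max 1 ((p / (p - 1)) / p))) ^ p * ∫⁻ x, ENNReal.ofReal (f x) ^ p * u x := by
  have hp0 : 0 < p := by linarith
  have hp1 : 0 < p - 1 := by linarith
  have hq : 1 < p/(p-1) := by rw [lt_div_iff₀ hp1]; linarith
  obtain ⟨c, hc, HK⟩ := KH_w hp
  obtain ⟨C1, hC1, H1⟩ := maxF_Lp hp
  obtain ⟨C2, hC2, H2⟩ := maxF_Lp hq
  set θ := max 1 ((p / (p - 1)) / p) with hθ
  set C3 := C1 + C2 + 1 with hC3
  have hC3t : C3 ≠ ⊤ := by simp [hC3, hC1, hC2]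
  refine ⟨2 * (19072 * (c+1)) * C3, ENNReal.mul_ne_top (ENNReal.mul_ne_top (by simp) (ENNReal.mul_ne_top (by simp) (by simp [hc]))) hC3t, ?_⟩
  intro u hu hu0 hut A hA hAp f hf hfm h0 ε hε a ℓ hℓ
  have hA0 := ApB_ne_zero hp hu hu0 hut hAp
  set T := TT f ε (Ioo (a-ℓ) (a+2*ℓ)) with hT
  have hTc : Continuous T := TT_cont hf hε measurableSet_Ioo
  set J := ∫⁻ x in Ico a (a+ℓ), ‖T x‖ₑ ^ p * u x with hJ
  set Z := ∫⁻ x, ENNReal.ofReal (f x) ^ p * u x with hZ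
  have hθ0 : 0 ≤ θ := le_trans zero_le_one (le_max_left _ _)
  have hAθ : A ^ θ ≠ 0 := by simp [ENNReal.rpow_eq_zero_iff, hA0, hA]
  have hAθt : A ^ θ ≠ ⊤ := ENNReal.rpow_ne_top_of_nonneg hθ0 hA
  have hJt : J ≠ ⊤ := by
    have : J ≤ ENNReal.ofReal ((∫ t in Ioo (a-ℓ) (a+2*ℓ), f t) / ε) ^ p * ∫⁻ x in Ioo (a-ℓ) (a+2*ℓ), u x := by
      rw [← lintegral_const_mul _ hu]
      refine (lintegral_mono_set (t := Ioo (a-ℓ) (a+2*ℓ)) ?_).trans ?_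
      · intro x hx; exact ⟨by linarith [hx.1], by linarith [hx.2]⟩
      · apply lintegral_mono
        intro x
        refine mul_le_mul' (ENNReal.rpow_le_rpow ?_ hp0.le) le_rfl
        rw [← ofReal_norm]
        exact ENNReal.ofReal_le_ofReal (TT_le hf h0 hε measurableSet_Ioo x)
    refine ne_top_of_le_ne_top (ENNReal.mul_ne_top (ENNReal.rpow_ne_top_of_nonneg hp0.le ENNReal.ofReal_ne_top) ?_) this
    exact (ApB_fin hp hu hu0 hut hA hAp (by linarith)).1
  have key := absorb hp (κ := 19072 * ((c + 1) * A ^ θ)) (C := C3) (J := J) (Z := Z) ?_ ?_ ?_ hC3t hJt ?_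
  · refine key.trans (le_of_eq ?_)
    congr 2; ring
  · simp [hAθ]
  · exact ENNReal.mul_ne_top (by simp) (ENNReal.mul_ne_top (by simp [hc]) hAθt)
  · rw [hC3]; exact le_add_self
  intro s hs0 hst
  set g : ℝ → ℝ≥0∞ := (Ico a (a+ℓ)).indicator (fun x => s * ‖T x‖ₑ ^ (p-1)) with hg
  have hgm : Measurable g := by
    apply Measurable.indicator _ measurableSet_Ico
    exact (hTc.enorm.measurable.pow_const _).const_mul _
  have hKH := HK u hu hu0 hut A hA hAp f hf hfm h0 g hgm
  obtain ⟨N, hN⟩ := pow_unbounded_of_one_lt (ℓ / ε) (one_lt_two : (1:ℝ) < 2)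
  rw [div_lt_iff₀ hε] at hN
  have hout := outer_ind hf hfm h0 hε _ _ hKH N a ℓ hℓ hN.le
  have hhm : Measurable (fun x => ENNReal.ofReal (f x) / dw p u x) := hfm.ennreal_ofReal.div (dw_meas hu)
  have eL : ∫⁻ x in Ico a (a+ℓ), ‖T x‖ₑ ∂(volume.withDensity (fun x => g x * u x)) = s * J := by
    rw [restrict_withDensity measurableSet_Ico,
      lintegral_withDensity_eq_lintegral_mul _ (f := fun x => g x * u x) (hgm.mul hu) hTc.enorm.measurable,
      ← lintegral_const_mul' _ _ hst]
    apply setLIntegral_congr_fun measurableSet_Ico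
    intro x hx
    simp only [Pi.mul_apply, hg, indicator_of_mem hx]
    have : ‖T x‖ₑ ^ p = ‖T x‖ₑ ^ (p-1) * ‖T x‖ₑ := by
      nth_rewrite 3 [← ENNReal.rpow_one ‖T x‖ₑ]
      rw [← ENNReal.rpow_add_of_nonneg _ _ hp1.le zero_le_one, sub_add_cancel]
    rw [this]; ring
  rw [eL] at hout
  refine hout.trans ?_
  rw [Measure.smul_apply, smul_eq_mul, ← mul_assoc]
  refine mul_le_mul' ?_ ?_
  · refine mul_le_mul' le_rfl (mul_le_mul' le_self_add le_rfl)
  refine (measure_mono (subset_univ _)).trans ?_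
  unfold nuM
  rw [Measure.add_apply, withDensity_apply _ MeasurableSet.univ, withDensity_apply _ MeasurableSet.univ]
  simp only [Measure.restrict_univ]
  have i1 := H1 (volume.withDensity (dw p u)) _ hhm
  have i2 := H2 (volume.withDensity u) _ hgm
  have j1 : ∫⁻ x, (ENNReal.ofReal (f x) / dw p u x) ^ p ∂(volume.withDensity (dw p u)) = Z := by
    rw [lintegral_withDensity_eq_lintegral_mul _ (dw_meas hu) (hhm.pow_const _)]
    apply lintegral_congr
    intro x
    simp only [Pi.mul_apply]
    rw [ENNReal.div_rpow_of_nonneg _ _ hp0.le, div_eq_mul_inv, mul_comm, mul_assoc]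
    congr 1
    unfold dw
    rw [← ENNReal.rpow_mul, ← ENNReal.rpow_neg, ← ENNReal.rpow_add _ _ (hu0 x) (hut x)]
    nth_rewrite 2 [← ENNReal.rpow_one (u x)]
    congr 1; field_simp; ring
  have j2 : ∫⁻ x, g x ^ (p/(p-1)) ∂(volume.withDensity u) = s ^ (p/(p-1)) * J := by
    rw [lintegral_withDensity_eq_lintegral_mul _ hu (hgm.pow_const _), hJ,
      ← lintegral_const_mul' _ _ (ENNReal.rpow_ne_top_of_nonneg (by linarith) hst),
      ← lintegral_indicator measurableSet_Ico]
    apply lintegral_congr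
    intro x
    simp only [Pi.mul_apply, hg]
    by_cases hx : x ∈ Ico a (a+ℓ)
    · simp only [indicator_of_mem hx]
      rw [ENNReal.mul_rpow_of_nonneg _ _ (by linarith), ← ENNReal.rpow_mul, mul_div_cancel₀ _ hp1.ne']
      ring
    · simp only [indicator_of_notMem hx]
      rw [ENNReal.zero_rpow_of_pos (by linarith), mul_zero]
  rw [j1] at i1
  rw [j2] at i2
  refine add_le_add (i1.trans (mul_le_mul' ?_ le_rfl)) (i2.trans (mul_le_mul' ?_ le_rfl))
  · rw [hC3, add_assoc]; exact le_self_add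
  · rw [hC3, add_right_comm]; exact le_add_self

def hker (ε s : ℝ) : ℝ := if ε < |s| then 1 / s else 0

lemma hker_meas (ε : ℝ) : Measurable (hker ε) := by
  unfold hker
  exact Measurable.ite (measurableSet_lt measurable_const measurable_norm) (by fun_prop) measurable_const

lemma hker_bd {ε : ℝ} (hε : 0 < ε) (s : ℝ) : |hker ε s| ≤ 1/ε := by
  unfold hker
  split_ifs with h
  · rw [abs_div, abs_one]; gcongr
  · simp; positivity

lemma hker_cmp {ε : ℝ} (hε : 0 < ε) (s : ℝ) : |hker ε s - s / (s^2+ε^2)| ≤ ε / (s^2+ε^2) := by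
  have hd : 0 < s^2 + ε^2 := by positivity
  unfold hker
  split_ifs with h
  · have hs : s ≠ 0 := by rintro rfl; simp at h; linarith
    have e : 1/s - s/(s^2+ε^2) = ε^2 / s / (s^2+ε^2) := by field_simp; ring
    rw [e, abs_div, abs_of_pos hd]
    gcongr
    rw [abs_div, abs_of_pos (by positivity : 0 < ε^2), div_le_iff₀ (by positivity)]
    nlinarith
  · push Not at h
    rw [zero_sub, abs_neg, abs_div, abs_of_pos hd]
    gcongr

def HE (f : ℝ → ℝ) (ε x : ℝ) : ℝ := ∫ t, hker ε (x - t) * f t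

lemma hker_int {f : ℝ → ℝ} (hf : Integrable f) {ε : ℝ} (hε : 0 < ε) (x : ℝ) :
    Integrable (fun t => hker ε (x - t) * f t) :=
  hf.bdd_mul ((hker_meas ε).comp (measurable_const.sub measurable_id)).aestronglyMeasurable
    (c := 1/ε) (Eventually.of_forall fun t => hker_bd hε _)

lemma TT_univ (f : ℝ → ℝ) (ε x : ℝ) : TT f ε univ x = ∫ t : ℝ, (f t : ℂ) / ((x:ℂ) + ε * Complex.I - t) := by
  unfold TT cauF; simp

lemma TT_re {f : ℝ → ℝ} (hf : Integrable f) {ε : ℝ} (hε : 0 < ε) (x : ℝ) :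
    (TT f ε univ x).re = ∫ t, (x - t) / ((x-t)^2+ε^2) * f t := by
  rw [TT_univ]
  have := integral_re (cau_int hf ((x:ℂ) + ε * Complex.I) (by rw [TT_im]; exact hε))
  simp only [RCLike.re_to_complex] at this
  rw [← this]
  congr 1; ext t
  rw [Complex.div_re]
  simp [Complex.normSq_apply]
  ring

lemma TT_imm {f : ℝ → ℝ} (hf : Integrable f) {ε : ℝ} (hε : 0 < ε) (x : ℝ) :
    (TT f ε univ x).im = - ∫ t, ε / ((x-t)^2+ε^2) * f t := by
  rw [TT_univ]
  have := integral_im (cau_int hf ((x:ℂ) + ε * Complex.I) (by rw [TT_im]; exact hε))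
  simp only [RCLike.im_to_complex] at this
  rw [← this, ← integral_neg]
  congr 1; ext t
  rw [Complex.div_im]
  simp [Complex.normSq_apply]
  ring

lemma ker_int1 {f : ℝ → ℝ} (hf : Integrable f) {ε : ℝ} (hε : 0 < ε) (x : ℝ) :
    Integrable (fun t => (x - t) / ((x-t)^2+ε^2) * f t) := by
  refine hf.bdd_mul (c := 1/ε) ?_ (Eventually.of_forall fun t => ?_)
  · apply Measurable.aestronglyMeasurable; fun_prop
  · have hd : 0 < (x-t)^2 + ε^2 := by positivity
    rw [Real.norm_eq_abs, abs_div, abs_of_pos hd, div_le_div_iff₀ hd hε]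
    rw [← sq_abs (x-t)]
    nlinarith [sq_nonneg (|x-t| - ε), abs_nonneg (x-t)]

lemma ker_int2 {f : ℝ → ℝ} (hf : Integrable f) {ε : ℝ} (hε : 0 < ε) (x : ℝ) :
    Integrable (fun t => ε / ((x-t)^2+ε^2) * f t) := by
  refine hf.bdd_mul (c := 1/ε) ?_ (Eventually.of_forall fun t => ?_)
  · apply Measurable.aestronglyMeasurable; fun_prop
  · have hd : 0 < (x-t)^2 + ε^2 := by positivity
    rw [Real.norm_eq_abs, abs_div, abs_of_pos hd, abs_of_pos hε, div_le_div_iff₀ hd hε]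
    nlinarith [sq_nonneg (x-t)]

lemma HE_le {f : ℝ → ℝ} (hf : Integrable f) {ε : ℝ} (hε : 0 < ε) (x : ℝ) :
    |HE f ε x| ≤ ‖TT (fun t => max (f t) 0) ε univ x‖ + ‖TT (fun t => max (-f t) 0) ε univ x‖
      + ‖TT (fun t => |f t|) ε univ x‖ := by
  have h1 : HE f ε x = (∫ t, (x - t) / ((x-t)^2+ε^2) * f t) +
      ∫ t, (hker ε (x-t) - (x - t) / ((x-t)^2+ε^2)) * f t := by
    unfold HE
    rw [← integral_add (ker_int1 hf hε x)]
    · congr 1; ext t; ring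
    · simp_rw [sub_mul]
      exact (hker_int hf hε x).sub (ker_int1 hf hε x)
  have h2 : |∫ t, (hker ε (x-t) - (x - t) / ((x-t)^2+ε^2)) * f t| ≤ ‖TT (fun t => |f t|) ε univ x‖ := by
    calc _ ≤ ∫ t, ε / ((x-t)^2+ε^2) * |f t| := by
          rw [← Real.norm_eq_abs]
          refine norm_integral_le_of_norm_le (ker_int2 hf.abs hε x) (Eventually.of_forall fun t => ?_)
          rw [norm_mul, Real.norm_eq_abs, Real.norm_eq_abs]
          exact mul_le_mul_of_nonneg_right (hker_cmp hε _) (abs_nonneg _)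
      _ ≤ |(TT (fun t => |f t|) ε univ x).im| := by
          rw [TT_imm hf.abs hε x, abs_neg]; exact le_abs_self _
      _ ≤ _ := Complex.abs_im_le_norm _
  have h3 : |∫ t, (x - t) / ((x-t)^2+ε^2) * f t| ≤
      ‖TT (fun t => max (f t) 0) ε univ x‖ + ‖TT (fun t => max (-f t) 0) ε univ x‖ := by
    have e : ∫ t, (x - t) / ((x-t)^2+ε^2) * f t = (TT (fun t => max (f t) 0) ε univ x).re
        - (TT (fun t => max (-f t) 0) ε univ x).re := by
      rw [TT_re hf.pos_part hε x, TT_re hf.neg_part hε x,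
        ← integral_sub (ker_int1 hf.pos_part hε x) (ker_int1 hf.neg_part hε x)]
      congr 1; ext t
      rw [← mul_sub]
      congr 1
      rcases le_total (f t) 0 with h | h <;> simp [h]
    rw [e]
    refine (abs_sub _ _).trans (add_le_add (Complex.abs_re_le_norm _) (Complex.abs_re_le_norm _))
  rw [h1]
  exact (abs_add_le _ _).trans (add_le_add h3 h2)

lemma oneD_pos {p : ℝ} (hp : 1 < p) : ∃ C : ℝ≥0∞, C ≠ ⊤ ∧ ∀ (u : ℝ → ℝ≥0∞), Measurable u → (∀ x, u x ≠ 0) →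
    (∀ x, u x ≠ ⊤) → ∀ A : ℝ≥0∞, A ≠ ⊤ → ApB p u A → ∀ (f : ℝ → ℝ), Integrable f → Measurable f →
    (∀ t, 0 ≤ f t) → ∀ R : ℝ, (∀ t, f t ≠ 0 → |t| ≤ R) → ∀ ε, 0 < ε →
      ∫⁻ x, ‖TT f ε univ x‖ₑ ^ p * u x
        ≤ (C * A ^ (max 1 ((p / (p - 1)) / p))) ^ p * ∫⁻ x, ENNReal.ofReal (f x) ^ p * u x := by
  obtain ⟨C, hC, H⟩ := oneD_loc hp
  refine ⟨C, hC, ?_⟩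
  intro u hu hu0 hut A hA hAp f hf hfm h0 R hR ε hε
  have hcov : AECover (volume : Measure ℝ) atTop (fun k : ℕ => Ico (-(k:ℝ)) (k:ℝ)) :=
    aecover_Ico (tendsto_neg_atTop_atBot.comp tendsto_natCast_atTop_atTop) tendsto_natCast_atTop_atTop
  have hTc : Continuous (TT f ε univ) := TT_cont hf hε MeasurableSet.univ
  have ht := hcov.lintegral_tendsto_of_countably_generated
    (f := fun x => ‖TT f ε univ x‖ₑ ^ p * u x) ((hTc.enorm.measurable.pow_const _).mul hu).aemeasurable
  refine le_of_tendsto ht ?_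
  obtain ⟨k0, hk0⟩ := exists_nat_gt (max R 0)
  filter_upwards [eventually_ge_atTop k0] with k hk
  have hk1 : max R 0 < (k:ℝ) := lt_of_lt_of_le hk0 (by exact_mod_cast hk)
  have hk2 : 0 < (k:ℝ) := lt_of_le_of_lt (le_max_right _ _) hk1
  have := H u hu hu0 hut A hA hAp f hf hfm h0 ε hε (-k) (2*k) (by linarith)
  have e : TT f ε (Ioo (-(k:ℝ) - 2*k) (-k+2*(2*k))) = TT f ε univ := by
    ext x
    unfold TT
    refine congrArg (fun F => cauF F _) ?_
    ext t
    by_cases ht : f t = 0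
    · simp [indicator, ht]
    · have := hR t ht
      have h3 := le_max_left R 0
      rw [abs_le] at this
      rw [indicator_of_mem (mem_univ _), indicator_of_mem]
      exact ⟨by linarith, by linarith⟩
  have e' : -(k:ℝ) + 2*k = k := by ring
  rw [e, e'] at this
  exact this

lemma oneD_sgn {p : ℝ} (hp : 1 < p) : ∃ C : ℝ≥0∞, C ≠ ⊤ ∧ ∀ (u : ℝ → ℝ≥0∞), Measurable u → (∀ x, u x ≠ 0) →
    (∀ x, u x ≠ ⊤) → ∀ A : ℝ≥0∞, A ≠ ⊤ → ApB p u A → ∀ (f : ℝ → ℝ), Integrable f → Measurable f →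
    ∀ R : ℝ, (∀ t, f t ≠ 0 → |t| ≤ R) → ∀ ε, 0 < ε →
      ∫⁻ x, ENNReal.ofReal |HE f ε x| ^ p * u x
        ≤ (C * A ^ (max 1 ((p / (p - 1)) / p))) ^ p * ∫⁻ x, ENNReal.ofReal |f x| ^ p * u x := by
  have hp0 : 0 < p := by linarith
  obtain ⟨C, hC, H⟩ := oneD_pos hp
  refine ⟨9 * C, ENNReal.mul_ne_top (by simp) hC, ?_⟩
  intro u hu hu0 hut A hA hAp f hf hfm R hR ε hε
  have k1 := H u hu hu0 hut A hA hAp (fun t => max (f t) 0) hf.pos_part (hfm.max measurable_const)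
    (fun t => le_max_right _ _) R (fun t ht => hR t (by intro h; simp [h] at ht)) ε hε
  have k2 := H u hu hu0 hut A hA hAp (fun t => max (-f t) 0) hf.neg_part (hfm.neg.max measurable_const)
    (fun t => le_max_right _ _) R (fun t ht => hR t (by intro h; simp [h] at ht)) ε hε
  have k3 := H u hu hu0 hut A hA hAp (fun t => |f t|) hf.abs (hfm.abs)
    (fun t => abs_nonneg _) R (fun t ht => hR t (by intro h; simp [h] at ht)) ε hε
  set K := (C * A ^ (max 1 ((p / (p - 1)) / p))) ^ p
  set Z := ∫⁻ x, ENNReal.ofReal |f x| ^ p * u x with hZ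
  have z1 : ∫⁻ x, ENNReal.ofReal (max (f x) 0) ^ p * u x ≤ Z := by
    apply lintegral_mono; intro x
    refine mul_le_mul' (ENNReal.rpow_le_rpow (ENNReal.ofReal_le_ofReal ?_) hp0.le) le_rfl
    exact max_le (le_abs_self _) (abs_nonneg _)
  have z2 : ∫⁻ x, ENNReal.ofReal (max (-f x) 0) ^ p * u x ≤ Z := by
    apply lintegral_mono; intro x
    refine mul_le_mul' (ENNReal.rpow_le_rpow (ENNReal.ofReal_le_ofReal ?_) hp0.le) le_rfl
    exact max_le (neg_le_abs _) (abs_nonneg _)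
  have m : ∀ g : ℝ → ℝ, Integrable g → Measurable (fun x => ‖TT g ε univ x‖ₑ ^ p * u x) := fun g hg =>
    ((TT_cont hg hε MeasurableSet.univ).enorm.measurable.pow_const _).mul hu
  have hpt : ∀ a b c : ℝ≥0∞, (a + b + c) ^ p ≤ 3 ^ p * (a ^ p + b ^ p + c ^ p) := by
    intro a b c
    have h1 : a + b + c ≤ 3 * max (max a b) c := by
      have ha : a ≤ max (max a b) c := (le_max_left _ _).trans (le_max_left _ _)
      have hb : b ≤ max (max a b) c := (le_max_right _ _).trans (le_max_left _ _)
      have hc : c ≤ max (max a b) c := (le_max_right _ _)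
      calc a + b + c ≤ max (max a b) c + max (max a b) c + max (max a b) c := by gcongr
        _ = _ := by ring
    refine (ENNReal.rpow_le_rpow h1 hp0.le).trans ?_
    rw [ENNReal.mul_rpow_of_nonneg _ _ hp0.le]
    refine mul_le_mul' le_rfl ?_
    rcases max_choice (max a b) c with h | h
    · rw [h]
      rcases max_choice a b with h | h
      · rw [h, add_assoc]; exact le_self_add
      · rw [h, add_right_comm]; exact le_add_self
    · rw [h]; exact le_add_self
  calc _ ≤ ∫⁻ x, 3 ^ p * (‖TT (fun t => max (f t) 0) ε univ x‖ₑ ^ p * u x +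
        ‖TT (fun t => max (-f t) 0) ε univ x‖ₑ ^ p * u x + ‖TT (fun t => |f t|) ε univ x‖ₑ ^ p * u x) := by
        apply lintegral_mono; intro x
        dsimp only
        rw [← add_mul, ← add_mul, ← mul_assoc]
        refine mul_le_mul' (le_trans (ENNReal.rpow_le_rpow ?_ hp0.le) (hpt _ _ _)) le_rfl
        rw [← ofReal_norm, ← ofReal_norm, ← ofReal_norm, ← ENNReal.ofReal_add (by positivity) (by positivity),
          ← ENNReal.ofReal_add (by positivity) (by positivity)]
        exact ENNReal.ofReal_le_ofReal (HE_le hf hε x)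
    _ ≤ 3 ^ p * (K * Z + K * Z + K * Z) := by
        rw [lintegral_const_mul' _ _ (ENNReal.rpow_ne_top_of_nonneg hp0.le (by simp))]
        refine mul_le_mul' le_rfl ?_
        rw [lintegral_add_right _ (m _ hf.abs), lintegral_add_right _ (m _ hf.neg_part)]
        refine add_le_add (add_le_add ?_ ?_) k3
        · exact k1.trans (mul_le_mul' le_rfl z1)
        · exact k2.trans (mul_le_mul' le_rfl z2)
    _ = (3 ^ p * 3) * (K * Z) := by ring
    _ ≤ 9 ^ p * (K * Z) := by
        refine mul_le_mul' ?_ le_rfl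
        have : (9:ℝ≥0∞) = 3 * 3 := by norm_num
        rw [this, ENNReal.mul_rpow_of_nonneg _ _ hp0.le]
        refine mul_le_mul' le_rfl ?_
        nth_rewrite 1 [← ENNReal.rpow_one 3]
        exact ENNReal.rpow_le_rpow_of_exponent_le (by norm_num) hp.le
    _ = _ := by
        rw [← mul_assoc, ← ENNReal.mul_rpow_of_nonneg _ _ hp0.le, mul_assoc 9]

lemma apChar_le_E {p : ℝ} {u : ℝ → ℝ} {A : ℝ≥0∞} (h : apChar p u ≤ A) {a b : ℝ} (hab : a < b) :
    avgIoc u a b * avgIoc (fun t => u t ^ (1 - p / (p - 1))) a b ^ (p - 1) ≤ A := by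
  unfold apChar at h
  simp only [iSup_le_iff] at h
  exact h a b hab

lemma oneD {p : ℝ} (hp : 1 < p) : ∃ C : ℝ≥0∞, C ≠ ⊤ ∧ ∀ (u : ℝ → ℝ), AEMeasurable u → (∀ᵐ x, 0 < u x) →
    ∀ A : ℝ≥0∞, A ≠ ⊤ → apChar p u ≤ A → ∀ (f : ℝ → ℝ), Integrable f → Measurable f →
    ∀ R : ℝ, (∀ t, f t ≠ 0 → |t| ≤ R) → ∀ ε, 0 < ε →
      ∫⁻ x, ENNReal.ofReal |HE f ε x| ^ p * ENNReal.ofReal (u x)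
        ≤ (C * A ^ (max 1 ((p / (p - 1)) / p))) ^ p * ∫⁻ x, ENNReal.ofReal |f x| ^ p * ENNReal.ofReal (u x) := by
  have hp0 : 0 < p := by linarith
  have hp1 : 0 < p - 1 := by linarith
  obtain ⟨C, hC, H⟩ := oneD_sgn hp
  refine ⟨C, hC, ?_⟩
  intro u hu hu0 A hA hAp f hf hfm R hR ε hε
  set v : ℝ → ℝ := fun x => if 0 < hu.mk u x then hu.mk u x else 1 with hv
  have hvm : Measurable v := Measurable.ite (measurableSet_lt measurable_const hu.measurable_mk) hu.measurable_mk measurable_const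
  have hv0 : ∀ x, 0 < v x := by
    intro x; simp only [hv]; split_ifs with h
    · exact h
    · exact one_pos
  have huv : u =ᵐ[volume] v := by
    filter_upwards [hu.ae_eq_mk, hu0] with x h1 h2
    simp only [hv]; rw [← h1]; simp [h2]
  have := H (fun x => ENNReal.ofReal (v x)) hvm.ennreal_ofReal (fun x => by simpa using hv0 x)
    (fun x => ENNReal.ofReal_ne_top) A hA ?_ f hf hfm R hR ε hε
  · have e : ∀ g : ℝ → ℝ≥0∞, ∫⁻ x, g x * ENNReal.ofReal (u x) = ∫⁻ x, g x * ENNReal.ofReal (v x) := by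
      intro g
      apply lintegral_congr_ae
      filter_upwards [huv] with x hx
      rw [hx]
    rw [e, e]; exact this
  · intro a b hab
    have h1 : avgIoc u a b * avgIoc (fun t => u t ^ (1 - p / (p - 1))) a b ^ (p - 1) ≤ A :=
      apChar_le_E hAp hab
    unfold avgIoc lintIoc at h1
    have e1 : ∫⁻ t in Ioc a b, ENNReal.ofReal (u t) = ∫⁻ t in Ioo a b, ENNReal.ofReal (v t) := by
      rw [restrict_Ioo_eq_restrict_Ioc]
      apply lintegral_congr_ae
      filter_upwards [ae_restrict_of_ae huv] with x hx
      rw [hx]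
    have e2 : ∫⁻ t in Ioc a b, ENNReal.ofReal (u t ^ (1 - p / (p - 1))) =
        ∫⁻ t in Ioo a b, dw p (fun x => ENNReal.ofReal (v x)) t := by
      rw [restrict_Ioo_eq_restrict_Ioc]
      apply lintegral_congr_ae
      filter_upwards [ae_restrict_of_ae huv] with x hx
      unfold dw
      rw [hx, ENNReal.ofReal_rpow_of_pos (hv0 x)]
    rw [e1, e2] at h1
    set X := ∫⁻ t in Ioo a b, ENNReal.ofReal (v t)
    set Y := ∫⁻ t in Ioo a b, dw p (fun x => ENNReal.ofReal (v x)) t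
    set L := ENNReal.ofReal (b - a) with hL
    have hL0 : L ≠ 0 := by simp [hL, hab]
    have hLt : L ≠ ⊤ := ENNReal.ofReal_ne_top
    rw [ENNReal.mul_rpow_of_nonneg _ _ hp1.le] at h1
    have e3 : L⁻¹ * X * (L⁻¹ ^ (p-1) * Y ^ (p-1)) * L ^ p = X * Y ^ (p-1) := by
      have : L⁻¹ * L⁻¹ ^ (p-1) * L ^ p = 1 := by
        rw [← ENNReal.rpow_neg_one, ← ENNReal.rpow_mul, ← ENNReal.rpow_add _ _ hL0 hLt,
          ← ENNReal.rpow_add _ _ hL0 hLt]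
        ring_nf; simp
      calc _ = (L⁻¹ * L⁻¹ ^ (p-1) * L ^ p) * (X * Y ^ (p-1)) := by ring
        _ = _ := by rw [this, one_mul]
    rw [← e3]
    exact mul_le_mul' h1 le_rfl

def consN (n : ℕ) (z : ℝ × (Fin n → ℝ)) : Fin (n+1) → ℝ := Fin.cons z.1 z.2

lemma consN_eq (n : ℕ) : consN n = (MeasurableEquiv.piFinSuccAbove (fun _ : Fin (n+1) => ℝ) 0).symm := by
  ext z i
  simp only [consN, MeasurableEquiv.piFinSuccAbove_symm_apply]
  rw [Fin.insertNthEquiv_zero]; rfl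

lemma consN_mp (n : ℕ) : MeasurePreserving (consN n) (volume.prod volume) volume := by
  rw [consN_eq]
  exact (volume_preserving_piFinSuccAbove (fun _ : Fin (n+1) => ℝ) 0).symm

lemma consN_emb (n : ℕ) : MeasurableEmbedding (consN n) := by
  rw [consN_eq]; exact MeasurableEquiv.measurableEmbedding _

lemma consN_lint (n : ℕ) (F : (Fin (n+1) → ℝ) → ℝ≥0∞) :
    ∫⁻ x, F x = ∫⁻ z, F (consN n z) ∂(volume.prod volume) :=
  ((consN_mp n).lintegral_comp_emb (consN_emb n) F).symm

lemma consN_int (n : ℕ) (F : (Fin (n+1) → ℝ) → ℝ) :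
    ∫ x, F x = ∫ z, F (consN n z) ∂(volume.prod volume) :=
  ((consN_mp n).integral_comp (consN_emb n) F).symm

lemma consN_ae (n : ℕ) {P : (Fin (n+1) → ℝ) → Prop} (h : ∀ᵐ x, P x) :
    ∀ᵐ z ∂((volume : Measure ℝ).prod (volume : Measure (Fin n → ℝ))), P (consN n z) :=
  (consN_mp n).quasiMeasurePreserving.ae h

lemma consN_ae1 (n : ℕ) {P : (Fin (n+1) → ℝ) → Prop} (h : ∀ᵐ x, P x) :
    ∀ᵐ a : ℝ, ∀ᵐ b : Fin n → ℝ, P (consN n (a, b)) :=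
  Measure.ae_ae_of_ae_prod (consN_ae n h)

lemma consN_ae2 (n : ℕ) {P : (Fin (n+1) → ℝ) → Prop} (h : ∀ᵐ x, P x) :
    ∀ᵐ b : Fin n → ℝ, ∀ᵐ a : ℝ, P (consN n (a, b)) := by
  have := (Measure.measurePreserving_swap (μ := (volume : Measure (Fin n → ℝ))) (ν := (volume : Measure ℝ))).quasiMeasurePreserving.ae (consN_ae n h)
  exact Measure.ae_ae_of_ae_prod this

lemma aem_slices {α β : Type*} [MeasurableSpace α] [MeasurableSpace β] {μ : Measure α} {ν : Measure β}
    [SFinite μ] [SFinite ν] {W : α × β → ℝ} (h : AEMeasurable W (μ.prod ν)) :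
    ∀ᵐ a ∂μ, AEMeasurable (fun b => W (a, b)) ν := by
  filter_upwards [Measure.ae_ae_of_ae_prod h.ae_eq_mk] with a ha
  exact ⟨fun b => h.mk W (a, b), h.measurable_mk.comp measurable_prodMk_left, ha⟩

lemma aem_slices2 {α β : Type*} [MeasurableSpace α] [MeasurableSpace β] {μ : Measure α} {ν : Measure β}
    [SFinite μ] [SFinite ν] {W : α × β → ℝ} (h : AEMeasurable W (μ.prod ν)) :
    ∀ᵐ b ∂ν, AEMeasurable (fun a => W (a, b)) μ := by
  have : AEMeasurable (fun z : β × α => W (z.2, z.1)) (ν.prod μ) :=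
    h.comp_quasiMeasurePreserving (Measure.measurePreserving_swap (μ := ν) (ν := μ)).quasiMeasurePreserving
  exact aem_slices this

/-- product kernel operator -/
def HN (n : ℕ) (f : (Fin n → ℝ) → ℝ) (ε : Fin n → ℝ) (x : Fin n → ℝ) : ℝ :=
  ∫ t, (∏ i, hker (ε i) (x i - t i)) * f t

lemma kerN_meas (n : ℕ) (ε : Fin n → ℝ) :
    Measurable (fun s : Fin n → ℝ => ∏ i, hker (ε i) (s i)) :=
  Finset.measurable_prod _ (fun i _ => (hker_meas (ε i)).comp (measurable_pi_apply i))

lemma kerN_bd (n : ℕ) (ε : Fin n → ℝ) (hε : ∀ i, 0 < ε i) (s : Fin n → ℝ) :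
    |∏ i, hker (ε i) (s i)| ≤ ∏ i, (1 / ε i) := by
  rw [Finset.abs_prod]
  exact Finset.prod_le_prod (fun i _ => abs_nonneg _) (fun i _ => hker_bd (hε i) (s i))

lemma bddN_int (n : ℕ) (f : (Fin n → ℝ) → ℝ) (hf : Measurable f) {M R : ℝ} (hM : ∀ t, |f t| ≤ M)
    (hR : ∀ t, f t ≠ 0 → ∀ i, |t i| ≤ R) : Integrable f := by
  have hs : f = indicator (Icc (fun _ => -R) (fun _ => R)) f := by
    ext t
    by_cases h : f t = 0
    · simp [indicator, h]
    · rw [indicator_of_mem]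
      exact ⟨fun i => (abs_le.1 (hR t h i)).1, fun i => (abs_le.1 (hR t h i)).2⟩
  rw [hs, integrable_indicator_iff measurableSet_Icc]
  exact Measure.integrableOn_of_bounded (M := M) (isCompact_Icc.measure_lt_top.ne) hf.aestronglyMeasurable
    (ae_of_all _ (fun t => by simpa using hM t))

lemma HN_meas (n : ℕ) {α : Type*} [MeasurableSpace α] (F : α × (Fin n → ℝ) → ℝ) (hF : Measurable F) (ε : Fin n → ℝ) :
    Measurable (fun z : α × (Fin n → ℝ) => HN n (fun t => F (z.1, t)) ε z.2) := by
  unfold HN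
  refine (StronglyMeasurable.integral_prod_right (ν := volume)
    (f := fun (z : α × (Fin n → ℝ)) (t : Fin n → ℝ) => (∏ i, hker (ε i) (z.2 i - t i)) * F (z.1, t)) ?_).measurable
  apply Measurable.stronglyMeasurable
  refine Measurable.mul ?_ (hF.comp (by fun_prop))
  exact (kerN_meas n ε).comp (f := fun y : (α × (Fin n → ℝ)) × (Fin n → ℝ) => fun i => y.1.2 i - y.2 i) (by fun_prop)

lemma HN_succ (n : ℕ) (f : (Fin (n+1) → ℝ) → ℝ) (hf : Measurable f) {M R : ℝ} (hM : ∀ t, |f t| ≤ M)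
    (hR : ∀ t, f t ≠ 0 → ∀ i, |t i| ≤ R) (ε : Fin (n+1) → ℝ) (hε : ∀ i, 0 < ε i) (z : ℝ × (Fin n → ℝ)) :
    HN (n+1) f ε (consN n z) =
      HE (fun t0 => HN n (fun t => f (consN n (t0, t))) (fun i => ε i.succ) z.2) (ε 0) z.1 := by
  unfold HN HE
  rw [consN_int]
  rw [integral_prod]
  · congr 1; ext t0
    rw [← integral_const_mul]
    congr 1; ext t
    rw [Fin.prod_univ_succ]
    simp only [consN, Fin.cons_zero, Fin.cons_succ]
    ring
  · refine Integrable.bdd_mul (c := ∏ i, (1 / ε i)) ?_ ?_ ?_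
    · exact ((consN_mp n).integrable_comp_emb (consN_emb n)).2 (bddN_int _ f hf hM hR)
    · apply Measurable.aestronglyMeasurable
      exact (kerN_meas (n+1) ε).comp (f := fun y : ℝ × (Fin n → ℝ) => fun i => consN n z i - consN n y i)
        (measurable_pi_lambda _ (fun i => measurable_const.sub ((measurable_pi_apply i).comp (consN_emb n).measurable)))
    · exact ae_of_all _ fun t => kerN_bd _ ε hε _

lemma HN_bd (n : ℕ) (f : (Fin n → ℝ) → ℝ) (hf : Measurable f) {M R : ℝ} (hM : ∀ t, |f t| ≤ M)
    (hR : ∀ t, f t ≠ 0 → ∀ i, |t i| ≤ R) (ε : Fin n → ℝ) (hε : ∀ i, 0 < ε i) (x : Fin n → ℝ) :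
    |HN n f ε x| ≤ (∏ i, (1 / ε i)) * (M * (volume (Icc (fun _ : Fin n => -R) (fun _ => R))).toReal) := by
  have hs : (fun t => (∏ i, hker (ε i) (x i - t i)) * f t) =
      indicator (Icc (fun _ => -R) (fun _ => R)) (fun t => (∏ i, hker (ε i) (x i - t i)) * f t) := by
    ext t
    by_cases h : f t = 0
    · simp [indicator, h]
    · rw [indicator_of_mem]
      exact ⟨fun i => (abs_le.1 (hR t h i)).1, fun i => (abs_le.1 (hR t h i)).2⟩
  unfold HN
  rw [hs, integral_indicator measurableSet_Icc]
  have := norm_setIntegral_le_of_norm_le_const (μ := volume) (s := Icc (fun _ : Fin n => -R) (fun _ => R))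
    (f := fun t => (∏ i, hker (ε i) (x i - t i)) * f t) (C := (∏ i, (1 / ε i)) * M)
    isCompact_Icc.measure_lt_top (fun t _ => by
      rw [norm_mul]
      exact mul_le_mul (kerN_bd _ ε hε _) (hM t) (abs_nonneg _) (Finset.prod_nonneg fun i _ => by have := hε i; positivity))
  rw [Real.norm_eq_abs] at this
  refine this.trans (le_of_eq ?_)
  rw [mul_assoc]; rfl

lemma HN_main {p : ℝ} (hp : 1 < p) : ∃ C : ℝ≥0∞, C ≠ ⊤ ∧ ∀ n : ℕ, ∀ w : (Fin n → ℝ) → ℝ, AEMeasurable w →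
    (∀ᵐ x, 0 < w x) → ∀ A : Fin n → ℝ≥0∞, (∀ i, A i ≠ ⊤) →
    (∀ i, ∀ᵐ x, apChar p (fun t => w (Function.update x i t)) ≤ A i) →
    ∀ f : (Fin n → ℝ) → ℝ, Measurable f → ∀ M R : ℝ, (∀ t, |f t| ≤ M) → (∀ t, f t ≠ 0 → ∀ i, |t i| ≤ R) →
    ∀ ε : Fin n → ℝ, (∀ i, 0 < ε i) →
    ∫⁻ x, ENNReal.ofReal |HN n f ε x| ^ p * ENNReal.ofReal (w x) ≤
      (∏ i, (C * A i ^ (max 1 ((p / (p - 1)) / p))) ^ p) * ∫⁻ x, ENNReal.ofReal |f x| ^ p * ENNReal.ofReal (w x) := by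
  obtain ⟨C, hC, H⟩ := oneD hp
  have hp0 : 0 < p := by linarith
  refine ⟨C, hC, ?_⟩
  intro n
  induction n with
  | zero =>
    intro w _ _ A _ _ f _ M R _ _ ε _
    simp only [Finset.univ_eq_empty, Finset.prod_empty, one_mul]
    refine lintegral_mono fun x => ?_
    have : HN 0 f ε x = f x := by
      unfold HN
      simp only [Finset.univ_eq_empty, Finset.prod_empty, one_mul]
      rw [integral_unique, Subsingleton.elim x default]
      simp only [Measure.real, volume_pi, Measure.pi_empty_univ, ENNReal.toReal_one, one_smul]
      exact congrArg f (Subsingleton.elim _ _)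
    rw [this]
  | succ n ih =>
    intro w hw hw0 A hA hAp f hf M R hM hR ε hε
    set θ := max 1 ((p / (p - 1)) / p)
    set ε' : Fin n → ℝ := fun i => ε i.succ
    set G : ℝ × (Fin n → ℝ) → ℝ := fun z => HN n (fun t => f (consN n (z.1, t))) ε' z.2 with hG
    have hfc : Measurable (fun z => f (consN n z)) := hf.comp (consN_emb n).measurable
    have hGm : Measurable G := HN_meas n (fun z => f (consN n z)) hfc ε'
    have hW : AEMeasurable (fun z => w (consN n z)) (volume.prod volume) :=
      hw.comp_quasiMeasurePreserving (consN_mp n).quasiMeasurePreserving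
    have hsup : ∀ t0 t, f (consN n (t0, t)) ≠ 0 → ∀ i, |t i| ≤ R := fun t0 t h i => by
      have := hR _ h i.succ
      simpa [consN] using this
    have hGb : ∀ z, |G z| ≤ (∏ i, (1 / ε' i)) * (M * (volume (Icc (fun _ : Fin n => -R) (fun _ => R))).toReal) := by
      intro z
      exact HN_bd n _ (hfc.comp measurable_prodMk_left) (fun t => hM _) (hsup z.1) ε' (fun i => hε _) z.2
    have hGs : ∀ t0 x, G (t0, x) ≠ 0 → |t0| ≤ R := by
      intro t0 x h
      by_contra h1
      apply h
      simp only [hG, HN]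
      have : ∀ t, f (consN n (t0, t)) = 0 := by
        intro t
        by_contra h2
        have := hR _ h2 0
        simp [consN] at this
        exact h1 this
      simp [this]
    have hGi : ∀ x, Integrable (fun t0 => G (t0, x)) := by
      intro x
      have hm : Measurable (fun t0 => G (t0, x)) := hGm.comp measurable_prodMk_right
      have hs : (fun t0 => G (t0, x)) = indicator (Icc (-R) R) (fun t0 => G (t0, x)) := by
        ext t
        by_cases h : G (t, x) = 0
        · simp [indicator, h]
        · rw [indicator_of_mem]
          exact abs_le.1 (hGs _ _ h)
      rw [hs, integrable_indicator_iff measurableSet_Icc]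
      exact Measure.integrableOn_of_bounded (isCompact_Icc.measure_lt_top.ne) hm.aestronglyMeasurable
        (ae_of_all _ (fun t => by simpa using hGb (t, x)))
    -- a.e. hypotheses
    have a1 : ∀ᵐ x' : Fin n → ℝ, apChar p (fun t => w (consN n (t, x'))) ≤ A 0 := by
      obtain ⟨x0, h⟩ := (consN_ae1 n (hAp 0)).exists
      filter_upwards [h] with x' hx
      have e : ∀ t, Function.update (consN n (x0, x')) 0 t = consN n (t, x') := by
        intro t; simp [consN]
      simpa only [e] using hx
    have a2 : ∀ᵐ t0 : ℝ, ∀ i : Fin n, ∀ᵐ x' : Fin n → ℝ,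
        apChar p (fun t => w (consN n (t0, Function.update x' i t))) ≤ A i.succ := by
      rw [ae_all_iff]; intro i
      filter_upwards [consN_ae1 n (hAp i.succ)] with t0 h
      filter_upwards [h] with x' hx
      have e : ∀ t, Function.update (consN n (t0, x')) i.succ t = consN n (t0, Function.update x' i t) := by
        intro t; simp [consN, Fin.cons_update]
      simpa only [e] using hx
    rw [consN_lint, consN_lint, Fin.prod_univ_succ]
    set K0 := (C * A 0 ^ θ) ^ p
    set K1 := ∏ i : Fin n, (C * A i.succ ^ θ) ^ p
    have hθ : 0 ≤ θ := le_trans zero_le_one (le_max_left _ _)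
    have hK0 : K0 ≠ ⊤ := ENNReal.rpow_ne_top_of_nonneg hp0.le (ENNReal.mul_ne_top hC (ENNReal.rpow_ne_top_of_nonneg hθ (hA 0)))
    have hK1 : K1 ≠ ⊤ := ENNReal.prod_ne_top fun i _ => ENNReal.rpow_ne_top_of_nonneg hp0.le (ENNReal.mul_ne_top hC (ENNReal.rpow_ne_top_of_nonneg hθ (hA _)))
    have mW : ∀ g : ℝ × (Fin n → ℝ) → ℝ, Measurable g →
      AEMeasurable (fun z => ENNReal.ofReal |g z| ^ p * ENNReal.ofReal (w (consN n z))) (volume.prod volume) := by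
      intro g hg
      exact ((hg.abs.ennreal_ofReal).pow_const _).aemeasurable.mul hW.ennreal_ofReal
    have mH : Measurable (fun z => HN (n+1) f ε (consN n z)) := by
      have := HN_meas (n+1) (α := Unit) (fun z => f z.2) (hf.comp measurable_snd) ε
      exact this.comp (f := fun z => ((), consN n z)) (measurable_const.prodMk (consN_emb n).measurable)
    calc ∫⁻ z, ENNReal.ofReal |HN (n+1) f ε (consN n z)| ^ p * ENNReal.ofReal (w (consN n z)) ∂(volume.prod volume)
        = ∫⁻ x', ∫⁻ x0, ENNReal.ofReal |HN (n+1) f ε (consN n (x0, x'))| ^ p * ENNReal.ofReal (w (consN n (x0, x'))) := by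
          rw [lintegral_prod_symm _ (mW _ mH)]
      _ ≤ ∫⁻ x', K0 * ∫⁻ x0, ENNReal.ofReal |G (x0, x')| ^ p * ENNReal.ofReal (w (consN n (x0, x'))) := by
          apply lintegral_mono_ae
          filter_upwards [a1, aem_slices2 hW, consN_ae2 n hw0] with x' h1 h2 h3
          have := H (fun t => w (consN n (t, x'))) h2 h3 (A 0) (hA 0) h1 (fun t => G (t, x')) (hGi x')
            (hGm.comp measurable_prodMk_right) R (fun t ht => hGs t x' ht) (ε 0) (hε 0)
          refine le_trans (le_of_eq ?_) this
          congr 1; ext x0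
          rw [HN_succ n f hf hM hR ε hε]
      _ = K0 * ∫⁻ z, ENNReal.ofReal |G z| ^ p * ENNReal.ofReal (w (consN n z)) ∂(volume.prod volume) := by
          rw [lintegral_const_mul' _ _ hK0, lintegral_prod_symm _ (mW _ hGm)]
      _ = K0 * ∫⁻ t0, ∫⁻ x', ENNReal.ofReal |G (t0, x')| ^ p * ENNReal.ofReal (w (consN n (t0, x'))) := by
          rw [lintegral_prod _ (mW _ hGm)]
      _ ≤ K0 * ∫⁻ t0, K1 * ∫⁻ x', ENNReal.ofReal |f (consN n (t0, x'))| ^ p * ENNReal.ofReal (w (consN n (t0, x'))) := by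
          refine mul_le_mul' le_rfl ?_
          apply lintegral_mono_ae
          filter_upwards [a2, aem_slices hW, consN_ae1 n hw0] with t0 h1 h2 h3
          exact ih (fun x' => w (consN n (t0, x'))) h2 h3 (fun i => A i.succ) (fun i => hA _) h1
            (fun t => f (consN n (t0, t))) (hfc.comp measurable_prodMk_left) M R (fun t => hM _) (hsup t0) ε' (fun i => hε _)
      _ = _ := by
          rw [lintegral_const_mul' _ _ hK1, lintegral_prod _ (mW _ hfc), mul_assoc]

lemma trunc_eq (n : ℕ) (f : (Fin n → ℝ) → ℝ) (ε x : Fin n → ℝ) : truncHilb n f ε x = HN n f ε x := by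
  have hms : MeasurableSet {t : Fin n → ℝ | ∀ i, ε i < |x i - t i|} := by
    simp only [ofPred_forall]
    exact MeasurableSet.iInter fun i => measurableSet_lt measurable_const (by fun_prop)
  unfold truncHilb HN
  rw [← integral_indicator hms]
  congr 1; ext t
  by_cases h : ∀ i, ε i < |x i - t i|
  · rw [indicator_of_mem (by exact h)]
    have : ∀ i, hker (ε i) (x i - t i) = (x i - t i)⁻¹ := fun i => by simp [hker, h i]
    simp only [this, Finset.prod_inv_distrib]
    rw [div_eq_inv_mul]
  · rw [indicator_of_notMem (by exact h)]
    push Not at h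
    obtain ⟨i, hi⟩ := h
    rw [Finset.prod_eq_zero (Finset.mem_univ i), zero_mul]
    simp [hker, hi]

lemma HN_meas' (n : ℕ) (f : (Fin n → ℝ) → ℝ) (hf : Measurable f) (ε : Fin n → ℝ) : Measurable (HN n f ε) := by
  have := HN_meas n (α := Unit) (fun z => f z.2) (hf.comp measurable_snd) ε
  exact this.comp (f := fun z => ((), z)) (measurable_const.prodMk measurable_id)

lemma HN_gen {p : ℝ} (hp : 1 < p) {n : ℕ} (w : (Fin n → ℝ) → ℝ) (hw : AEMeasurable w) (K : ℝ≥0∞)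
    (H : ∀ f : (Fin n → ℝ) → ℝ, Measurable f → ∀ M R : ℝ, (∀ t, |f t| ≤ M) → (∀ t, f t ≠ 0 → ∀ i, |t i| ≤ R) →
      ∀ ε : Fin n → ℝ, (∀ i, 0 < ε i) →
      ∫⁻ x, ENNReal.ofReal |HN n f ε x| ^ p * ENNReal.ofReal (w x) ≤
        K * ∫⁻ x, ENNReal.ofReal |f x| ^ p * ENNReal.ofReal (w x))
    (f : (Fin n → ℝ) → ℝ) (hf : Measurable f) (ε : Fin n → ℝ) (hε : ∀ i, 0 < ε i) :
      ∫⁻ x, ENNReal.ofReal |HN n f ε x| ^ p * ENNReal.ofReal (w x) ≤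
        K * ∫⁻ x, ENNReal.ofReal |f x| ^ p * ENNReal.ofReal (w x) := by
  have hp0 : 0 < p := by linarith
  set S : ℕ → Set (Fin n → ℝ) := fun k => {t | |f t| ≤ k ∧ ∀ i, |t i| ≤ k} with hS
  have hSm : ∀ k, MeasurableSet (S k) := by
    intro k
    refine (measurableSet_le hf.abs measurable_const).inter (s₂ := {t | ∀ i, |t i| ≤ (k:ℝ)}) ?_
    rw [show {t : Fin n → ℝ | ∀ i, |t i| ≤ (k:ℝ)} = ⋂ i, {t : Fin n → ℝ | |t i| ≤ (k:ℝ)} from by ext; simp]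
    exact MeasurableSet.iInter fun i => measurableSet_le (by fun_prop) measurable_const
  have hSe : ∀ t, ∀ᶠ k in atTop, t ∈ S k := by
    intro t
    have h1 : ∀ᶠ k : ℕ in atTop, |f t| ≤ k := tendsto_natCast_atTop_atTop.eventually_ge_atTop _
    have h2 : ∀ᶠ k : ℕ in atTop, ∀ i, |t i| ≤ k := by
      rw [eventually_all]; intro i
      exact tendsto_natCast_atTop_atTop.eventually_ge_atTop _
    exact h1.and h2
  set F : ℕ → (Fin n → ℝ) → ℝ := fun k => indicator (S k) f with hF
  have hFm : ∀ k, Measurable (F k) := fun k => hf.indicator (hSm k)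
  have hb : ∀ k, ∫⁻ x, ENNReal.ofReal |HN n (F k) ε x| ^ p * ENNReal.ofReal (w x) ≤
        K * ∫⁻ x, ENNReal.ofReal |f x| ^ p * ENNReal.ofReal (w x) := by
    intro k
    refine (H (F k) (hFm k) k k ?_ ?_ ε hε).trans (mul_le_mul' le_rfl (lintegral_mono fun x => ?_))
    · intro t
      by_cases h : t ∈ S k
      · simp only [hF]; rw [indicator_of_mem h]; exact h.1
      · simp only [hF]; rw [indicator_of_notMem h]; simp
    · intro t ht
      exact (mem_of_indicator_ne_zero ht).2
    · refine mul_le_mul' (ENNReal.rpow_le_rpow (ENNReal.ofReal_le_ofReal ?_) hp0.le) le_rfl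
      simp only [hF, indicator]
      split_ifs <;> simp
  have hpt : ∀ x, ENNReal.ofReal |HN n f ε x| ^ p * ENNReal.ofReal (w x) ≤
      liminf (fun k => ENNReal.ofReal |HN n (F k) ε x| ^ p * ENNReal.ofReal (w x)) atTop := by
    intro x
    by_cases hi : Integrable (fun t => (∏ i, hker (ε i) (x i - t i)) * f t)
    · have ht : Tendsto (fun k => HN n (F k) ε x) atTop (nhds (HN n f ε x)) := by
        unfold HN
        refine tendsto_integral_of_dominated_convergence (fun t => ‖(∏ i, hker (ε i) (x i - t i)) * f t‖) ?_ hi.norm ?_ ?_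
        · intro k
          refine (Measurable.mul ?_ (hFm k)).aestronglyMeasurable
          exact (kerN_meas n ε).comp (f := fun t : (Fin n → ℝ) => fun i => x i - t i) (by fun_prop)
        · intro k
          refine ae_of_all _ fun t => ?_
          rw [norm_mul, norm_mul]
          refine mul_le_mul_of_nonneg_left ?_ (norm_nonneg _)
          simp only [hF, indicator]
          split_ifs <;> simp
        · refine ae_of_all _ fun t => ?_
          apply tendsto_const_nhds.congr'
          filter_upwards [hSe t] with k hk
          simp only [hF]; rw [indicator_of_mem hk]
      have ht2 : Tendsto (fun k => ENNReal.ofReal |HN n (F k) ε x| ^ p * ENNReal.ofReal (w x)) atTop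
          (nhds (ENNReal.ofReal |HN n f ε x| ^ p * ENNReal.ofReal (w x))) := by
        refine ENNReal.Tendsto.mul_const ?_ (Or.inr ENNReal.ofReal_ne_top)
        exact ((ENNReal.continuous_rpow_const).tendsto _).comp
          ((ENNReal.continuous_ofReal.tendsto _).comp ht.abs)
      exact ht2.liminf_eq.ge
    · have : HN n f ε x = 0 := integral_undef hi
      rw [this]; simp [ENNReal.zero_rpow_of_pos hp0]
  calc _ ≤ ∫⁻ x, liminf (fun k => ENNReal.ofReal |HN n (F k) ε x| ^ p * ENNReal.ofReal (w x)) atTop :=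
        lintegral_mono hpt
    _ ≤ liminf (fun k => ∫⁻ x, ENNReal.ofReal |HN n (F k) ε x| ^ p * ENNReal.ofReal (w x)) atTop := by
        apply lintegral_liminf_le'
        intro k
        exact (((HN_meas' n (F k) (hFm k) ε).abs.ennreal_ofReal).pow_const _).aemeasurable.mul hw.ennreal_ofReal
    _ ≤ _ := liminf_le_of_frequently_le' (Frequently.of_forall hb)

lemma pv_seq {n : ℕ} {f : (Fin n → ℝ) → ℝ} {x : Fin n → ℝ} {L : ℝ} (h : HasHilbPV n f x L) :
    Tendsto (fun j : ℕ => HN n f (fun _ => 1 / ((j:ℝ) + 1)) x) atTop (nhds L) := by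
  unfold HasHilbPV at h
  simp only [trunc_eq] at h
  refine h.comp ?_
  rw [tendsto_pi]
  intro i
  rw [tendsto_nhdsWithin_iff]
  exact ⟨tendsto_one_div_add_atTop_nhds_zero_nat, Eventually.of_forall fun j => by simp only [mem_Ioi]; positivity⟩

lemma coord_null (n : ℕ) (x : Fin n → ℝ) : ∀ᵐ t : Fin n → ℝ, ∀ i, t i ≠ x i := by
  rw [ae_all_iff]; intro i
  rw [ae_iff]
  simp only [ne_eq, not_not]
  exact Measure.pi_hyperplane (fun _ : Fin n => (volume : Measure ℝ)) i (x i)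

lemma not_aem {n : ℕ} {f : (Fin n → ℝ) → ℝ} (hf : ¬ AEMeasurable f) {x : Fin n → ℝ} {L : ℝ}
    (h : HasHilbPV n f x L) : L = 0 := by
  have hs := pv_seq h
  by_contra hL
  apply hf
  have hne := hs.eventually_ne hL
  obtain ⟨N, hN⟩ := eventually_atTop.1 hne
  set S : ℕ → Set (Fin n → ℝ) := fun j => {t | ∀ i, 1 / ((j:ℝ)+1) < |x i - t i|} with hS
  have hSm : ∀ j, MeasurableSet (S j) := by
    intro j
    simp only [hS, ofPred_forall]
    exact MeasurableSet.iInter fun i => measurableSet_lt measurable_const (by fun_prop)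
  have h1 : ∀ j, N ≤ j → AEMeasurable f (volume.restrict (S j)) := by
    intro j hj
    have hi : Integrable (fun t => (∏ i, hker (1 / ((j:ℝ)+1)) (x i - t i)) * f t) := by
      by_contra hi
      exact hN j hj (integral_undef hi)
    have hk : Measurable (fun t : Fin n → ℝ => (∏ i, hker (1 / ((j:ℝ)+1)) (x i - t i))⁻¹) :=
      ((kerN_meas n (fun _ => 1 / ((j:ℝ)+1))).comp (f := fun t : (Fin n → ℝ) => fun i => x i - t i) (by fun_prop)).inv
    have h2 := (hk.aemeasurable.mul hi.aemeasurable).restrict (s := S j)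
    refine h2.congr ?_
    refine (ae_restrict_iff' (hSm j)).2 (ae_of_all _ fun t ht => ?_)
    have : (∏ i, hker (1 / ((j:ℝ)+1)) (x i - t i)) ≠ 0 := by
      rw [Finset.prod_ne_zero_iff]
      intro i _
      have h3 := ht i
      have : x i - t i ≠ 0 := by
        intro h4; rw [h4, abs_zero] at h3
        have : (0:ℝ) < 1 / ((j:ℝ)+1) := by positivity
        linarith
      unfold hker; rw [if_pos h3]; simpa using this
    simp only [Pi.mul_apply]
    field_simp
  have h2 : AEMeasurable f (volume.restrict (⋃ j, S (N + j))) :=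
    aemeasurable_iUnion_iff.2 fun j => h1 _ (by omega)
  have h3 : volume.restrict (⋃ j, S (N + j)) = (volume : Measure (Fin n → ℝ)) := by
    rw [Measure.restrict_eq_self_of_ae_mem]
    filter_upwards [coord_null n x] with t ht
    have : ∀ᶠ j : ℕ in atTop, ∀ i, 1 / ((j:ℝ)+1) < |x i - t i| := by
      rw [eventually_all]; intro i
      exact tendsto_one_div_add_atTop_nhds_zero_nat.eventually_lt_const (abs_pos.2 (sub_ne_zero.2 (ht i).symm))
    obtain ⟨j, hj⟩ := ((tendsto_add_atTop_nat N).eventually this).exists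
    rw [mem_iUnion]
    exact ⟨j, by rw [add_comm]; exact hj⟩
  rwa [h3] at h2

lemma part1 (n : ℕ) (p : ℝ) (hp : 1 < p) :
    ∃ c : ℝ, 0 < c ∧
      ∀ w : (Fin n → ℝ) → ℝ, IsWeightN w → (∀ i, apVar p w i ≠ ∞) →
        ∀ f Hf : (Fin n → ℝ) → ℝ,
          (∀ᵐ x : Fin n → ℝ, HasHilbPV n f x (Hf x)) →
          lnormWN p w (fun x => ENNReal.ofReal |Hf x|) ≤
            ENNReal.ofReal c * (∏ i, apVar p w i) ^ max 1 ((p / (p - 1)) / p) *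
              lnormWN p w (fun x => ENNReal.ofReal |f x|) := by
  have hp0 : 0 < p := by linarith
  obtain ⟨C, hC, H⟩ := HN_main hp
  have hCn : C ^ n ≠ ⊤ := ENNReal.pow_ne_top hC
  refine ⟨(C ^ n).toReal + 1, by positivity, ?_⟩
  intro w hw hA f Hf hf
  set θ := max 1 ((p / (p - 1)) / p)
  have hθ : 0 ≤ θ := le_trans zero_le_one (le_max_left _ _)
  have hwm : AEMeasurable w := hw.2.aestronglyMeasurable.aemeasurable
  have hc : C ^ n ≤ ENNReal.ofReal ((C ^ n).toReal + 1) := by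
    rw [← ENNReal.ofReal_toReal hCn]
    exact ENNReal.ofReal_le_ofReal (by rw [ENNReal.toReal_ofReal ENNReal.toReal_nonneg]; linarith)
  unfold lnormWN
  by_cases hfm : AEMeasurable f
  swap
  · have : ∫⁻ x, ENNReal.ofReal |Hf x| ^ p * ENNReal.ofReal (w x) = 0 := by
      rw [← lintegral_zero (α := Fin n → ℝ) (μ := volume)]
      apply lintegral_congr_ae
      filter_upwards [hf] with x hx
      rw [not_aem hfm hx]; simp [ENNReal.zero_rpow_of_pos hp0]
    rw [this, ENNReal.zero_rpow_of_pos (by positivity)]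
    exact zero_le
  set g := hfm.mk f
  have hg : Measurable g := hfm.measurable_mk
  have hHN : ∀ ε x, HN n f ε x = HN n g ε x := by
    intro ε x
    unfold HN
    apply integral_congr_ae
    filter_upwards [hfm.ae_eq_mk] with t ht
    rw [ht]
  have hI : ∫⁻ x, ENNReal.ofReal |f x| ^ p * ENNReal.ofReal (w x) = ∫⁻ x, ENNReal.ofReal |g x| ^ p * ENNReal.ofReal (w x) := by
    apply lintegral_congr_ae
    filter_upwards [hfm.ae_eq_mk] with t ht
    rw [ht]
  set I := ∫⁻ x, ENNReal.ofReal |g x| ^ p * ENNReal.ofReal (w x)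
  set K := ∏ i, (C * apVar p w i ^ θ) ^ p with hK
  have hb : ∀ j : ℕ, ∫⁻ x, ENNReal.ofReal |HN n g (fun _ => 1 / ((j:ℝ) + 1)) x| ^ p * ENNReal.ofReal (w x) ≤ K * I := by
    intro j
    exact HN_gen hp w hwm K (H n w hwm hw.1 (apVar p w) hA (fun i => ENNReal.ae_le_essSup _)) g hg _ (fun i => by positivity)
  have hmain : ∫⁻ x, ENNReal.ofReal |Hf x| ^ p * ENNReal.ofReal (w x) ≤ K * I := by
    calc _ ≤ ∫⁻ x, liminf (fun j : ℕ => ENNReal.ofReal |HN n g (fun _ => 1 / ((j:ℝ) + 1)) x| ^ p * ENNReal.ofReal (w x)) atTop := by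
          apply lintegral_mono_ae
          filter_upwards [hf] with x hx
          have ht := pv_seq hx
          simp only [hHN] at ht
          have ht2 : Tendsto (fun j : ℕ => ENNReal.ofReal |HN n g (fun _ => 1 / ((j:ℝ) + 1)) x| ^ p * ENNReal.ofReal (w x)) atTop
              (nhds (ENNReal.ofReal |Hf x| ^ p * ENNReal.ofReal (w x))) := by
            refine ENNReal.Tendsto.mul_const ?_ (Or.inr ENNReal.ofReal_ne_top)
            exact ((ENNReal.continuous_rpow_const).tendsto _).comp
              ((ENNReal.continuous_ofReal.tendsto _).comp ht.abs)
          exact ht2.liminf_eq.ge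
      _ ≤ liminf (fun j : ℕ => ∫⁻ x, ENNReal.ofReal |HN n g (fun _ => 1 / ((j:ℝ) + 1)) x| ^ p * ENNReal.ofReal (w x)) atTop := by
          apply lintegral_liminf_le'
          intro k
          exact (((HN_meas' n g hg _).abs.ennreal_ofReal).pow_const _).aemeasurable.mul hwm.ennreal_ofReal
      _ ≤ _ := liminf_le_of_frequently_le' (Frequently.of_forall hb)
  rw [hI]
  calc _ ≤ (K * I) ^ (1/p) := ENNReal.rpow_le_rpow hmain (by positivity)
    _ = C ^ n * (∏ i, apVar p w i) ^ θ * I ^ (1/p) := by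
        rw [ENNReal.mul_rpow_of_nonneg _ _ (by positivity : 0 ≤ 1/p)]
        congr 1
        rw [hK, ENNReal.prod_rpow_of_nonneg hp0.le, ← ENNReal.rpow_mul, mul_one_div_cancel hp0.ne', ENNReal.rpow_one,
          Finset.prod_mul_distrib, ENNReal.prod_rpow_of_nonneg hθ]
        simp
    _ ≤ _ := mul_le_mul' (mul_le_mul' hc le_rfl) le_rfl

lemma lint_prod (n : ℕ) (h : ℝ → ℝ≥0∞) (hm : Measurable h) :
    ∫⁻ x : Fin n → ℝ, ∏ i, h (x i) = (∫⁻ t, h t) ^ n := by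
  induction n with
  | zero => simp [volume_pi]
  | succ n ih =>
    rw [consN_lint]
    simp only [Fin.prod_univ_succ, consN, Fin.cons_zero, Fin.cons_succ]
    have hm2 : Measurable (fun x : Fin n → ℝ => ∏ i, h (x i)) :=
      Finset.measurable_prod _ fun i _ => hm.comp (measurable_pi_apply i)
    rw [lintegral_prod_mul hm.aemeasurable hm2.aemeasurable, ih, pow_succ']

lemma ae_coord (n : ℕ) {P : ℝ → Prop} (h : ∀ᵐ t, P t) : ∀ᵐ x : Fin n → ℝ, ∀ i, P (x i) := by
  rw [ae_all_iff]; intro i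
  exact (Measure.quasiMeasurePreserving_eval (fun _ : Fin n => (volume : Measure ℝ)) i).ae h

lemma avg_const (c : ℝ) (hc : 0 < c) (u : ℝ → ℝ) (a b : ℝ) :
    avgIoc (fun t => c * u t) a b = ENNReal.ofReal c * avgIoc u a b := by
  unfold avgIoc lintIoc
  simp only [ENNReal.ofReal_mul hc.le]
  rw [lintegral_const_mul' _ _ ENNReal.ofReal_ne_top]
  ring

lemma apChar_const {p : ℝ} (hp : 1 < p) (c : ℝ) (hc : 0 < c) (u : ℝ → ℝ) (hu : ∀ t, 0 ≤ u t) :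
    apChar p (fun t => c * u t) = apChar p u := by
  unfold apChar
  have hp1 : 0 < p - 1 := by linarith
  refine iSup_congr fun a => iSup_congr fun b => iSup_congr fun _ => ?_
  simp only [Real.mul_rpow hc.le (hu _)]
  rw [avg_const c hc, avg_const _ (Real.rpow_pos_of_pos hc _), ENNReal.mul_rpow_of_nonneg _ _ hp1.le,
    ENNReal.ofReal_rpow_of_nonneg (by positivity) hp1.le, ← Real.rpow_mul hc.le]
  have e : (1 - p / (p-1)) * (p-1) = -1 := by field_simp; ring
  rw [e]
  calc _ = (ENNReal.ofReal c * ENNReal.ofReal (c ^ (-1:ℝ))) * (avgIoc u a b * avgIoc (fun t => u t ^ (1 - p / (p - 1))) a b ^ (p-1)) := by ring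
    _ = _ := by
      rw [← ENNReal.ofReal_mul hc.le, Real.rpow_neg_one, mul_inv_cancel₀ hc.ne']; simp

lemma apChar_ge_one {p : ℝ} (hp : 1 < p) (u : ℝ → ℝ) (hu : Measurable u) (hu0 : ∀ᵐ t, 0 < u t) :
    1 ≤ apChar p u := by
  have hp0 : 0 < p := by linarith
  set v : ℝ → ℝ := fun x => if 0 < u x then u x else 1 with hv
  have hvm : Measurable v := Measurable.ite (measurableSet_lt measurable_const hu) hu measurable_const
  have hv0 : ∀ x, 0 < v x := by
    intro x; simp only [hv]; split_ifs with h
    · exact h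
    · exact one_pos
  have huv : u =ᵐ[volume] v := by
    filter_upwards [hu0] with x h2
    simp [hv, h2]
  have h := holder_E hp hvm.ennreal_ofReal (fun x => by simpa using hv0 x) (fun x => ENNReal.ofReal_ne_top) (Ioc (0:ℝ) 1)
  have h2 := apChar_le_E (p := p) (u := u) le_rfl (zero_lt_one' ℝ)
  refine le_trans ?_ h2
  unfold avgIoc lintIoc
  have e1 : ∫⁻ t in Ioc (0:ℝ) 1, ENNReal.ofReal (u t) = ∫⁻ t in Ioc (0:ℝ) 1, ENNReal.ofReal (v t) := by
    apply lintegral_congr_ae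
    filter_upwards [ae_restrict_of_ae huv] with x hx
    rw [hx]
  have e2 : ∫⁻ t in Ioc (0:ℝ) 1, ENNReal.ofReal (u t ^ (1 - p / (p - 1))) =
      ∫⁻ t in Ioc (0:ℝ) 1, dw p (fun x => ENNReal.ofReal (v x)) t := by
    apply lintegral_congr_ae
    filter_upwards [ae_restrict_of_ae huv] with x hx
    unfold dw
    rw [hx, ENNReal.ofReal_rpow_of_pos (hv0 x)]
  rw [e1, e2]
  simp only [Real.volume_Ioc, sub_zero, ENNReal.ofReal_one] at h
  have h3 := ENNReal.rpow_le_rpow h hp0.le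
  rw [ENNReal.one_rpow, ENNReal.mul_rpow_of_nonneg _ _ hp0.le, ← ENNReal.rpow_mul, ← ENNReal.rpow_mul] at h3
  have e3 : 1 / p * p = 1 := by field_simp
  have e4 : (1 - 1/p) * p = p - 1 := by field_simp
  rw [e3, e4, ENNReal.rpow_one] at h3
  simpa using h3

lemma update_prod {n : ℕ} (u : ℝ → ℝ) (x : Fin n → ℝ) (i : Fin n) (t : ℝ) :
    ∏ j, u (Function.update x i t j) = (∏ j ∈ Finset.univ.erase i, u (x j)) * u t := by
  rw [← Finset.prod_erase_mul _ _ (Finset.mem_univ i)]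
  simp only [Function.update_self]
  congr 1
  apply Finset.prod_congr rfl
  intro j hj
  rw [Function.update_of_ne (Finset.ne_of_mem_erase hj)]

lemma tensor (n : ℕ) (p : ℝ) (hp : 1 < p) (u g Hg : ℝ → ℝ) (H0 : ℝ → ℝ≥0∞) (Q : ℝ≥0∞) (hQ : Q ≠ ⊤)
    (hu : Measurable u) (hu0 : ∀ t, 0 ≤ u t) (hu1 : ∀ᵐ t, 0 < u t) (hul : LocallyIntegrable u) (hQu : apChar p u ≤ Q)
    (hg : Measurable g) (hH0 : Measurable H0)
    (hpv : ∀ᵐ x, Tendsto (fun ε => HE g ε x) (nhdsWithin 0 (Ioi 0)) (nhds (Hg x)))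
    (hle : ∀ᵐ x, H0 x ≤ ENNReal.ofReal |Hg x|) (β c : ℝ)
    (hyp : ∀ w : (Fin n → ℝ) → ℝ, IsWeightN w → (∀ i, apVar p w i ≠ ∞) →
          ∀ f Hf : (Fin n → ℝ) → ℝ,
            (∀ᵐ x : Fin n → ℝ, HasHilbPV n f x (Hf x)) →
            lnormWN p w (fun x => ENNReal.ofReal |Hf x|) ≤
              ENNReal.ofReal c * (∏ i, apVar p w i) ^ β *
                lnormWN p w (fun x => ENNReal.ofReal |f x|)) :
    ((∫⁻ t, H0 t ^ p * ENNReal.ofReal (u t)) ^ n) ^ (1/p) ≤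
      ENNReal.ofReal c * (Q ^ n) ^ (max β 0) * ((∫⁻ t, ENNReal.ofReal |g t| ^ p * ENNReal.ofReal (u t)) ^ n) ^ (1/p) := by
  have hp0 : 0 < p := by linarith
  set w : (Fin n → ℝ) → ℝ := fun x => ∏ i, u (x i) with hw
  have hwp : ∀ᵐ x : Fin n → ℝ, ∀ i, 0 < u (x i) := ae_coord n hu1
  have hW : IsWeightN w := by
    constructor
    · filter_upwards [hwp] with x hx
      exact Finset.prod_pos fun i _ => hx i
    · rw [locallyIntegrable_iff]
      intro k hk
      obtain ⟨R, hR⟩ := hk.isBounded.subset_closedBall 0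
      have hi : Integrable (fun x : Fin n → ℝ => ∏ i, indicator (Icc (-R) R) u (x i)) := by
        refine Integrable.fintype_prod (f := fun _ => indicator (Icc (-R) R) u) fun i => ?_
        rw [integrable_indicator_iff measurableSet_Icc]
        exact hul.integrableOn_isCompact isCompact_Icc
      refine (hi.integrableOn (s := k)).congr_fun ?_ hk.measurableSet
      intro x hx
      apply Finset.prod_congr rfl
      intro i _
      rw [indicator_of_mem]
      have := hR hx
      rw [mem_closedBall_zero_iff] at this
      exact abs_le.1 ((norm_le_pi_norm x i).trans this)
  have hap : ∀ i, ∀ᵐ x : Fin n → ℝ, apChar p (fun t => w (Function.update x i t)) = apChar p u := by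
    intro i
    filter_upwards [hwp] with x hx
    simp only [hw, update_prod]
    exact apChar_const hp _ (Finset.prod_pos fun j _ => hx j) u hu0
  have hapQ : ∀ i, apVar p w i ≤ Q := by
    intro i
    unfold apVar
    refine essSup_le_of_ae_le _ ?_
    filter_upwards [hap i] with x hx
    rw [hx]; exact hQu
  have hap1 : ∀ i, 1 ≤ apVar p w i := by
    intro i
    have h1 : ∀ᵐ x : Fin n → ℝ, apChar p (fun t => w (Function.update x i t)) ≤ apVar p w i := ENNReal.ae_le_essSup _
    obtain ⟨x, hx⟩ := (h1.and (hap i)).exists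
    exact (apChar_ge_one hp u hu hu1).trans (hx.2 ▸ hx.1)
  have hPV : ∀ᵐ x : Fin n → ℝ, HasHilbPV n (fun t => ∏ i, g (t i)) x (∏ i, Hg (x i)) := by
    filter_upwards [ae_coord n hpv] with x hx
    unfold HasHilbPV
    simp only [trunc_eq]
    have e : ∀ ε, HN n (fun t => ∏ i, g (t i)) ε x = ∏ i, HE g (ε i) (x i) := by
      intro ε
      unfold HN HE
      rw [← integral_fintype_prod_volume_eq_prod (fun i t => hker (ε i) (x i - t) * g t)]
      simp only [Finset.prod_mul_distrib]
    simp only [e]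
    apply tendsto_finsetProd
    intro i _
    exact (hx i).comp (tendsto_eval_pi _ i)
  have h := hyp w hW (fun i => ((hapQ i).trans_lt hQ.lt_top).ne) _ _ hPV
  unfold lnormWN at h
  have e : ∀ F : ℝ → ℝ, ∀ x : Fin n → ℝ, ENNReal.ofReal |∏ i, F (x i)| ^ p * ENNReal.ofReal (w x) =
      ∏ i, (ENNReal.ofReal |F (x i)| ^ p * ENNReal.ofReal (u (x i))) := by
    intro F x
    rw [Finset.prod_mul_distrib, Finset.abs_prod, ENNReal.ofReal_prod_of_nonneg (fun i _ => abs_nonneg _),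
      ENNReal.prod_rpow_of_nonneg hp0.le, ENNReal.ofReal_prod_of_nonneg (fun i _ => hu0 _)]
  simp only [e] at h
  rw [lint_prod n (fun t => ENNReal.ofReal |g t| ^ p * ENNReal.ofReal (u t))
    ((hg.abs.ennreal_ofReal.pow_const _).mul hu.ennreal_ofReal)] at h
  have h1 : (∏ i, apVar p w i) ^ β ≤ (Q ^ n) ^ (max β 0) := by
    have hone : 1 ≤ ∏ i, apVar p w i := Finset.one_le_prod'' hap1
    calc _ ≤ (∏ i, apVar p w i) ^ (max β 0) := ENNReal.rpow_le_rpow_of_exponent_le hone (le_max_left _ _)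
      _ ≤ _ := by
        refine ENNReal.rpow_le_rpow ?_ (le_max_right _ _)
        calc _ ≤ ∏ i : Fin n, Q := Finset.prod_le_prod' fun i _ => hapQ i
          _ = _ := by simp
  refine le_trans ?_ (h.trans (mul_le_mul' (mul_le_mul' le_rfl h1) le_rfl))
  rw [← lint_prod n (fun t => H0 t ^ p * ENNReal.ofReal (u t)) ((hH0.pow_const _).mul hu.ennreal_ofReal)]
  refine ENNReal.rpow_le_rpow ?_ (by positivity)
  apply lintegral_mono_ae
  filter_upwards [ae_coord n hle] with x hx
  apply Finset.prod_le_prod'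
  intro i _
  exact mul_le_mul' (ENNReal.rpow_le_rpow (hx i) hp0.le) le_rfl

lemma pv_exists {g : ℝ → ℝ} (hg : Integrable g) {x : ℝ} (hd : DifferentiableAt ℝ g x) :
    ∃ L, Tendsto (fun ε => HE g ε x) (nhdsWithin 0 (Ioi 0)) (nhds L) := by
  obtain ⟨M, hM⟩ := hd.isBigO_sub.bound
  obtain ⟨r, hr, hM⟩ := Metric.eventually_nhds_iff.1 hM
  set B : Set ℝ := Metric.ball x r with hB
  set k : ℝ → ℝ := indicator B (fun _ => g x) with hk
  have hBv : volume B ≠ ⊤ := by rw [hB, Real.volume_ball]; exact ENNReal.ofReal_ne_top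
  have hki : Integrable k := (integrable_indicator_iff measurableSet_ball).2 (integrableOn_const hBv)
  have hz : ∀ ε, ∫ t, hker ε (x - t) * k t = 0 := by
    intro ε
    set φ : ℝ → ℝ := fun s => hker ε s * indicator (Metric.ball (0:ℝ) r) (fun _ => g x) s with hφ
    have e1 : (fun t => hker ε (x - t) * k t) = fun t => φ (x - t) := by
      ext t
      simp only [hφ, hk, hB, indicator, Metric.mem_ball, Real.dist_eq, sub_zero]
      rw [abs_sub_comm t x]
    rw [e1, integral_sub_left_eq_self]
    have e2 : ∀ s, φ (-s) = - φ s := by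
      intro s
      simp only [hφ, hker, indicator, Metric.mem_ball, Real.dist_eq, sub_zero, abs_neg]
      split_ifs <;> simp
    have e3 := integral_neg_eq_self φ volume
    simp only [e2, integral_neg] at e3
    linarith
  refine ⟨∫ t, (x - t)⁻¹ * (g t - k t), ?_⟩
  have e : ∀ ε, 0 < ε → HE g ε x = ∫ t, hker ε (x - t) * (g t - k t) := by
    intro ε hε
    simp only [mul_sub]
    rw [integral_sub (hker_int hg hε x) (hker_int hki hε x), hz, sub_zero]; rfl
  have hev : ∀ᶠ ε in nhdsWithin (0:ℝ) (Ioi 0), 0 < ε := self_mem_nhdsWithin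
  refine Tendsto.congr' (f₁ := fun ε => ∫ t, hker ε (x - t) * (g t - k t)) ?_ ?_
  · filter_upwards [hev] with ε hε
    rw [e ε hε]
  · refine tendsto_integral_filter_of_dominated_convergence
      (fun t => indicator B (fun _ => |M|) t + r⁻¹ * ‖g t - k t‖) ?_ ?_ ?_ ?_
    · filter_upwards with ε
      exact ((hker_meas ε).comp (measurable_const.sub measurable_id)).aestronglyMeasurable.mul (hg.sub hki).1
    · filter_upwards [hev] with ε hε
      refine ae_of_all _ fun t => ?_
      have hkb : |hker ε (x - t)| ≤ |x - t|⁻¹ := by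
        unfold hker; split_ifs
        · rw [one_div, abs_inv]
        · simp
      rw [norm_mul]
      by_cases ht : t ∈ B
      · have h1 := hM (Metric.mem_ball.1 ht)
        rw [indicator_of_mem ht]
        have hkt : k t = g x := indicator_of_mem ht _
        rw [hkt]
        have : ‖hker ε (x-t)‖ * ‖g t - g x‖ ≤ |M| := by
          by_cases hxt : x = t
          · subst hxt; simp
          calc _ ≤ |x - t|⁻¹ * (M * ‖t - x‖) := mul_le_mul hkb h1 (norm_nonneg _) (by positivity)
            _ = M := by
              have : |x - t| ≠ 0 := abs_ne_zero.2 (sub_ne_zero.2 hxt)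
              rw [Real.norm_eq_abs, abs_sub_comm t x]; field_simp
            _ ≤ _ := le_abs_self _
        have : 0 ≤ r⁻¹ * ‖g t - g x‖ := by positivity
        linarith
      · rw [indicator_of_notMem ht, zero_add]
        refine mul_le_mul_of_nonneg_right (hkb.trans ?_) (norm_nonneg _)
        have : r ≤ |x - t| := by
          rw [hB, Metric.mem_ball, Real.dist_eq, not_lt, abs_sub_comm] at ht; exact ht
        exact inv_anti₀ hr this
    · refine Integrable.add ?_ ((hg.sub hki).norm.const_mul _)
      exact (integrable_indicator_iff measurableSet_ball).2 (integrableOn_const hBv)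
    · have : ∀ᵐ t : ℝ, t ≠ x := by
        rw [ae_iff]; simp
      filter_upwards [this] with t ht
      apply tendsto_const_nhds.congr'
      have h0 : 0 < |x - t| := abs_pos.2 (sub_ne_zero.2 ht.symm)
      filter_upwards [nhdsWithin_le_nhds (eventually_lt_nhds h0)] with ε hε
      simp [hker, hε]

lemma pv_neg {g : ℝ → ℝ} (hs : ∀ t, g t ≠ 0 → 0 < t) {x : ℝ} (hx : x < 0) {L : ℝ}
    (h : Tendsto (fun ε => HE g ε x) (nhdsWithin 0 (Ioi 0)) (nhds L)) :
    L = ∫ t, (x - t)⁻¹ * g t := by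
  refine tendsto_nhds_unique h (tendsto_const_nhds.congr' ?_)
  filter_upwards [nhdsWithin_le_nhds (eventually_lt_nhds (neg_pos.2 hx))] with ε hε
  unfold HE
  congr 1; ext t
  by_cases ht : g t = 0
  · simp [ht]
  · have := hs t ht
    have : ε < |x - t| := by rw [abs_of_neg (by linarith)]; linarith
    simp [hker, this]

lemma lint_refl (F : ℝ → ℝ≥0∞) (s : Set ℝ) : ∫⁻ t in s, F t = ∫⁻ t in (Neg.neg ⁻¹' s), F (-t) :=
  ((Measure.measurePreserving_neg (volume : Measure ℝ)).setLIntegral_comp_preimage_emb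
    (MeasurableEquiv.neg ℝ).measurableEmbedding F s).symm

lemma lint_pow {δ : ℝ} (hδ : 0 < δ) {R : ℝ} (hR : 0 ≤ R) :
    ∫⁻ t in Ioc 0 R, ENNReal.ofReal (t ^ (δ - 1)) = ENNReal.ofReal (R ^ δ / δ) := by
  have hi : IntegrableOn (fun t : ℝ => t ^ (δ-1)) (Ioc 0 R) := by
    have := intervalIntegral.intervalIntegrable_rpow' (a := 0) (b := R) (r := δ - 1) (by linarith)
    rwa [intervalIntegrable_iff_integrableOn_Ioc_of_le hR] at this
  rw [← ofReal_integral_eq_lintegral_ofReal hi]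
  · rw [← intervalIntegral.integral_of_le hR, integral_rpow (Or.inl (by linarith))]
    simp [hδ.ne']
  · refine (ae_restrict_iff' measurableSet_Ioc).2 (ae_of_all _ fun t ht => ?_)
    exact Real.rpow_nonneg ht.1.le _

lemma lint_pow_abs {δ : ℝ} (hδ : 0 < δ) {R : ℝ} (hR : 0 ≤ R) :
    ∫⁻ t in Ioo 0 R, ENNReal.ofReal (|t| ^ (δ - 1)) = ENNReal.ofReal (R ^ δ / δ) := by
  rw [← lint_pow hδ hR, restrict_Ioo_eq_restrict_Ioc]
  refine setLIntegral_congr_fun measurableSet_Ioc fun t ht => ?_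
  simp only [abs_of_pos ht.1]

lemma lint_pow_abs_neg {δ : ℝ} (hδ : 0 < δ) {R : ℝ} (hR : 0 ≤ R) :
    ∫⁻ t in Ioo (-R) 0, ENNReal.ofReal (|t| ^ (δ - 1)) = ENNReal.ofReal (R ^ δ / δ) := by
  rw [lint_refl, ← lint_pow_abs hδ hR]
  simp

lemma lint_pow_sym {δ : ℝ} (hδ : 0 < δ) {R : ℝ} (hR : 0 ≤ R) :
    ∫⁻ t in Ioc (-R) R, ENNReal.ofReal (|t| ^ (δ - 1)) ≤ ENNReal.ofReal (2 * R ^ δ / δ) := by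
  calc _ ≤ ∫⁻ t in (Ioc (-R) 0 ∪ Ioc 0 R), ENNReal.ofReal (|t| ^ (δ - 1)) := by
        apply lintegral_mono_set
        intro t ht
        rcases le_or_gt t 0 with h | h
        · left; exact ⟨ht.1, h⟩
        · right; exact ⟨h, ht.2⟩
    _ ≤ _ + _ := lintegral_union_le _ _ _
    _ = _ := by
        rw [← restrict_Ioo_eq_restrict_Ioc, lint_pow_abs_neg hδ hR, ← restrict_Ioo_eq_restrict_Ioc, lint_pow_abs hδ hR,
          ← ENNReal.ofReal_add (by positivity) (by positivity)]
        congr 1; ring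

lemma loc_pow {δ : ℝ} (hδ : 0 < δ) : LocallyIntegrable (fun t : ℝ => |t| ^ (δ - 1)) := by
  rw [locallyIntegrable_iff]
  intro k hk
  obtain ⟨R, hR⟩ := hk.isBounded.subset_closedBall 0
  have hs : k ⊆ Ioc (-(|R|+1)) (|R|+1) := by
    intro t ht
    have := hR ht
    rw [mem_closedBall_zero_iff, Real.norm_eq_abs, abs_le] at this
    have := le_abs_self R
    exact ⟨by linarith, by linarith⟩
  refine IntegrableOn.mono_set ?_ hs
  have hm : Measurable (fun t : ℝ => |t| ^ (δ - 1)) := by fun_prop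
  refine ⟨hm.aestronglyMeasurable, ?_⟩
  rw [hasFiniteIntegral_iff_ofReal (ae_of_all _ fun t => by positivity)]
  exact (lint_pow_sym hδ (by positivity)).trans_lt ENNReal.ofReal_lt_top

lemma abs_le_max_Ioc {a b t : ℝ} (ht : t ∈ Ioc a b) : |t| ≤ max |a| |b| := by
  rw [abs_le]
  have h1 := neg_abs_le a
  have h2 := le_abs_self b
  have h3 := le_max_left |a| |b|
  have h4 := le_max_right |a| |b|
  exact ⟨by linarith [ht.1], by linarith [ht.2]⟩

lemma avg_le_const {u : ℝ → ℝ} {a b : ℝ} (hab : a < b) {c : ℝ} (h : ∀ t ∈ Ioc a b, u t ≤ c) :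
    avgIoc u a b ≤ ENNReal.ofReal c := by
  unfold avgIoc lintIoc
  have : ∫⁻ t in Ioc a b, ENNReal.ofReal (u t) ≤ ENNReal.ofReal c * ENNReal.ofReal (b - a) := by
    calc _ ≤ ∫⁻ t in Ioc a b, ENNReal.ofReal c :=
          setLIntegral_mono measurable_const fun t ht => ENNReal.ofReal_le_ofReal (h t ht)
      _ = _ := by rw [setLIntegral_const, Real.volume_Ioc]
  calc _ ≤ (ENNReal.ofReal (b - a))⁻¹ * (ENNReal.ofReal c * ENNReal.ofReal (b - a)) := mul_le_mul' le_rfl this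
    _ = _ := by
      rw [mul_comm, mul_assoc, ENNReal.mul_inv_cancel (by simpa using hab) ENNReal.ofReal_ne_top, mul_one]

lemma avg_pos_pow {q : ℝ} (hq : 0 ≤ q) {a b : ℝ} (hab : a < b) :
    avgIoc (fun t => |t| ^ q) a b ≤ ENNReal.ofReal ((max |a| |b|) ^ q) :=
  avg_le_const hab fun t ht => Real.rpow_le_rpow (abs_nonneg _) (abs_le_max_Ioc ht) hq

lemma max_pos_ab {a b : ℝ} (hab : a < b) : 0 < max |a| |b| := by
  rcases eq_or_ne a 0 with h | h
  · exact lt_max_of_lt_right (abs_pos.2 (by linarith))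
  · exact lt_max_of_lt_left (abs_pos.2 h)

lemma avg_neg_pow {δ : ℝ} (hδ : 0 < δ) (hδ1 : δ ≤ 1) {a b : ℝ} (hab : a < b) :
    avgIoc (fun t => |t| ^ (δ-1)) a b ≤ ENNReal.ofReal (4 / δ * (max |a| |b|) ^ (δ-1)) := by
  have hR := max_pos_ab hab
  set R := max |a| |b| with hRd
  by_cases hL : R / 2 ≤ b - a
  · unfold avgIoc lintIoc
    have h1 : ∫⁻ t in Ioc a b, ENNReal.ofReal (|t| ^ (δ-1)) ≤ ENNReal.ofReal (2 * R ^ δ / δ) := by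
      refine le_trans (lintegral_mono_set ?_) (lint_pow_sym hδ hR.le)
      intro t ht
      have h1 := neg_abs_le a
      have h2 := le_abs_self b
      have h3 := le_max_left |a| |b|
      have h4 := le_max_right |a| |b|
      exact ⟨by linarith [ht.1], by linarith [ht.2]⟩
    have hba : 0 < b - a := by linarith
    rw [← ENNReal.ofReal_inv_of_pos hba]
    refine (mul_le_mul' le_rfl h1).trans ?_
    rw [← ENNReal.ofReal_mul (by positivity)]
    apply ENNReal.ofReal_le_ofReal
    have h2 : (b - a)⁻¹ ≤ (R/2)⁻¹ := inv_anti₀ (by positivity) hL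
    calc _ ≤ (R/2)⁻¹ * (2 * R ^ δ / δ) := by gcongr
      _ = _ := by rw [Real.rpow_sub_one hR.ne']; field_simp; norm_num
  · push Not at hL
    refine avg_le_const hab fun t ht => ?_
    have h1 : R / 2 ≤ |t| := by
      rcases max_choice |a| |b| with h | h
      · have h5 : |a| = R := by rw [hRd, h]
        have : |a| ≤ |a - t| + |t| := by simpa using abs_add_le (a - t) t
        have h6 : |a - t| ≤ b - a := by rw [abs_le]; constructor <;> linarith [ht.1, ht.2]
        linarith
      · have h5 : |b| = R := by rw [hRd, h]
        have : |b| ≤ |b - t| + |t| := by simpa using abs_add_le (b - t) t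
        have h6 : |b - t| ≤ b - a := by rw [abs_le]; constructor <;> linarith [ht.1, ht.2]
        linarith
    calc |t| ^ (δ-1) ≤ (R/2) ^ (δ-1) := Real.rpow_le_rpow_of_nonpos (by positivity) h1 (by linarith)
      _ = 2 ^ (1 - δ) * R ^ (δ-1) := by
          rw [Real.div_rpow hR.le (by norm_num), div_eq_mul_inv, ← Real.rpow_neg (by norm_num)]
          rw [mul_comm]; congr 2; ring
      _ ≤ 4 / δ * R ^ (δ-1) := by
          gcongr
          have : (2:ℝ) ^ (1-δ) ≤ 2 ^ (1:ℝ) := Real.rpow_le_rpow_of_exponent_le (by norm_num) (by linarith)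
          rw [Real.rpow_one] at this
          rw [le_div_iff₀ hδ]
          nlinarith [Real.rpow_pos_of_pos (zero_lt_two' ℝ) (1-δ)]

lemma apA {p δ : ℝ} (hp : 1 < p) (hδ : 0 < δ) (hδ1 : δ ≤ 1) :
    apChar p (fun t => |t| ^ (δ-1)) ≤ ENNReal.ofReal (4/δ) := by
  have hp1 : 0 < p - 1 := by linarith
  unfold apChar
  refine iSup_le fun a => iSup_le fun b => iSup_le fun hab => ?_
  have hR := max_pos_ab hab
  have e : (fun t : ℝ => (|t| ^ (δ-1)) ^ (1 - p/(p-1))) = fun t => |t| ^ ((1-δ)/(p-1)) := by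
    ext t
    rw [← Real.rpow_mul (abs_nonneg _)]; congr 1; field_simp; ring
  rw [e]
  refine (mul_le_mul' (avg_neg_pow hδ hδ1 hab) (ENNReal.rpow_le_rpow
    (avg_pos_pow (div_nonneg (by linarith) hp1.le) hab) hp1.le)).trans (le_of_eq ?_)
  rw [ENNReal.ofReal_rpow_of_nonneg (by positivity) hp1.le, ← ENNReal.ofReal_mul (by positivity), ← Real.rpow_mul hR.le,
    mul_assoc, ← Real.rpow_add hR]
  have : δ - 1 + (1 - δ)/(p-1) * (p-1) = 0 := by field_simp; ring
  rw [this]; simp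

lemma apB {p δ : ℝ} (hp : 1 < p) (hδ : 0 < δ) (hδ1 : δ ≤ 1) :
    apChar p (fun t => |t| ^ ((p-1)*(1-δ))) ≤ ENNReal.ofReal ((4/δ)^(p-1)) := by
  have hp1 : 0 < p - 1 := by linarith
  unfold apChar
  refine iSup_le fun a => iSup_le fun b => iSup_le fun hab => ?_
  have hR := max_pos_ab hab
  have e : (fun t : ℝ => (|t| ^ ((p-1)*(1-δ))) ^ (1 - p/(p-1))) = fun t => |t| ^ (δ-1) := by
    ext t
    rw [← Real.rpow_mul (abs_nonneg _)]; congr 1; field_simp; ring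
  rw [e]
  refine (mul_le_mul' (avg_pos_pow (mul_nonneg hp1.le (by linarith)) hab) (ENNReal.rpow_le_rpow
    (avg_neg_pow hδ hδ1 hab) hp1.le)).trans (le_of_eq ?_)
  rw [ENNReal.ofReal_rpow_of_nonneg (by positivity) hp1.le, ← ENNReal.ofReal_mul (by positivity),
    Real.mul_rpow (by positivity) (by positivity), ← Real.rpow_mul hR.le,
    mul_left_comm, ← Real.rpow_add hR]
  have : (p-1) * (1 - δ) + (δ - 1) * (p-1) = 0 := by ring
  rw [this]; simp

def gpow (η : ℝ) : ℝ → ℝ := indicator (Ioo 0 1) (fun t => t ^ η)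

lemma gpow_meas (η : ℝ) : Measurable (gpow η) :=
  Measurable.indicator (by fun_prop) measurableSet_Ioo

lemma gpow_int {η : ℝ} (hη : -1 < η) : Integrable (gpow η) := by
  unfold gpow
  rw [integrable_indicator_iff measurableSet_Ioo]
  have := intervalIntegral.intervalIntegrable_rpow' (a := 0) (b := 1) hη
  rw [intervalIntegrable_iff_integrableOn_Ioc_of_le zero_le_one] at this
  exact this.mono_set Ioo_subset_Ioc_self

lemma gpow_PV {η : ℝ} (hη : -1 < η) : ∃ Hg : ℝ → ℝ,
    (∀ᵐ x, Tendsto (fun ε => HE (gpow η) ε x) (nhdsWithin 0 (Ioi 0)) (nhds (Hg x))) ∧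
    ∀ x, x < 0 → Hg x = ∫ t, (x - t)⁻¹ * gpow η t := by
  have hd : ∀ x, x ≠ 0 → x ≠ 1 → DifferentiableAt ℝ (gpow η) x := by
    intro x h0 h1
    by_cases hx : x ∈ Ioo (0:ℝ) 1
    · have : DifferentiableAt ℝ (fun t : ℝ => t ^ η) x := Real.differentiableAt_rpow_const_of_ne _ h0
      refine this.congr_of_eventuallyEq ?_
      filter_upwards [isOpen_Ioo.mem_nhds hx] with t ht
      exact indicator_of_mem ht _
    · have hx2 : x ∈ (Icc (0:ℝ) 1)ᶜ := by
        intro h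
        exact hx ⟨lt_of_le_of_ne h.1 h0.symm, lt_of_le_of_ne h.2 h1⟩
      refine (differentiableAt_const (0:ℝ)).congr_of_eventuallyEq ?_
      filter_upwards [isClosed_Icc.isOpen_compl.mem_nhds hx2] with t ht
      exact indicator_of_notMem (fun h => ht (Ioo_subset_Icc_self h)) _
  have hex : ∀ x, ∃ L, x ≠ 0 → x ≠ 1 → Tendsto (fun ε => HE (gpow η) ε x) (nhdsWithin 0 (Ioi 0)) (nhds L) := by
    intro x
    by_cases h : x ≠ 0 ∧ x ≠ 1
    · obtain ⟨L, hL⟩ := pv_exists (gpow_int hη) (hd x h.1 h.2)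
      exact ⟨L, fun _ _ => hL⟩
    · exact ⟨0, fun h0 h1 => absurd ⟨h0, h1⟩ h⟩
  choose Hg hH using hex
  refine ⟨Hg, ?_, ?_⟩
  · have h0 : ∀ᵐ t : ℝ, t ≠ 0 := by rw [ae_iff]; simp
    have h1 : ∀ᵐ t : ℝ, t ≠ 1 := by rw [ae_iff]; simp
    filter_upwards [h0, h1] with x a b
    exact hH x a b
  · intro x hx
    refine pv_neg (fun t ht => ?_) hx (hH x hx.ne (by linarith))
    exact (mem_of_indicator_ne_zero ht).1

lemma Hval_eq (η x : ℝ) : |∫ t, (x - t)⁻¹ * gpow η t| = |∫ t in Ioo (0:ℝ) 1, (t - x)⁻¹ * t ^ η| := by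
  rw [← integral_indicator measurableSet_Ioo, ← abs_neg, ← integral_neg]
  congr 2; ext t
  unfold gpow
  by_cases h : t ∈ Ioo (0:ℝ) 1
  · rw [indicator_of_mem h, indicator_of_mem h, ← neg_sub t x, inv_neg]; ring
  · rw [indicator_of_notMem h, indicator_of_notMem h]; simp

lemma HvalA {x : ℝ} (hx : x < 0) : Real.log (1 / (-x)) ≤ |∫ t, (x - t)⁻¹ * gpow 0 t| := by
  rw [Hval_eq]
  refine le_trans ?_ (le_abs_self _)
  simp only [Real.rpow_zero, mul_one]
  rw [← integral_Ioc_eq_integral_Ioo, ← intervalIntegral.integral_of_le zero_le_one,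
    intervalIntegral.integral_comp_sub_right (fun t => t⁻¹) x, integral_inv_of_pos (by linarith) (by linarith)]
  have : 0 < -x := by linarith
  apply Real.log_le_log (by positivity)
  rw [zero_sub]
  gcongr
  linarith

lemma HvalB {δ x : ℝ} (hδ : 0 < δ) (hx : x < -1) : 1 / (2 * δ * |x|) ≤ |∫ t, (x - t)⁻¹ * gpow (δ-1) t| := by
  rw [Hval_eq]
  refine le_trans ?_ (le_abs_self _)
  have hax : |x| = -x := abs_of_neg (by linarith)
  have hi : IntegrableOn (fun t : ℝ => t ^ (δ-1)) (Ioo 0 1) := by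
    have := gpow_int (η := δ - 1) (by linarith)
    unfold gpow at this
    rwa [integrable_indicator_iff measurableSet_Ioo] at this
  have hv : ∫ t in Ioo (0:ℝ) 1, t ^ (δ-1) = 1/δ := by
    rw [← integral_Ioc_eq_integral_Ioo, ← intervalIntegral.integral_of_le zero_le_one, integral_rpow (Or.inl (by linarith))]
    simp [hδ.ne']
  calc 1 / (2 * δ * |x|) = ∫ t in Ioo (0:ℝ) 1, (2*|x|)⁻¹ * t ^ (δ-1) := by
        rw [integral_const_mul, hv]; field_simp
    _ ≤ _ := by
        refine setIntegral_mono_on (hi.const_mul _) ?_ measurableSet_Ioo ?_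
        · refine Integrable.bdd_mul (c := 1) hi (by fun_prop) ?_
          refine (ae_restrict_iff' measurableSet_Ioo).2 (ae_of_all _ fun t ht => ?_)
          rw [norm_inv, Real.norm_eq_abs, abs_of_pos (by linarith [ht.1])]
          exact inv_le_one_of_one_le₀ (by linarith [ht.1])
        · intro t ht
          have : 0 ≤ t ^ (δ-1) := Real.rpow_nonneg ht.1.le _
          refine mul_le_mul_of_nonneg_right ?_ this
          apply inv_anti₀ (by linarith [ht.1])
          linarith [ht.2]

lemma ae_ne0 : ∀ᵐ t : ℝ, t ≠ 0 := by rw [ae_iff]; simp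

def Pkg (p c τ δ : ℝ) : Prop := ∃ (u g Hg : ℝ → ℝ) (H0 : ℝ → ℝ≥0∞),
    Measurable u ∧ (∀ t, 0 ≤ u t) ∧ (∀ᵐ t, 0 < u t) ∧ LocallyIntegrable u ∧
    apChar p u ≤ ENNReal.ofReal ((4/δ)^τ) ∧ Measurable g ∧ Measurable H0 ∧
    (∀ᵐ x, Tendsto (fun ε => HE g ε x) (nhdsWithin 0 (Ioi 0)) (nhds (Hg x))) ∧
    (∀ᵐ x, H0 x ≤ ENNReal.ofReal |Hg x|) ∧
    (∫⁻ t, ENNReal.ofReal |g t| ^ p * ENNReal.ofReal (u t)) ≠ 0 ∧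
    (∫⁻ t, ENNReal.ofReal |g t| ^ p * ENNReal.ofReal (u t)) ≠ ⊤ ∧
    ENNReal.ofReal (c/δ) ^ p * (∫⁻ t, ENNReal.ofReal |g t| ^ p * ENNReal.ofReal (u t)) ≤
      ∫⁻ t, H0 t ^ p * ENNReal.ofReal (u t)

lemma pkgA {p δ : ℝ} (hp : 1 < p) (hδ : 0 < δ) (hδ1 : δ ≤ 1) : Pkg p (Real.exp (-1)) 1 δ := by
  have hp0 : 0 < p := by linarith
  obtain ⟨Hg, h1, h2⟩ := gpow_PV (η := 0) (by norm_num)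
  set a := Real.exp (-(1/δ)) with ha
  have ha0 : 0 < a := Real.exp_pos _
  have hI : ∫⁻ t, ENNReal.ofReal |gpow 0 t| ^ p * ENNReal.ofReal (|t| ^ (δ-1)) = ENNReal.ofReal (1/δ) := by
    have := lint_pow_abs hδ zero_le_one
    rw [Real.one_rpow] at this
    rw [← this, ← lintegral_indicator measurableSet_Ioo]
    congr 1; ext t
    unfold gpow
    by_cases h : t ∈ Ioo (0:ℝ) 1
    · rw [indicator_of_mem h, indicator_of_mem h]; simp
    · rw [indicator_of_notMem h, indicator_of_notMem h]; simp [ENNReal.zero_rpow_of_pos hp0]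
  refine ⟨fun t => |t| ^ (δ-1), gpow 0, Hg, indicator (Ioo (-a) 0) (fun _ => ENNReal.ofReal (1/δ)),
    by fun_prop, fun t => by positivity, ?_, loc_pow hδ, ?_, gpow_meas 0, measurable_const.indicator measurableSet_Ioo, h1, ?_, ?_, ?_, ?_⟩
  · filter_upwards [ae_ne0] with t ht
    exact Real.rpow_pos_of_pos (abs_pos.2 ht) _
  · rw [Real.rpow_one]; exact apA hp hδ hδ1
  · refine ae_of_all _ fun x => ?_
    by_cases hx : x ∈ Ioo (-a) 0
    · rw [indicator_of_mem hx]
      apply ENNReal.ofReal_le_ofReal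
      rw [h2 x hx.2]
      refine le_trans ?_ (HvalA hx.2)
      have hx0 : 0 < -x := by linarith [hx.2]
      have : Real.log (-x) ≤ -(1/δ) := by
        rw [← Real.log_exp (-(1/δ))]
        exact Real.log_le_log hx0 (by linarith [hx.1])
      rw [one_div (-x), Real.log_inv]; linarith
    · rw [indicator_of_notMem hx]; exact zero_le
  · rw [hI]; simpa using hδ
  · rw [hI]; exact ENNReal.ofReal_ne_top
  · rw [hI]
    have hJ : ∫⁻ t, indicator (Ioo (-a) 0) (fun _ => ENNReal.ofReal (1/δ)) t ^ p * ENNReal.ofReal (|t| ^ (δ-1)) =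
        ENNReal.ofReal (1/δ) ^ p * ENNReal.ofReal (a ^ δ / δ) := by
      rw [← lint_pow_abs_neg hδ ha0.le, ← lintegral_const_mul' _ _ (ENNReal.rpow_ne_top_of_nonneg hp0.le ENNReal.ofReal_ne_top),
        ← lintegral_indicator measurableSet_Ioo]
      congr 1; ext t
      by_cases h : t ∈ Ioo (-a) 0
      · rw [indicator_of_mem h, indicator_of_mem h]
      · rw [indicator_of_notMem h, indicator_of_notMem h]; simp [ENNReal.zero_rpow_of_pos hp0]
    rw [hJ, ENNReal.ofReal_rpow_of_nonneg (by positivity) hp0.le, ENNReal.ofReal_rpow_of_nonneg (by positivity) hp0.le,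
      ← ENNReal.ofReal_mul (by positivity), ← ENNReal.ofReal_mul (by positivity)]
    apply ENNReal.ofReal_le_ofReal
    have e1 : a ^ δ = Real.exp (-1) := by
      rw [ha, ← Real.exp_mul]; congr 1; field_simp
    rw [e1, div_eq_mul_one_div, Real.mul_rpow (by positivity) (by positivity)]
    have e2 : Real.exp (-1) ^ p ≤ Real.exp (-1) := by
      rw [← Real.exp_mul]; apply Real.exp_le_exp.2; linarith
    calc _ ≤ Real.exp (-1) * (1/δ) ^ p * (1/δ) := by gcongr
      _ = _ := by ring

lemma pkgB {p δ : ℝ} (hp : 1 < p) (hp2 : p ≤ 2) (hδ : 0 < δ) (hδ1 : δ ≤ 1) : Pkg p (1/2) (p-1) δ := by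
  have hp0 : 0 < p := by linarith
  have hp1 : 0 < p - 1 := by linarith
  obtain ⟨Hg, h1, h2⟩ := gpow_PV (η := δ - 1) (by linarith)
  have hI : ∫⁻ t, ENNReal.ofReal |gpow (δ-1) t| ^ p * ENNReal.ofReal (|t| ^ ((p-1)*(1-δ))) = ENNReal.ofReal (1/δ) := by
    have := lint_pow_abs hδ zero_le_one
    rw [Real.one_rpow] at this
    rw [← this, ← lintegral_indicator measurableSet_Ioo]
    congr 1; ext t
    unfold gpow
    by_cases h : t ∈ Ioo (0:ℝ) 1
    · rw [indicator_of_mem h, indicator_of_mem h]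
      have ht := h.1
      rw [ENNReal.ofReal_rpow_of_nonneg (by positivity) hp0.le, ← ENNReal.ofReal_mul (by positivity), abs_of_pos ht,
        abs_of_pos (Real.rpow_pos_of_pos ht _), ← Real.rpow_mul ht.le, ← Real.rpow_add ht]
      congr 2; ring
    · rw [indicator_of_notMem h, indicator_of_notMem h]; simp [ENNReal.zero_rpow_of_pos hp0]
  refine ⟨fun t => |t| ^ ((p-1)*(1-δ)), gpow (δ-1), Hg, indicator (Iio (-1)) (fun x => ENNReal.ofReal (1/(2*δ*|x|))),
    by fun_prop, fun t => by positivity, ?_, ?_, apB hp hδ hδ1, gpow_meas _, 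
    Measurable.indicator (by fun_prop) measurableSet_Iio, h1, ?_, ?_, ?_, ?_⟩
  · filter_upwards [ae_ne0] with t ht
    exact Real.rpow_pos_of_pos (abs_pos.2 ht) _
  · have := loc_pow (δ := (p-1)*(1-δ) + 1) (by nlinarith)
    simpa using this
  · refine ae_of_all _ fun x => ?_
    by_cases hx : x ∈ Iio (-1:ℝ)
    · rw [indicator_of_mem hx]
      apply ENNReal.ofReal_le_ofReal
      rw [h2 x (by have : x < -1 := hx; linarith)]
      exact HvalB hδ hx
    · rw [indicator_of_notMem hx]; exact zero_le
  · rw [hI]; simpa using hδ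
  · rw [hI]; exact ENNReal.ofReal_ne_top
  · rw [hI]
    have hi : IntegrableOn (fun t : ℝ => t ^ (-1 - (p-1)*δ)) (Ioi 1) :=
      integrableOn_Ioi_rpow_of_lt (by nlinarith) zero_lt_one
    have hv : ∫⁻ t in Ioi (1:ℝ), ENNReal.ofReal (t ^ (-1 - (p-1)*δ)) = ENNReal.ofReal (1/((p-1)*δ)) := by
      rw [← ofReal_integral_eq_lintegral_ofReal hi, integral_Ioi_rpow_of_lt (by nlinarith) zero_lt_one]
      · congr 1
        rw [Real.one_rpow]
        have : -1 - (p-1)*δ + 1 = -((p-1)*δ) := by ring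
        rw [this, neg_div_neg_eq]
      · refine (ae_restrict_iff' measurableSet_Ioi).2 (ae_of_all _ fun t ht => ?_)
        exact Real.rpow_nonneg (zero_le_one.trans (le_of_lt ht)) _
    have hJ : ∫⁻ t, indicator (Iio (-1:ℝ)) (fun x => ENNReal.ofReal (1/(2*δ*|x|))) t ^ p * ENNReal.ofReal (|t| ^ ((p-1)*(1-δ))) =
        ENNReal.ofReal (1/(2*δ)) ^ p * ENNReal.ofReal (1/((p-1)*δ)) := by
      rw [← hv, ← lintegral_const_mul' _ _ (ENNReal.rpow_ne_top_of_nonneg hp0.le ENNReal.ofReal_ne_top)]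
      have e0 : ∫⁻ t, indicator (Iio (-1:ℝ)) (fun x => ENNReal.ofReal (1/(2*δ*|x|))) t ^ p * ENNReal.ofReal (|t| ^ ((p-1)*(1-δ)))
          = ∫⁻ t in Iio (-1:ℝ), ENNReal.ofReal (1/(2*δ*|t|)) ^ p * ENNReal.ofReal (|t| ^ ((p-1)*(1-δ))) := by
        rw [← lintegral_indicator measurableSet_Iio]
        congr 1; ext t
        by_cases h : t ∈ Iio (-1:ℝ)
        · rw [indicator_of_mem h, indicator_of_mem h]
        · rw [indicator_of_notMem h, indicator_of_notMem h]; simp [ENNReal.zero_rpow_of_pos hp0]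
      rw [e0, lint_refl]
      have e3 : Neg.neg ⁻¹' Iio (-1:ℝ) = Ioi 1 := by ext; simp
      rw [e3]
      refine setLIntegral_congr_fun measurableSet_Ioi fun t ht => ?_
      have ht0 : 0 < t := zero_lt_one.trans ht
      simp only [abs_neg, abs_of_pos ht0]
      rw [ENNReal.ofReal_rpow_of_nonneg (by positivity) hp0.le, ENNReal.ofReal_rpow_of_nonneg (by positivity) hp0.le,
        ← ENNReal.ofReal_mul (by positivity), ← ENNReal.ofReal_mul (by positivity)]
      congr 1
      have e4 : 1 / (2*δ*t) = 1/(2*δ) * t ^ (-1:ℝ) := by rw [Real.rpow_neg_one]; field_simp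
      rw [e4, Real.mul_rpow (by positivity) (by positivity), mul_assoc, ← Real.rpow_mul ht0.le, ← Real.rpow_add ht0]
      congr 2; ring
    rw [hJ]
    have e5 : (1/2)/δ = 1/(2*δ) := by field_simp
    rw [e5]
    refine mul_le_mul' le_rfl (ENNReal.ofReal_le_ofReal ?_)
    apply one_div_le_one_div_of_le (by positivity)
    nlinarith

lemma part2 (n : ℕ) (hn : 0 < n) (p : ℝ) (hp : 1 < p) :
    ∀ β : ℝ, β < max 1 ((p / (p - 1)) / p) →
      ¬ ∃ c : ℝ, 0 < c ∧
        ∀ w : (Fin n → ℝ) → ℝ, IsWeightN w → (∀ i, apVar p w i ≠ ∞) →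
          ∀ f Hf : (Fin n → ℝ) → ℝ,
            (∀ᵐ x : Fin n → ℝ, HasHilbPV n f x (Hf x)) →
            lnormWN p w (fun x => ENNReal.ofReal |Hf x|) ≤
              ENNReal.ofReal c * (∏ i, apVar p w i) ^ β *
                lnormWN p w (fun x => ENNReal.ofReal |f x|) := by
  intro β hβ
  rintro ⟨C, hC, hyp⟩
  have hp0 : 0 < p := by linarith
  have hp1 : 0 < p - 1 := by linarith
  have eθ : (p / (p - 1)) / p = 1/(p-1) := by field_simp
  rw [eθ] at hβ
  have hpk : ∃ c τ : ℝ, 0 < c ∧ 0 ≤ τ ∧ τ * max β 0 < 1 ∧ ∀ δ, 0 < δ → δ ≤ 1 → Pkg p c τ δ := by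
    rcases le_total p 2 with h | h
    · refine ⟨1/2, p-1, by norm_num, hp1.le, ?_, fun δ h0 h1 => pkgB hp h h0 h1⟩
      have : 1 ≤ 1/(p-1) := by rw [le_div_iff₀ hp1]; linarith
      rw [max_eq_right this] at hβ
      have h3 : max β 0 < 1/(p-1) := max_lt hβ (by positivity)
      rw [lt_div_iff₀ hp1] at h3
      linarith
    · refine ⟨Real.exp (-1), 1, Real.exp_pos _, zero_le_one, ?_, fun δ h0 h1 => pkgA hp h0 h1⟩
      have : 1/(p-1) ≤ 1 := by rw [div_le_iff₀ hp1]; linarith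
      rw [max_eq_left this] at hβ
      rw [one_mul]; exact max_lt hβ one_pos
  obtain ⟨c, τ, hc, hτ, hσ, H⟩ := hpk
  set σ := τ * max β 0 with hσd
  have hb0 : 0 ≤ max β 0 := le_max_right _ _
  have hσ0 : 0 ≤ σ := mul_nonneg hτ hb0
  -- main inequality
  have key : ∀ s : ℝ, 1 ≤ s → (c * s) ^ n ≤ C * ((4 * s) ^ σ) ^ n := by
    intro s hs
    have hs0 : 0 < s := by linarith
    obtain ⟨u, g, Hg, H0, a1, a2, a3, a4, a5, a6, a7, a8, a9, b1, b2, b3⟩ := H (1/s) (by positivity)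
      (by rw [div_le_iff₀ hs0]; linarith)
    have h := tensor n p hp u g Hg H0 _ ENNReal.ofReal_ne_top a1 a2 a3 a4 a5 a6 a7 a8 a9 β C hyp
    set I := ∫⁻ t, ENNReal.ofReal |g t| ^ p * ENNReal.ofReal (u t)
    set J := ∫⁻ t, H0 t ^ p * ENNReal.ofReal (u t)
    have e1 : c / (1/s) = c * s := by field_simp
    have e2 : 4 / (1/s) = 4 * s := by field_simp
    rw [e1] at b3
    rw [e2] at h
    have hIn0 : (I ^ n) ^ (1/p) ≠ 0 := by
      simp [b1, b2, hp0]
    have hInt : (I ^ n) ^ (1/p) ≠ ⊤ := ENNReal.rpow_ne_top_of_nonneg (by positivity) (ENNReal.pow_ne_top b2)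
    have h3 : ENNReal.ofReal (c * s) ^ n * (I ^ n) ^ (1/p) ≤ (J ^ n) ^ (1/p) := by
      have : ENNReal.ofReal (c * s) ^ n = ((ENNReal.ofReal (c*s) ^ p) ^ n) ^ (1/p) := by
        rw [← ENNReal.rpow_natCast, ← ENNReal.rpow_natCast, ← ENNReal.rpow_mul, ← ENNReal.rpow_mul]
        congr 1; field_simp
      rw [this, ← ENNReal.mul_rpow_of_nonneg _ _ (by positivity : 0 ≤ 1/p), ← mul_pow]
      exact ENNReal.rpow_le_rpow (pow_le_pow_left' b3 n) (by positivity)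
    have h4 := (ENNReal.mul_le_mul_iff_left hIn0 hInt).1 (h3.trans h)
    rw [← ENNReal.ofReal_pow (by positivity), ← ENNReal.ofReal_pow (by positivity),
      ENNReal.ofReal_rpow_of_nonneg (by positivity) hb0, ← ENNReal.ofReal_mul hC.le,
      ENNReal.ofReal_le_ofReal_iff (by positivity)] at h4
    refine h4.trans (le_of_eq ?_)
    congr 1
    have h4s : (0:ℝ) ≤ 4 * s := by positivity
    rw [← Real.rpow_natCast (((4*s) ^ τ)) n, ← Real.rpow_natCast ((4*s) ^ σ) n, ← Real.rpow_mul h4s, ← Real.rpow_mul h4s,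
      ← Real.rpow_mul h4s, hσd]
    congr 1; ring
  -- contradiction
  have hn' : (0:ℝ) < n := by exact_mod_cast hn
  have ht : Tendsto (fun s : ℝ => s ^ ((1-σ) * n)) atTop atTop := tendsto_rpow_atTop (mul_pos (by linarith) hn')
  obtain ⟨s, hs1, hs2⟩ := ((ht.eventually_gt_atTop (C * (4 ^ σ) ^ n / c ^ n)).and (eventually_ge_atTop (1:ℝ))).exists
  have hs0 : 0 < s := by linarith
  have h := key s hs2
  rw [div_lt_iff₀ (by positivity)] at hs1
  have e : s ^ n = s ^ ((1-σ)*n) * (s ^ σ) ^ n := by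
    rw [← Real.rpow_natCast, ← Real.rpow_natCast, ← Real.rpow_mul hs0.le, ← Real.rpow_add hs0]
    congr 1; ring
  rw [mul_pow, e, Real.mul_rpow (by norm_num) hs0.le, mul_pow] at h
  have hpos : 0 < (s ^ σ) ^ n := by positivity
  have := mul_lt_mul_of_pos_right hs1 hpos
  nlinarith


/-- Sharp mixed bound for the Hilbert transform with product kernel:
`‖H^{(n)}f‖_{L^p_w} ≤ c (∏ᵢ ‖w‖_{A_p(x_i)})^{max{1,p'/p}} ‖f‖_{L^p_w}` whenever
`w ∈ A_p^{(s)}(ℝⁿ)` (i.e. `w ∈ A_p(x_i)` for all `i`), and the power `max{1,p'/p}`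
is sharp (cannot be replaced by any smaller exponent). -/
theorem stmt17 (n : ℕ) (hn : 0 < n) (p : ℝ) (hp : 1 < p) :
    (∃ c : ℝ, 0 < c ∧
      ∀ w : (Fin n → ℝ) → ℝ, IsWeightN w → (∀ i, apVar p w i ≠ ∞) →
        ∀ f Hf : (Fin n → ℝ) → ℝ,
          (∀ᵐ x : Fin n → ℝ, HasHilbPV n f x (Hf x)) →
          lnormWN p w (fun x => ENNReal.ofReal |Hf x|) ≤
            ENNReal.ofReal c * (∏ i, apVar p w i) ^ max 1 ((p / (p - 1)) / p) *
              lnormWN p w (fun x => ENNReal.ofReal |f x|)) ∧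
    (∀ β : ℝ, β < max 1 ((p / (p - 1)) / p) →
      ¬ ∃ c : ℝ, 0 < c ∧
        ∀ w : (Fin n → ℝ) → ℝ, IsWeightN w → (∀ i, apVar p w i ≠ ∞) →
          ∀ f Hf : (Fin n → ℝ) → ℝ,
            (∀ᵐ x : Fin n → ℝ, HasHilbPV n f x (Hf x)) →
            lnormWN p w (fun x => ENNReal.ofReal |Hf x|) ≤
              ENNReal.ofReal c * (∏ i, apVar p w i) ^ β *
                lnormWN p w (fun x => ENNReal.ofReal |f x|)) := by
  exact ⟨part1 n p hp, part2 n hn p hp⟩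

end
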